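/- arXiv:1805.01630 — 7 statements merged into one kernel-verified Lean document; each statement's English description precedes it below -/
import Mathlib

section
/- Let T > 0 and let b(t,x) : [0,T] × ℝ → ℝ be such that b ∈ L¹(0,T; L¹_loc(ℝ)) and the spatial derivative ∂b/∂x(t,·) belongs to BMO(ℝ) for a.e. t with ∫₀ᵀ ‖∂b/∂x(t,·)‖_* dt < ∞. Then there exists a unique flow φ(t,x) satisfying ∂φ/∂t(t,x) = b(t, φ(t,x)) for all (t,x) ∈ [0,T] × ℝ and φ(0,x) = x for all x ∈ ℝ. Moreover, for each t ∈ [0,T] the function x ↦ |∂φ/∂x(t,x)| is an A_∞(ℝ) weight, and there exist constants C₁, c > 0 such that ‖log|∂φ/∂x(t,·)|‖_BMO ≤ (∫₀ᵗ C₁ ‖∂b/∂x(s,·)‖_BMO ds) · exp(c ∫₀ᵗ ‖∂b/∂x(s,·)‖_BMO ds). -/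
open MeasureTheory Set

/-- Average of `f` over the interval `(a,b)`. -/
noncomputable def avgI (f : ℝ → ℝ) (a b : ℝ) : ℝ := (b - a)⁻¹ * ∫ x in a..b, f x

/-- The set of mean oscillations of `f` over bounded intervals. -/
def oscSet (f : ℝ → ℝ) : Set ℝ :=
  {r : ℝ | ∃ a b : ℝ, a < b ∧ r = avgI (fun x => |f x - avgI f a b|) a b}

/-- The BMO seminorm of `f` (as a supremum of mean oscillations). -/
noncomputable def bmoNorm (f : ℝ → ℝ) : ℝ := sSup (oscSet f)

/-- `f ∈ BMO(ℝ)`: `f` is locally integrable with bounded mean oscillation. -/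
def MemBMO (f : ℝ → ℝ) : Prop :=
  MeasureTheory.LocallyIntegrable f MeasureTheory.volume ∧ BddAbove (oscSet f)

/-- The modified norm `‖f‖_* = ‖f‖_BMO + ∫_{[-1,1]} |f|`. -/
noncomputable def starNorm (f : ℝ → ℝ) : ℝ := bmoNorm f + ∫ x in (-1:ℝ)..1, |f x|

/-- The `A_∞` quotient of `w` over the interval `(a,b)`. -/
noncomputable def ainftyQuot (w : ℝ → ℝ) (a b : ℝ) : ℝ :=
  avgI w a b * Real.exp (-(avgI (fun x => Real.log (w x)) a b))

def ainftySet (w : ℝ → ℝ) : Set ℝ :=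
  {r : ℝ | ∃ a b : ℝ, a < b ∧ r = ainftyQuot w a b}

/-- The `A_∞` constant `[w]_{A_∞}`. -/
noncomputable def ainftyConst (w : ℝ → ℝ) : ℝ := sSup (ainftySet w)

/-- `w` is an `A_∞(ℝ)` weight: nonnegative, locally integrable, finite `A_∞` constant. -/
def IsAinftyWeight (w : ℝ → ℝ) : Prop :=
  (∀ x, 0 ≤ w x) ∧ MeasureTheory.LocallyIntegrable w MeasureTheory.volume ∧
    BddAbove (ainftySet w)

/-- `log⁺ t = max {1, log t}`. -/
noncomputable def logPlus (t : ℝ) : ℝ := max 1 (Real.log t)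

/-- `φ` is a flow of the time-dependent vector field `b` on `[0,T]`: it starts at the identity
and solves `∂φ/∂t = b(t, φ)` in the integral (Carathéodory) sense. -/
def IsFlowOf (T : ℝ) (b : ℝ → ℝ → ℝ) (φ : ℝ → ℝ → ℝ) : Prop :=
  (∀ x : ℝ, φ 0 x = x) ∧
  (∀ x : ℝ, MeasureTheory.IntegrableOn (fun s => b s (φ s x)) (Set.Ioc 0 T)
    MeasureTheory.volume) ∧
  (∀ x : ℝ, ∀ t ∈ Set.Icc (0 : ℝ) T, φ t x = x + ∫ s in (0 : ℝ)..t, b s (φ s x))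

section PartA
open MeasureTheory Set

noncomputable def dyD (g : ℝ → ℝ) : ℕ → ℝ → ℝ → ℝ
  | 0, p, q => ∫ x in p..q, |g x - avgI g p q|
  | n+1, p, q => dyD g n p ((p+q)/2) + dyD g n ((p+q)/2) q

def LInt (g : ℝ → ℝ) : Prop := ∀ a b : ℝ, IntervalIntegrable g volume a b

lemma LInt.abs {g : ℝ → ℝ} (hg : LInt g) : LInt (fun x => |g x|) := fun a b => (hg a b).abs
lemma LInt.sub {g h : ℝ → ℝ} (hg : LInt g) (hh : LInt h) : LInt (fun x => g x - h x) :=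
  fun a b => (hg a b).sub (hh a b)
lemma LInt.const (c : ℝ) : LInt (fun _ => c) := fun _ _ => intervalIntegrable_const
lemma LInt.sup0 {g : ℝ → ℝ} (hg : LInt g) : LInt (fun x => max (g x) 0) := by
  intro a b
  rw [intervalIntegrable_iff]
  exact (intervalIntegrable_iff.1 (hg a b)).pos_part

lemma LInt.osc {g : ℝ → ℝ} (hg : LInt g) (A : ℝ) : LInt (fun x => |g x - A|) :=
  (hg.sub (LInt.const A)).abs

lemma mul_avgI (g : ℝ → ℝ) {p q : ℝ} (h : p < q) : (q - p) * avgI g p q = ∫ x in p..q, g x := by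
  unfold avgI
  have : q - p ≠ 0 := by linarith
  field_simp

lemma int_split {g : ℝ → ℝ} (hg : LInt g) (p m q : ℝ) :
    ∫ x in p..q, g x = (∫ x in p..m, g x) + ∫ x in m..q, g x :=
  (intervalIntegral.integral_add_adjacent_intervals (hg _ _) (hg _ _)).symm

lemma int_mono {g h : ℝ → ℝ} (hg : LInt g) (hh : LInt h) {p q : ℝ} (hpq : p ≤ q)
    (H : ∀ x ∈ Icc p q, g x ≤ h x) : ∫ x in p..q, g x ≤ ∫ x in p..q, h x :=
  intervalIntegral.integral_mono_on hpq (hg _ _) (hh _ _) H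

lemma int_nonneg {g : ℝ → ℝ} {p q : ℝ} (hpq : p ≤ q) (H : ∀ x, 0 ≤ g x) :
    0 ≤ ∫ x in p..q, g x := intervalIntegral.integral_nonneg hpq (fun x _ => H x)

lemma dyD_nonneg (g : ℝ → ℝ) (n : ℕ) : ∀ {p q : ℝ}, p < q → 0 ≤ dyD g n p q := by
  induction n with
  | zero => intro p q h; exact int_nonneg h.le (fun x => abs_nonneg _)
  | succ n ih =>
    intro p q h
    exact add_nonneg (ih (by linarith)) (ih (by linarith))

lemma dyD_perturb {g k : ℝ → ℝ} (hg : LInt g) (hk : LInt k) (n : ℕ) : ∀ {p q : ℝ}, p < q →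
    dyD g n p q ≤ dyD k n p q + 2 * ∫ x in p..q, |g x - k x| := by
  induction n with
  | zero =>
    intro p q h
    simp only [dyD]
    have hA : (q - p) * |avgI k p q - avgI g p q| ≤ ∫ x in p..q, |g x - k x| := by
      rw [← abs_of_pos (sub_pos.2 h), ← abs_mul, mul_sub, mul_avgI _ h, mul_avgI _ h,
        abs_sub_comm, ← intervalIntegral.integral_sub (hg _ _) (hk _ _)]
      exact intervalIntegral.abs_integral_le_integral_abs h.le
    have := int_mono (p := p) (q := q) (hg.osc (avgI g p q))
      (h := fun x => |k x - avgI k p q| + (|g x - k x| + |avgI k p q - avgI g p q|))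
      (fun a b => ((hk.osc _) a b).add (((hg.sub hk).abs a b).add (LInt.const _ a b))) h.le
      (fun x _ => by
        have e : g x - avgI g p q = (k x - avgI k p q) + ((g x - k x) + (avgI k p q - avgI g p q)) := by ring
        rw [e]
        exact (abs_add_le _ _).trans (by gcongr; exact abs_add_le _ _))
    rw [intervalIntegral.integral_add ((hk.osc _) p q) (((hg.sub hk).abs p q).add (LInt.const _ p q)),
      intervalIntegral.integral_add ((hg.sub hk).abs p q) (LInt.const _ p q),
      intervalIntegral.integral_const, smul_eq_mul] at this
    linarith
  | succ n ih =>
    intro p q h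
    simp only [dyD]
    have h1 := ih (p := p) (q := (p+q)/2) (by linarith)
    have h2 := ih (p := (p+q)/2) (q := q) (by linarith)
    rw [int_split (hg.sub hk).abs p ((p+q)/2) q]
    linarith

lemma dyD_cont {k : ℝ → ℝ} (hk : LInt k) {η δ : ℝ} (hδ : ∀ x y, |x - y| ≤ δ → |k x - k y| ≤ η)
    (n : ℕ) : ∀ {p q : ℝ}, p < q → (q - p) / 2 ^ n ≤ δ → dyD k n p q ≤ η * (q - p) := by
  induction n with
  | zero =>
    intro p q h hs
    simp only [dyD]
    have hb : ∀ x ∈ Icc p q, |k x - avgI k p q| ≤ η := by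
      intro x hx
      have : (q - p) * |k x - avgI k p q| ≤ (q - p) * η := by
        rw [← abs_of_pos (sub_pos.2 h), ← abs_mul, abs_of_pos (sub_pos.2 h), mul_sub, mul_avgI _ h]
        have e : (q - p) * k x = ∫ _ in p..q, k x := by simp
        rw [e, ← intervalIntegral.integral_sub (LInt.const _ _ _) (hk _ _)]
        refine (intervalIntegral.abs_integral_le_integral_abs h.le).trans ?_
        refine (int_mono ((LInt.const (k x)).sub hk).abs (LInt.const η) h.le ?_).trans (by simp)
        intro y hy
        apply hδ
        simp only [pow_zero, div_one] at hs
        rw [abs_le]; constructor <;> linarith [hx.1, hx.2, hy.1, hy.2]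
      exact le_of_mul_le_mul_left this (by linarith)
    refine (int_mono (hk.osc _) (LInt.const η) h.le hb).trans ?_
    simp [mul_comm]
  | succ n ih =>
    intro p q h hs
    simp only [dyD]
    have e : (q - p) / 2 ^ (n+1) = ((q - p)/2) / 2 ^ n := by rw [pow_succ]; field_simp
    have h1 := ih (p := p) (q := (p+q)/2) (by linarith)
      (by rw [show (p+q)/2 - p = (q-p)/2 by ring, ← e]; exact hs)
    have h2 := ih (p := (p+q)/2) (q := q) (by linarith)
      (by rw [show q - (p+q)/2 = (q-p)/2 by ring, ← e]; exact hs)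
    nlinarith

lemma dyD_small {g : ℝ → ℝ} (hg : LInt g) {p q : ℝ} (h : p < q) {η : ℝ} (hη : 0 < η) :
    ∃ n0, ∀ n ≥ n0, dyD g n p q ≤ η := by
  have hi : Integrable (indicator (Ioc p q) g) := by
    rw [integrable_indicator_iff measurableSet_Ioc]
    exact (intervalIntegrable_iff_integrableOn_Ioc_of_le h.le).1 (hg p q)
  obtain ⟨k, hkc, hkb, hkcont, hki⟩ := hi.exists_hasCompactSupport_integral_sub_le (ε := η/4) (by linarith)
  have huc := hkc.uniformContinuous_of_continuous hkcont
  have hkL : LInt k := fun a b => hkcont.intervalIntegrable a b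
  have hb : ∫ x in p..q, |g x - k x| ≤ η/4 := by
    refine le_trans ?_ hkb
    rw [intervalIntegral.integral_of_le h.le]
    have : ∫ x in Ioc p q, |g x - k x| = ∫ x in Ioc p q, ‖indicator (Ioc p q) g x - k x‖ := by
      refine setIntegral_congr_fun measurableSet_Ioc ?_
      intro x hx
      simp [indicator_of_mem hx]
    rw [this]
    exact setIntegral_le_integral (hi.sub hki).norm (Filter.Eventually.of_forall fun x => norm_nonneg _)
  have hη' : 0 < η / (2 * (q - p)) := by have := sub_pos.2 h; positivity
  obtain ⟨δ, hδ, hd⟩ := Metric.uniformContinuous_iff.1 huc _ hη'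
  obtain ⟨n0, hn0⟩ := exists_pow_lt_of_lt_one (show 0 < δ / (2 * (q - p)) by have := sub_pos.2 h; positivity)
    (show (1/2 : ℝ) < 1 by norm_num)
  refine ⟨n0, fun n hn => ?_⟩
  have hn1 : (1/2:ℝ)^n ≤ (1/2)^n0 := pow_le_pow_of_le_one (by norm_num) (by norm_num) hn
  have hqp := sub_pos.2 h
  have hs : (q - p) / 2 ^ n ≤ δ / 2 := by
    have : (q - p) / 2^n = (q - p) * (1/2)^n := by rw [one_div, inv_pow]; rfl
    rw [this]
    calc (q-p) * (1/2)^n ≤ (q - p) * (δ / (2 * (q - p))) := by gcongr; linarith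
      _ = δ/2 := by field_simp
  have h1 := dyD_cont hkL (η := η / (2 * (q - p))) (δ := δ/2) (fun x y hxy => by
    have := hd (a := x) (b := y) (by rw [Real.dist_eq]; linarith)
    rw [Real.dist_eq] at this; exact this.le) n h hs
  have h2 := dyD_perturb hg hkL n h
  have : η / (2 * (q - p)) * (q - p) = η/2 := by field_simp
  linarith

lemma cz_aux {g h : ℝ → ℝ} (hg : LInt g) (hh : LInt h) (g0 : ∀ x, 0 ≤ g x) {lam ε : ℝ} (hl : 0 < lam)
    (hε : 0 ≤ ε)
    (hhg : ∀ x, h x ≤ max (g x - lam) 0)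
    (hJ : ∀ p q, p < q → lam * (q - p) < ∫ x in p..q, g x → ∫ x in p..q, g x ≤ 2 * lam * (q - p) →
      ∫ x in p..q, h x ≤ ε * (q - p)) (n : ℕ) :
    ∀ {p q : ℝ}, p < q → ∫ x in p..q, g x ≤ lam * (q - p) →
      ∫ x in p..q, h x ≤ ε / lam * (∫ x in p..q, g x) + dyD g n p q := by
  induction n with
  | zero =>
    intro p q hpq ha
    have hA : avgI g p q ≤ lam := by
      rw [← mul_avgI g hpq, mul_comm] at ha
      exact le_of_mul_le_mul_right ha (sub_pos.2 hpq)
    have : ∫ x in p..q, h x ≤ ∫ x in p..q, |g x - avgI g p q| := by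
      refine int_mono hh (hg.osc _) hpq.le (fun x _ => (hhg x).trans ?_)
      exact max_le ((by linarith : g x - lam ≤ g x - avgI g p q).trans (le_abs_self _)) (abs_nonneg _)
    have h0 : 0 ≤ ε / lam * (∫ x in p..q, g x) := mul_nonneg (by positivity) (int_nonneg hpq.le g0)
    simp only [dyD]; linarith
  | succ n ih =>
    intro p q hpq ha
    have key : ∀ {r s : ℝ}, r < s → s - r = (q-p)/2 → ∫ x in r..s, g x ≤ ∫ x in p..q, g x →
        ∫ x in r..s, h x ≤ ε / lam * (∫ x in r..s, g x) + dyD g n r s := by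
      intro r s hrs e hle
      by_cases hc : ∫ x in r..s, g x ≤ lam * (s - r)
      · exact ih hrs hc
      · push Not at hc
        have h1 := hJ r s hrs hc (by rw [e]; linarith)
        have h2 := dyD_nonneg g n hrs
        have h3 : ε * (s - r) ≤ ε / lam * (∫ x in r..s, g x) := by
          have : ε / lam * (lam * (s - r)) = ε * (s - r) := by field_simp
          rw [← this]; gcongr
        linarith
    have sp := int_split hg p ((p+q)/2) q
    have a1 := int_nonneg (g := g) (p := p) (q := (p+q)/2) (by linarith) g0
    have a2 := int_nonneg (g := g) (p := (p+q)/2) (q := q) (by linarith) g0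
    have k1 := key (r := p) (s := (p+q)/2) (by linarith) (by ring) (by linarith)
    have k2 := key (r := (p+q)/2) (s := q) (by linarith) (by ring) (by linarith)
    rw [int_split hh p ((p+q)/2) q, sp, mul_add]
    simp only [dyD]
    linarith

lemma cz {g h : ℝ → ℝ} (hg : LInt g) (hh : LInt h) (g0 : ∀ x, 0 ≤ g x) {lam ε : ℝ} (hl : 0 < lam)
    (hε : 0 ≤ ε)
    (hhg : ∀ x, h x ≤ max (g x - lam) 0)
    (hJ : ∀ p q, p < q → lam * (q - p) < ∫ x in p..q, g x → ∫ x in p..q, g x ≤ 2 * lam * (q - p) →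
      ∫ x in p..q, h x ≤ ε * (q - p))
    {p q : ℝ} (hpq : p < q) (ha : ∫ x in p..q, g x ≤ lam * (q - p)) :
      ∫ x in p..q, h x ≤ ε / lam * (∫ x in p..q, g x) := by
  refine le_of_forall_pos_le_add fun η hη => ?_
  obtain ⟨n, hn⟩ := dyD_small hg hpq hη
  have := cz_aux hg hh g0 hl hε hhg hJ n hpq ha
  linarith [hn n le_rfl]

lemma avg_diff {f : ℝ → ℝ} (hf : LInt f) (A : ℝ) {p q : ℝ} (h : p < q) :
    (q - p) * |avgI f p q - A| ≤ ∫ x in p..q, |f x - A| := by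
  rw [← abs_of_pos (sub_pos.2 h), ← abs_mul, mul_sub, mul_avgI _ h]
  have e : (q - p) * A = ∫ _ in p..q, A := by simp
  rw [e, ← intervalIntegral.integral_sub (hf _ _) (LInt.const _ _ _)]
  exact intervalIntegral.abs_integral_le_integral_abs h.le

lemma jn_levels {f : ℝ → ℝ} (hf : LInt f) {B : ℝ} (hB : 0 < B)
    (hosc : ∀ c d, c < d → ∫ x in c..d, |f x - avgI f c d| ≤ B * (d - c)) (k : ℕ) :
    ∀ c d, c < d → ∫ x in c..d, max (|f x - avgI f c d| - 4 * k * B) 0 ≤ (1/2)^k * B * (d - c) := by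
  induction k with
  | zero =>
    intro c d h
    simpa using hosc c d h
  | succ k ih =>
    intro c d h
    have hh : LInt (fun x => max (|f x - avgI f c d| - 4 * (k+1 : ℕ) * B) 0) :=
      ((hf.osc _).sub (LInt.const _)).sup0
    have := cz (hf.osc (avgI f c d)) hh (fun x => abs_nonneg _) (lam := 2 * B) (ε := (1/2)^k * B)
      (by linarith) (by positivity)
      (fun x => by
        gcongr; push_cast
        have : (0:ℝ) ≤ k := by positivity
        nlinarith) ?_ h ((hosc c d h).trans ?_)
    · refine this.trans ?_
      have e : (1/2:ℝ)^k * B / (2 * B) = (1/2)^(k+1) := by field_simp; ring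
      rw [e, mul_assoc]
      gcongr
      exact hosc c d h
    · intro p q hpq h1 h2
      refine le_trans ?_ (ih p q hpq)
      refine int_mono hh ((hf.osc _).sub (LInt.const _)).sup0 hpq.le (fun x _ => ?_)
      have h3 := (avg_diff hf (avgI f c d) hpq).trans h2
      have h4 : |avgI f p q - avgI f c d| ≤ 4 * B := by
        rw [mul_comm] at h3
        have := le_of_mul_le_mul_right h3 (sub_pos.2 hpq)
        linarith
      have h5 := abs_sub_le (f x) (avgI f p q) (avgI f c d)
      refine max_le_max ?_ le_rfl
      push_cast
      linarith
    · have := sub_pos.2 h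
      nlinarith

/-- John–Nirenberg type bound. -/
theorem jn_pos {f : ℝ → ℝ} (hf : LInt f) {B : ℝ} (hB : 0 < B)
    (hosc : ∀ c d, c < d → ∫ x in c..d, |f x - avgI f c d| ≤ B * (d - c)) {c d : ℝ} (h : c < d)
    {E : Set ℝ} (hE : MeasurableSet E) (hEs : E ⊆ Ioc c d) (hpos : 0 < volume.real E) :
    |(∫ x in E, f x) - volume.real E * avgI f c d| ≤
      6 * B * volume.real E * (1 + Real.log ((d - c) / volume.real E)) := by
  set v := volume.real E with hv
  set A := avgI f c d with hA
  have hfin : volume E ≠ ⊤ := ne_top_of_le_ne_top (by simp) (measure_mono hEs)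
  have hvle : v ≤ d - c := by
    have := measureReal_mono (μ := volume) hEs (by simp)
    rwa [Real.volume_real_Ioc_of_le h.le] at this
  have hfE : IntegrableOn f E :=
    ((intervalIntegrable_iff_integrableOn_Ioc_of_le h.le).1 (hf c d)).mono_set hEs
  have hcE : IntegrableOn (fun _ : ℝ => A) E := integrableOn_const (by simpa using hfin)
  have e1 : (∫ x in E, f x) - v * A = ∫ x in E, (f x - A) := by
    rw [integral_sub hfE hcE, setIntegral_const, smul_eq_mul]
  rw [e1]
  refine (abs_integral_le_integral_abs).trans ?_
  obtain ⟨k, hk1, hk2⟩ : ∃ k : ℕ, (d - c) / v ≤ 2 ^ k ∧ (k:ℝ) ≤ Real.log ((d-c)/v) / Real.log 2 + 1 := by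
    have h1 : 1 ≤ (d - c)/v := by rw [le_div_iff₀ hpos]; linarith
    refine ⟨⌈Real.log ((d-c)/v) / Real.log 2⌉₊, ?_, ?_⟩
    · have hl2 : 0 < Real.log 2 := Real.log_pos (by norm_num)
      have := Nat.le_ceil (Real.log ((d-c)/v) / Real.log 2)
      rw [div_le_iff₀ hl2, ← Real.log_pow] at this
      exact (Real.log_le_log_iff (by linarith) (by positivity)).1 this
    · exact (Nat.ceil_lt_add_one (div_nonneg (Real.log_nonneg h1) (Real.log_nonneg (by norm_num)))).le
  have hl : LInt (fun x => max (|f x - A| - 4 * k * B) 0) := ((hf.osc _).sub (LInt.const _)).sup0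
  have hlI : IntegrableOn (fun x => max (|f x - A| - 4 * k * B) 0) (Ioc c d) :=
    (intervalIntegrable_iff_integrableOn_Ioc_of_le h.le).1 (hl c d)
  have hconst : IntegrableOn (fun _ : ℝ => 4 * k * B) E := integrableOn_const (by simpa using hfin)
  have e2 : ∫ x in E, |f x - A| ≤ ∫ x in E, (4 * k * B + max (|f x - A| - 4 * k * B) 0) := by
    refine setIntegral_mono (hfE.sub hcE).abs (hconst.add (hlI.mono_set hEs)) (fun x => ?_)
    have := le_max_left (|f x - A| - 4 * k * B) 0
    dsimp only
    linarith
  rw [integral_add hconst (hlI.mono_set hEs), setIntegral_const, smul_eq_mul] at e2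
  have e3 : ∫ x in E, max (|f x - A| - 4 * k * B) 0 ≤ (1/2)^k * B * (d - c) := by
    refine le_trans ?_ (jn_levels hf hB hosc k c d h)
    rw [intervalIntegral.integral_of_le h.le]
    exact setIntegral_mono_set hlI (Filter.Eventually.of_forall fun x => le_max_right _ _)
      (Filter.Eventually.of_forall hEs)
  have e4 : (1/2:ℝ)^k * B * (d - c) ≤ B * v := by
    rw [div_le_iff₀ hpos] at hk1
    have : (1/2:ℝ)^k * (2^k * v) = v := by rw [← mul_assoc, ← mul_pow]; norm_num
    calc (1/2:ℝ)^k * B * (d - c) ≤ (1/2:ℝ)^k * B * (2^k * v) := by gcongr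
      _ = B * ((1/2:ℝ)^k * (2^k * v)) := by ring
      _ = B * v := by rw [this]
  have h1 : 0 ≤ Real.log ((d - c)/v) := Real.log_nonneg (by rw [le_div_iff₀ hpos]; linarith)
  have h2 : Real.log ((d-c)/v) / Real.log 2 ≤ 1.5 * Real.log ((d-c)/v) := by
    have := Real.log_two_gt_d9
    rw [div_le_iff₀ (by linarith)]
    nlinarith
  have h3 : (∫ x in E, |f x - A|) ≤ v * (4 * (1.5 * Real.log ((d-c)/v) + 1) * B) + B * v := by
    have : v * (4 * k * B) ≤ v * (4 * (1.5 * Real.log ((d-c)/v) + 1) * B) := by gcongr; linarith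
    linarith
  refine h3.trans ?_
  have : 0 < B * v := by positivity
  nlinarith

theorem jn {f : ℝ → ℝ} (hf : LInt f) {B : ℝ} 
    (hosc : ∀ c d, c < d → ∫ x in c..d, |f x - avgI f c d| ≤ B * (d - c)) {c d : ℝ} (h : c < d)
    {E : Set ℝ} (hE : MeasurableSet E) (hEs : E ⊆ Ioc c d) (hpos : 0 < volume.real E) :
    |(∫ x in E, f x) - volume.real E * avgI f c d| ≤
      6 * B * volume.real E * (1 + Real.log ((d - c) / volume.real E)) := by
  have hB : 0 ≤ B := by
    have := (int_nonneg (g := fun x => |f x - avgI f c d|) h.le (fun x => abs_nonneg _)).trans (hosc c d h)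
    exact nonneg_of_mul_nonneg_left this (sub_pos.2 h)
  have key : ∀ η > 0, |(∫ x in E, f x) - volume.real E * avgI f c d| ≤
      6 * (B + η) * volume.real E * (1 + Real.log ((d - c) / volume.real E)) := by
    intro η hη
    refine jn_pos hf (by linarith) (fun p q hpq => (hosc p q hpq).trans ?_) h hE hEs hpos
    have := sub_pos.2 hpq
    nlinarith
  have hc : Continuous (fun η : ℝ => 6 * (B + η) * volume.real E * (1 + Real.log ((d - c) / volume.real E))) := by
    fun_prop
  have ht := (hc.tendsto 0).mono_left (nhdsWithin_le_nhds (s := Ioi 0))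
  simp only [add_zero] at ht
  exact ge_of_tendsto ht (Filter.eventually_of_mem self_mem_nhdsWithin key)
end PartA

section PartB
open MeasureTheory Set

noncomputable def dyV (B : ℝ → ℝ) (A : ℝ) : ℕ → ℝ → ℝ → ℝ
  | 0, p, q => |B q - B p - A * (q - p)|
  | n+1, p, q => dyV B A n p ((p+q)/2) + dyV B A n ((p+q)/2) q

lemma dyV_le {f B : ℝ → ℝ} (hf : LInt f) (hB : ∀ x y, B y - B x = ∫ z in x..y, f z) (A : ℝ) (n : ℕ) :
    ∀ {p q : ℝ}, p < q → dyV B A n p q ≤ ∫ x in p..q, |f x - A| := by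
  induction n with
  | zero =>
    intro p q h
    simp only [dyV]
    have e : B q - B p - A * (q - p) = ∫ x in p..q, (f x - A) := by
      rw [intervalIntegral.integral_sub (hf _ _) (LInt.const _ _ _), hB]; simp [mul_comm]
    rw [e]
    exact intervalIntegral.abs_integral_le_integral_abs h.le
  | succ n ih =>
    intro p q h
    simp only [dyV]
    rw [int_split (hf.osc A) p ((p+q)/2) q]
    exact add_le_add (ih (by linarith)) (ih (by linarith))

lemma le_dyV {f B : ℝ → ℝ} (hf : LInt f) (hB : ∀ x y, B y - B x = ∫ z in x..y, f z) (A : ℝ) (n : ℕ) :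
    ∀ {p q : ℝ}, p < q → ∫ x in p..q, |f x - A| ≤ dyV B A n p q + dyD (fun x => f x - A) n p q := by
  induction n with
  | zero =>
    intro p q h
    simp only [dyV, dyD]
    have e : B q - B p - A * (q - p) = ∫ x in p..q, (f x - A) := by
      rw [intervalIntegral.integral_sub (hf _ _) (LInt.const _ _ _), hB]; simp [mul_comm]
    rw [e, ← mul_avgI (fun x => f x - A) h, abs_mul, abs_of_pos (sub_pos.2 h)]
    set F := fun x => f x - A with hF
    have hFL : LInt F := hf.sub (LInt.const A)
    have := int_mono (p := p) (q := q) hFL.abs (h := fun x => |avgI F p q| + |F x - avgI F p q|)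
      (fun a b => (LInt.const _ a b).add (hFL.osc _ a b)) h.le (fun x _ => by
        have := abs_add_le (avgI F p q) (F x - avgI F p q)
        simpa using this)
    rw [intervalIntegral.integral_add (LInt.const _ p q) (hFL.osc _ p q),
      intervalIntegral.integral_const, smul_eq_mul] at this
    exact this
  | succ n ih =>
    intro p q h
    simp only [dyV, dyD]
    rw [int_split (hf.osc A) p ((p+q)/2) q]
    have h1 := ih (p := p) (q := (p+q)/2) (by linarith)
    have h2 := ih (p := (p+q)/2) (q := q) (by linarith)
    linarith

lemma int_le_iff_dyV {f B : ℝ → ℝ} (hf : LInt f) (hB : ∀ x y, B y - B x = ∫ z in x..y, f z) (A : ℝ)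
    {p q : ℝ} (h : p < q) (r : ℝ) : ∫ x in p..q, |f x - A| ≤ r ↔ ∀ n, dyV B A n p q ≤ r := by
  constructor
  · intro H n; exact (dyV_le hf hB A n h).trans H
  · intro H
    refine le_of_forall_pos_le_add fun η hη => ?_
    obtain ⟨n, hn⟩ := dyD_small (hf.sub (LInt.const A)) h hη
    have := le_dyV hf hB A n h
    linarith [hn n le_rfl, H n]

lemma dyV_cont {B : ℝ → ℝ} (hB : Continuous B) (n : ℕ) :
    Continuous (fun u : ℝ × ℝ × ℝ => dyV B u.1 n u.2.1 u.2.2) := by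
  induction n with
  | zero => simp only [dyV]; fun_prop
  | succ n ih =>
    simp only [dyV]
    exact (ih.comp (f := fun u : ℝ × ℝ × ℝ => (u.1, u.2.1, (u.2.1+u.2.2)/2)) (by fun_prop)).add
      (ih.comp (f := fun u : ℝ × ℝ × ℝ => (u.1, (u.2.1+u.2.2)/2, u.2.2)) (by fun_prop))

lemma dyV_meas {B : ℝ → ℝ → ℝ} (hB : ∀ x, Measurable (fun t => B t x)) {A : ℝ → ℝ} (hA : Measurable A)
    (n : ℕ) : ∀ p q, Measurable (fun t => dyV (B t) (A t) n p q) := by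
  induction n with
  | zero =>
    intro p q; simp only [dyV]
    exact (((hB q).sub (hB p)).sub (hA.mul_const _)).abs
  | succ n ih =>
    intro p q
    simp only [dyV]
    exact (ih _ _).add (ih _ _)

lemma MemBMO.lint {f : ℝ → ℝ} (h : MemBMO f) : LInt f := fun _ _ =>
  intervalIntegrable_iff.2 ((h.1.integrableOn_isCompact isCompact_uIcc).mono_set uIoc_subset_uIcc)

lemma avgI_le_iff (g : ℝ → ℝ) {c d : ℝ} (h : c < d) (r : ℝ) :
    avgI g c d ≤ r ↔ ∫ x in c..d, g x ≤ r * (d - c) := by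
  rw [← mul_avgI g h, mul_comm, mul_le_mul_iff_left₀ (sub_pos.2 h)]

lemma oscSet_ne (f : ℝ → ℝ) : (oscSet f).Nonempty := ⟨_, 0, 1, by norm_num, rfl⟩

lemma bmoNorm_le_iff {f : ℝ → ℝ} (h : MemBMO f) (r : ℝ) :
    bmoNorm f ≤ r ↔ ∀ c d, c < d → ∫ x in c..d, |f x - avgI f c d| ≤ r * (d - c) := by
  unfold bmoNorm
  rw [csSup_le_iff h.2 (oscSet_ne f)]
  constructor
  · intro H c d hcd
    exact (avgI_le_iff _ hcd r).1 (H _ ⟨c, d, hcd, rfl⟩)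
  · rintro H _ ⟨c, d, hcd, rfl⟩
    exact (avgI_le_iff _ hcd r).2 (H c d hcd)

lemma bmoNorm_nonneg (f : ℝ → ℝ) : 0 ≤ bmoNorm f := by
  refine Real.sSup_nonneg ?_
  rintro _ ⟨c, d, hcd, rfl⟩
  exact mul_nonneg (inv_nonneg.2 (by linarith)) (int_nonneg hcd.le fun x => abs_nonneg _)

lemma prim_cont {f B : ℝ → ℝ} (hf : LInt f) (hB : ∀ x y, B y - B x = ∫ z in x..y, f z) : Continuous B := by
  have : B = fun x => B 0 + ∫ z in (0:ℝ)..x, f z := by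
    funext x; rw [← hB 0 x]; ring
  rw [this]
  exact continuous_const.add (intervalIntegral.continuous_primitive hf 0)

lemma bmo_iff_dyV {f B : ℝ → ℝ} (h : MemBMO f) (hB : ∀ x y, B y - B x = ∫ z in x..y, f z) (r : ℝ) :
    bmoNorm f ≤ r ↔ ∀ (c d : ℚ), (c:ℝ) < d → ∀ n, dyV B ((d - c : ℝ)⁻¹ * (B d - B c)) n c d ≤ r * (d - c) := by
  have hA : ∀ c d, avgI f c d = (d - c)⁻¹ * (B d - B c) := fun c d => by rw [hB]; rfl
  rw [bmoNorm_le_iff h]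
  constructor
  · intro H c d hcd
    rw [← int_le_iff_dyV h.lint hB _ hcd, ← hA]
    exact H c d hcd
  · intro H c d hcd
    rw [hA, int_le_iff_dyV h.lint hB _ hcd]
    intro n
    have hcB := prim_cont h.lint hB
    have hco : ContinuousOn (fun u : ℝ × ℝ => dyV B ((u.2 - u.1)⁻¹ * (B u.2 - B u.1)) n u.1 u.2 - r * (u.2 - u.1))
        {u : ℝ × ℝ | u.1 < u.2} := by
      refine ContinuousOn.sub ?_ (by fun_prop)
      refine (dyV_cont hcB n).comp_continuousOn
        (f := fun u : ℝ × ℝ => ((u.2 - u.1)⁻¹ * (B u.2 - B u.1), u.1, u.2)) ?_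
      refine ContinuousOn.prodMk (ContinuousOn.mul (ContinuousOn.inv₀ (by fun_prop) ?_) (by fun_prop)) (by fun_prop)
      intro u hu
      have : u.1 < u.2 := hu
      linarith
    have hop : IsOpen {u : ℝ × ℝ | u.1 < u.2} := isOpen_lt continuous_fst continuous_snd
    by_contra hcon
    push Not at hcon
    have hopen := hco.isOpen_inter_preimage hop isOpen_Ioi (t := Ioi 0)
    have hdense : DenseRange (Prod.map ((↑) : ℚ → ℝ) ((↑) : ℚ → ℝ)) :=
      Rat.denseRange_cast.prodMap Rat.denseRange_cast
    obtain ⟨⟨c', d'⟩, hm⟩ := hdense.exists_mem_open hopen ⟨(c, d), hcd, by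
      simp only [mem_preimage, mem_Ioi]; linarith⟩
    have h1 : (c':ℝ) < d' := hm.1
    have h2 := hm.2
    simp only [mem_preimage, mem_Ioi, Prod.map] at h2
    linarith [H c' d' h1 n]

lemma bmo_meas {b b' : ℝ → ℝ → ℝ} (h1 : ∀ t x y, b t y - b t x = ∫ z in x..y, b' t z)
    (h2 : ∀ t, MemBMO (b' t)) (h3 : ∀ x, Measurable (fun t => b t x)) :
    Measurable (fun t => bmoNorm (b' t)) := by
  refine measurable_of_Iic fun r => ?_
  have : (fun t => bmoNorm (b' t)) ⁻¹' Iic r = ⋂ (c : ℚ), ⋂ (d : ℚ), ⋂ (_ : (c:ℝ) < d), ⋂ n,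
      {t | dyV (b t) ((d - c : ℝ)⁻¹ * (b t d - b t c)) n c d ≤ r * (d - c)} := by
    ext t
    simp only [mem_preimage, mem_Iic, mem_iInter, mem_ofPred_eq]
    exact bmo_iff_dyV (h2 t) (h1 t) r
  rw [this]
  refine MeasurableSet.iInter fun c => MeasurableSet.iInter fun d => MeasurableSet.iInter fun _ =>
    MeasurableSet.iInter fun n => ?_
  exact measurableSet_le (dyV_meas h3 (((h3 _).sub (h3 _)).const_mul _) n _ _) measurable_const

lemma memBMO_zero : MemBMO (fun _ : ℝ => (0:ℝ)) := by
  refine ⟨locallyIntegrable_const 0, 0, ?_⟩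
  rintro _ ⟨c, d, h, rfl⟩
  simp [avgI]

lemma bmoNorm_zero : bmoNorm (fun _ : ℝ => (0:ℝ)) = 0 := by
  refine le_antisymm ((bmoNorm_le_iff memBMO_zero 0).2 ?_) (bmoNorm_nonneg _)
  intro c d h
  simp [avgI]
end PartB

section PartC
open MeasureTheory Set

structure Clean (f f' : ℝ → ℝ → ℝ) (β m : ℝ → ℝ) : Prop where
  prim : ∀ t x y, f t y - f t x = ∫ z in x..y, f' t z
  lint : ∀ t, LInt (f' t)
  osc : ∀ t c d, c < d → ∫ x in c..d, |f' t x - avgI (f' t) c d| ≤ β t * (d - c)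
  meas : ∀ x, Measurable (fun t => f t x)
  mbd : ∀ t, (∫ x in (-1:ℝ)..1, |f' t x|) + |f t 0| + β t ≤ m t
  bI : Integrable β
  mI : Integrable m

namespace Clean
variable {f f' : ℝ → ℝ → ℝ} {β m : ℝ → ℝ}

lemma b0 (h : Clean f f' β m) (t : ℝ) : 0 ≤ β t := by
  have := (int_nonneg (g := fun x => |f' t x - avgI (f' t) 0 1|) zero_le_one
    (fun x => abs_nonneg _)).trans (h.osc t 0 1 one_pos)
  linarith

lemma i0 (t : ℝ) : 0 ≤ (∫ x in (-1:ℝ)..1, |f' t x|) := int_nonneg (by norm_num) (fun x => abs_nonneg _)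

lemma m0 (h : Clean f f' β m) (t : ℝ) : 0 ≤ m t := by
  have := h.mbd t
  have := h.b0 t
  have := i0 (f' := f') t
  have := abs_nonneg (f t 0)
  linarith

lemma cont (h : Clean f f' β m) (t : ℝ) : Continuous (f t) := prim_cont (h.lint t) (h.prim t)

lemma measurable_comp (h : Clean f f' β m) {x : ℝ → ℝ} (hx : Measurable x) :
    Measurable (fun s => f s (x s)) := by
  have := measurable_uncurry_of_continuous_of_measurable (u := fun x t => f t x) h.cont h.meas
  exact this.comp (hx.prodMk measurable_id)

lemma logLip (h : Clean f f' β m) (t : ℝ) {R x y : ℝ} (hR : 1 ≤ R) (hx : -R ≤ x) (hxy : x < y) (hy : y ≤ R) :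
    |f t y - f t x| ≤ 6 * m t * (y - x) * (3 + 2 * Real.log R + |Real.log (y - x)|) := by
  have hp : 0 < y - x := by linarith
  have hb := h.b0 t
  have hm := h.mbd t
  have hi := i0 (f' := f') t
  have h0 := abs_nonneg (f t 0)
  have hm0 := h.m0 t
  have hlR : 0 ≤ Real.log R := Real.log_nonneg hR
  have l2 : Real.log 2 ≤ 1 := by linarith [Real.log_two_lt_d9]
  have v1 : volume.real (Ioc x y) = y - x := Real.volume_real_Ioc_of_le hxy.le
  have v2 : volume.real (Ioc (-1:ℝ) 1) = 2 := by rw [Real.volume_real_Ioc_of_le (by norm_num)]; norm_num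
  have j1 := jn (h.lint t) (h.osc t) (c := -R) (d := R) (by linarith) (E := Ioc x y) measurableSet_Ioc
    (Ioc_subset_Ioc hx hy) (by rw [v1]; exact hp)
  have j2 := jn (h.lint t) (h.osc t) (c := -R) (d := R) (by linarith) (E := Ioc (-1) 1) measurableSet_Ioc
    (Ioc_subset_Ioc (by linarith) hR) (by rw [v2]; norm_num)
  rw [v1, ← intervalIntegral.integral_of_le hxy.le, ← h.prim] at j1
  rw [v2, ← intervalIntegral.integral_of_le (by norm_num)] at j2
  set A := avgI (f' t) (-R) R
  have a1 : |∫ z in (-1:ℝ)..1, f' t z| ≤ ∫ x in (-1:ℝ)..1, |f' t x| :=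
    intervalIntegral.abs_integral_le_integral_abs (by norm_num)
  have e2 : (R - -R) / 2 = R := by ring
  rw [e2] at j2
  have hA : |A| ≤ 6 * m t * (1 + Real.log R) := by
    have : 2 * |A| ≤ |∫ z in (-1:ℝ)..1, f' t z| + |(∫ z in (-1:ℝ)..1, f' t z) - 2 * A| := by
      have := abs_sub_abs_le_abs_sub (2 * A) (∫ z in (-1:ℝ)..1, f' t z)
      rw [abs_mul, abs_two, abs_sub_comm (2 * A)] at this
      linarith
    have h6 : (∫ x in (-1:ℝ)..1, |f' t x|) ≤ 12 * (m t - β t) * (1 + Real.log R) := by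
      nlinarith
    nlinarith
  have e1 : Real.log ((R - -R) / (y - x)) ≤ 1 + Real.log R + |Real.log (y - x)| := by
    rw [Real.log_div (by linarith) (by linarith), show R - -R = 2 * R by ring,
      Real.log_mul (by norm_num) (by linarith)]
    linarith [neg_abs_le (Real.log (y - x))]
  have : |f t y - f t x| ≤ (y - x) * |A| + |f t y - f t x - (y - x) * A| := by
    have := abs_sub_abs_le_abs_sub (f t y - f t x) ((y - x) * A)
    rw [abs_mul, abs_of_pos hp] at this
    linarith
  refine this.trans ?_
  have k1 : (y - x) * |A| ≤ (y - x) * (6 * m t * (1 + Real.log R)) := by gcongr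
  have k2 : 6 * β t * (y - x) * (1 + Real.log ((R - -R) / (y - x))) ≤
      6 * m t * (y - x) * (2 + Real.log R + |Real.log (y - x)|) := by
    have habs := abs_nonneg (Real.log (y - x))
    calc _ ≤ 6 * β t * (y - x) * (2 + Real.log R + |Real.log (y - x)|) :=
          mul_le_mul_of_nonneg_left (by linarith) (by positivity)
      _ ≤ _ := by gcongr; linarith
  nlinarith

lemma growth (h : Clean f f' β m) (t x : ℝ) :
    |f t x| ≤ 18 * m t * ((1 + |x|) * (1 + Real.log (1 + x^2))) := by
  have hb := h.b0 t
  have hm := h.mbd t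
  have hi := i0 (f' := f') t
  have h0 := abs_nonneg (f t 0)
  have hm0 := h.m0 t
  have hlog : 0 ≤ Real.log (1 + x^2) := Real.log_nonneg (by nlinarith)
  have hx0 := abs_nonneg x
  have hbig : 1 ≤ (1 + |x|) * (1 + Real.log (1 + x^2)) := by nlinarith
  have tri : |f t x| ≤ |f t 0| + |f t x - f t 0| := by
    have := abs_add_le (f t 0) (f t x - f t 0); simpa using this
  by_cases hx : |x| ≤ 1
  · have : |f t x - f t 0| ≤ ∫ z in (-1:ℝ)..1, |f' t z| := by
      rw [h.prim]
      refine (intervalIntegral.norm_integral_le_integral_norm_uIoc (f := f' t)).trans ?_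
      rw [intervalIntegral.integral_of_le (by norm_num)]
      refine setIntegral_mono_set ((intervalIntegrable_iff_integrableOn_Ioc_of_le (by norm_num)).1
        ((h.lint t).abs (-1) 1)) (Filter.Eventually.of_forall fun x => abs_nonneg _)
        (Filter.Eventually.of_forall ?_)
      rw [abs_le] at hx
      intro z hz
      have hz : z ∈ uIoc 0 x := hz
      show z ∈ Ioc (-1:ℝ) 1
      rw [mem_uIoc] at hz
      rcases hz with hz | hz <;> exact ⟨by linarith [hz.1], by linarith [hz.2]⟩
    nlinarith
  · push Not at hx
    have hl1 : Real.log |x| ≤ Real.log (1 + x^2) / 2 := by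
      have : Real.log (x^2) ≤ Real.log (1+x^2) := Real.log_le_log (by rw [← sq_abs]; positivity) (by linarith)
      rw [← sq_abs, Real.log_pow] at this
      rw [sq_abs] at this
      push_cast at this; linarith
    have hl0 : 0 ≤ Real.log |x| := Real.log_nonneg hx.le
    have : |f t x - f t 0| ≤ 6 * m t * |x| * (3 + 2 * Real.log |x| + |Real.log (|x|)|) := by
      rcases lt_or_ge 0 x with hp | hn
      · have := h.logLip t (R := |x|) (x := 0) (y := x) hx.le (by linarith) hp (le_abs_self x)
        rw [sub_zero] at this
        rwa [abs_of_pos hp] at this ⊢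
      · have hneg : x < 0 := lt_of_le_of_ne hn (by rintro rfl; simp at hx; linarith)
        have := h.logLip t (R := |x|) (x := x) (y := 0) hx.le (neg_abs_le x) hneg (by linarith)
        rw [zero_sub] at this
        rw [abs_sub_comm]
        rwa [abs_of_neg hneg] at this ⊢
    rw [abs_of_nonneg hl0] at this
    have k : 6 * m t * |x| * (3 + 2 * Real.log |x| + Real.log |x|) ≤ 18 * m t * (|x| * (1 + Real.log (1 + x^2))) := by
      have : 6 * m t * |x| * (3 + 2 * Real.log |x| + Real.log |x|) = 18 * m t * (|x| * (1 + Real.log |x|)) := by ring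
      rw [this]
      exact mul_le_mul_of_nonneg_left (mul_le_mul_of_nonneg_left (by linarith) hx0) (by positivity)
    have : |f t 0| ≤ 18 * m t * (1 + Real.log (1 + x^2)) := by nlinarith
    nlinarith
end Clean
end PartC

section PartD
open MeasureTheory Set Filter Topology

lemma ac_comp {v Φ : ℝ → ℝ} {a b : ℝ} (hv : AbsolutelyContinuousOnInterval v a b) {K : ℝ} 
    (hΦ : ∀ s ∈ uIcc a b, ∀ t ∈ uIcc a b, |Φ (v s) - Φ (v t)| ≤ K * |v s - v t|) :
    AbsolutelyContinuousOnInterval (fun s => Φ (v s)) a b := by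
  unfold AbsolutelyContinuousOnInterval at *
  have h2 := hv.const_mul K
  rw [mul_zero] at h2
  refine squeeze_zero' (Eventually.of_forall fun E => Finset.sum_nonneg fun i _ => dist_nonneg) ?_ h2
  rw [eventually_inf_principal]
  refine Eventually.of_forall fun E hE => ?_
  rw [Finset.mul_sum]
  refine Finset.sum_le_sum fun i hi => ?_
  rw [Real.dist_eq, Real.dist_eq]
  exact hΦ _ (hE.1 i hi).1 _ (hE.1 i hi).2

lemma ac_congr {v w : ℝ → ℝ} {a b : ℝ} (hv : AbsolutelyContinuousOnInterval v a b)
    (h : ∀ s ∈ uIcc a b, w s = v s) : AbsolutelyContinuousOnInterval w a b := by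
  unfold AbsolutelyContinuousOnInterval at *
  refine hv.congr' ?_
  filter_upwards [mem_inf_of_right (mem_principal_self _)] with E hE
  refine Finset.sum_congr rfl fun i hi => ?_
  rw [h _ (hE.1 i hi).1, h _ (hE.1 i hi).2]

lemma ac_bound {v k : ℝ → ℝ} {a b : ℝ} (hab : a ≤ b) (hv : AbsolutelyContinuousOnInterval v a b)
    (hk : IntervalIntegrable k volume a b)
    (h : ∀ᵐ s, s ∈ Ioo a b → ∃ v', HasDerivAt v v' s ∧ |v'| ≤ k s) :
    |v b - v a| ≤ ∫ s in a..b, k s := by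
  rw [← hv.integral_deriv_eq_sub]
  refine (intervalIntegral.abs_integral_le_integral_abs hab).trans ?_
  refine intervalIntegral.integral_mono_ae_restrict hab hv.intervalIntegrable_deriv.abs hk ?_
  have hne : ∀ᵐ s : ℝ, s ≠ a ∧ s ≠ b := by
    simp only [eventually_and]
    exact ⟨by simp [ae_iff, measure_singleton], by simp [ae_iff, measure_singleton]⟩
  filter_upwards [ae_restrict_mem measurableSet_Icc, ae_restrict_of_ae h, ae_restrict_of_ae hne] with s hs h1 h2
  obtain ⟨v', hv', hle⟩ := h1 ⟨lt_of_le_of_ne hs.1 (Ne.symm h2.1), lt_of_le_of_ne hs.2 h2.2⟩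
  rw [hv'.deriv]; exact hle

/-- Carathéodory solution. -/
def Sol (T : ℝ) (f : ℝ → ℝ → ℝ) (x : ℝ → ℝ) : Prop :=
  IntegrableOn (fun s => f s (x s)) (Ioc 0 T) ∧ ∀ t ∈ Icc 0 T, x t = x 0 + ∫ s in (0:ℝ)..t, f s (x s)

namespace Sol
variable {T : ℝ} {f : ℝ → ℝ → ℝ} {x y : ℝ → ℝ}

lemma ii (h : Sol T f x) (hT : 0 ≤ T) : IntervalIntegrable (fun s => f s (x s)) volume 0 T :=
  (intervalIntegrable_iff_integrableOn_Ioc_of_le hT).2 h.1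

lemma ac (h : Sol T f x) (hT : 0 ≤ T) : AbsolutelyContinuousOnInterval x 0 T := by
  have h1 := (h.ii hT).absolutelyContinuousOnInterval_intervalIntegral (c := 0) (by simp)
  have h2 : AbsolutelyContinuousOnInterval (fun _ : ℝ => x 0) 0 T :=
    (LipschitzWith.const (x 0)).lipschitzOnWith.absolutelyContinuousOnInterval
  refine ac_congr (h2.add h1) fun s hs => ?_
  rw [uIcc_of_le hT] at hs
  exact h.2 s hs

lemma ac' (h : Sol T f x) {a b : ℝ} (ha : 0 ≤ a) (hab : a ≤ b) (hb : b ≤ T) :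
    AbsolutelyContinuousOnInterval x a b :=
  (h.ac (by linarith)).mono (by rw [uIcc_of_le hab, uIcc_of_le (by linarith)]; exact Icc_subset_Icc ha hb)

lemma contOn (h : Sol T f x) (hT : 0 ≤ T) : ContinuousOn x (Icc 0 T) := by
  have := (h.ac hT).continuousOn
  rwa [uIcc_of_le hT] at this

lemma deriv (h : Sol T f x) (hT : 0 ≤ T) : ∀ᵐ s, s ∈ Ioo 0 T → HasDerivAt x (f s (x s)) s := by
  filter_upwards [(h.ii hT).ae_hasDerivAt_integral] with s hs hsI
  rw [uIcc_of_le hT] at hs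
  have := (hs ⟨hsI.1.le, hsI.2.le⟩ 0 ⟨le_rfl, hT⟩).const_add (x 0)
  refine this.congr_of_eventuallyEq ?_
  filter_upwards [Ioo_mem_nhds hsI.1 hsI.2] with r hr
  exact h.2 r ⟨hr.1.le, hr.2.le⟩
end Sol

lemma log_lip {m u v : ℝ} (hm : 0 < m) (hu : m ≤ u) (hv : m ≤ v) :
    |Real.log u - Real.log v| ≤ m⁻¹ * |u - v| := by
  have key : ∀ {u v : ℝ}, m ≤ u → m ≤ v → Real.log u - Real.log v ≤ m⁻¹ * |u - v| := by
    intro u v hu hv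
    have hu0 : 0 < u := by linarith
    have hv0 : 0 < v := by linarith
    rw [← Real.log_div hu0.ne' hv0.ne']
    have h1 := Real.log_le_sub_one_of_pos (div_pos hu0 hv0)
    have h2 : u / v - 1 = v⁻¹ * (u - v) := by field_simp
    rw [h2] at h1
    refine h1.trans ?_
    calc v⁻¹ * (u - v) ≤ v⁻¹ * |u - v| := by gcongr; exact le_abs_self _
      _ ≤ m⁻¹ * |u - v| := by gcongr
  rw [abs_le]
  constructor
  · have := key hv hu; rw [abs_sub_comm] at this; linarith
  · exact key hu hv

lemma ac_log {v : ℝ → ℝ} {a b : ℝ} (hv : AbsolutelyContinuousOnInterval v a b)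
    (h0 : ∀ s ∈ uIcc a b, 0 < v s) : AbsolutelyContinuousOnInterval (fun s => Real.log (v s)) a b := by
  obtain ⟨s0, hs0, hmin⟩ := isCompact_uIcc.exists_isMinOn nonempty_uIcc hv.continuousOn
  exact ac_comp hv (Φ := Real.log) (K := (v s0)⁻¹) fun s hs t ht =>
    log_lip (h0 _ hs0) (hmin hs) (hmin ht)

lemma ac_const (c a b : ℝ) : AbsolutelyContinuousOnInterval (fun _ : ℝ => c) a b :=
    (LipschitzWith.const c).lipschitzOnWith.absolutelyContinuousOnInterval

section P4
variable {f f' : ℝ → ℝ → ℝ} {β m : ℝ → ℝ}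

lemma aux_ineq1 (L : ℝ) : |2 * L / (1 + L^2)| * (1 + |L|) ≤ 3 := by
  rw [abs_div, abs_of_pos (show 0 < 1 + L^2 by positivity), div_mul_eq_mul_div, div_le_iff₀ (by positivity),
    abs_mul, abs_two]
  have := sq_abs L
  nlinarith [sq_nonneg (|L| - 1), abs_nonneg L]

/-- separation of trajectories: log-log bound -/
lemma sep {x y : ℝ → ℝ} {T : ℝ} (hc : Clean f f' β m) (hx : Sol T f x) (hy : Sol T f y) {R : ℝ} (hR : 1 ≤ R)
    (hxR : ∀ t ∈ Icc 0 T, |x t| ≤ R) (hyR : ∀ t ∈ Icc 0 T, |y t| ≤ R) {a b : ℝ} (ha : 0 ≤ a) (hab : a ≤ b)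
    (hb : b ≤ T) (hlt : ∀ t ∈ Icc a b, x t < y t) :
    |Real.log (1 + Real.log (y b - x b)^2) - Real.log (1 + Real.log (y a - x a)^2)| ≤
      18 * (3 + 2 * Real.log R) * ∫ s, m s := by
  have hT : 0 ≤ T := by linarith
  have hlR : 0 ≤ Real.log R := Real.log_nonneg hR
  have acδ : AbsolutelyContinuousOnInterval (fun s => y s - x s) a b := (hy.ac' ha hab hb).sub (hx.ac' ha hab hb)
  have acL := ac_log acδ (fun s hs => by rw [uIcc_of_le hab] at hs; linarith [hlt s hs])
  have ac2 : AbsolutelyContinuousOnInterval (fun s => 1 + Real.log (y s - x s)^2) a b := by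
    simp only [pow_two]
    exact (ac_const 1 a b).add (acL.mul acL)
  have ac3 := ac_log ac2 (fun s hs => by positivity)
  have hki : IntervalIntegrable (fun s => 18 * (3 + 2 * Real.log R) * m s) volume a b :=
    (hc.mI.const_mul _).intervalIntegrable
  have := ac_bound hab ac3 hki ?_
  · refine this.trans ?_
    rw [intervalIntegral.integral_const_mul]
    gcongr
    rw [intervalIntegral.integral_of_le hab]
    exact setIntegral_le_integral hc.mI (Eventually.of_forall hc.m0)
  · filter_upwards [hx.deriv hT, hy.deriv hT] with s h1 h2 hs
    have hs1 : s ∈ Ioo 0 T := ⟨by linarith [hs.1], by linarith [hs.2]⟩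
    have hs2 : s ∈ Icc 0 T := ⟨hs1.1.le, hs1.2.le⟩
    have hl := hlt s ⟨hs.1.le, hs.2.le⟩
    have hpos : 0 < y s - x s := by linarith
    have d1 := (h2 hs1).sub (h1 hs1)
    have hq : 1 + ((fun r => Real.log ((y - x) r)) ^ 2) s ≠ 0 := by
      have : 0 < 1 + (Real.log ((y - x) s)) ^ 2 := by positivity
      exact this.ne'
    have d2 := (((d1.log hpos.ne').pow 2).const_add 1).log hq
    refine ⟨_, d2, ?_⟩
    have lip := hc.logLip s hR (abs_le.1 (hxR s hs2)).1 hl (abs_le.1 (hyR s hs2)).2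
    have hm := hc.m0 s
    simp only [Pi.pow_apply, Pi.sub_apply, Nat.cast_ofNat, Nat.reduceSub, pow_one]
    set L := Real.log (y s - x s) with hL
    have e : 2 * L * ((f s (y s) - f s (x s)) / (y s - x s)) / (1 + L^2) =
      (2 * L / (1 + L^2)) * ((f s (y s) - f s (x s)) / (y s - x s)) := by ring
    rw [e, abs_mul]
    have q : |(f s (y s) - f s (x s)) / (y s - x s)| ≤ 6 * m s * (3 + 2 * Real.log R) * (1 + |L|) := by
      rw [abs_div, abs_of_pos hpos, div_le_iff₀ hpos]
      refine lip.trans ?_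
      have : 3 + 2 * Real.log R + |L| ≤ (3 + 2 * Real.log R) * (1 + |L|) := by nlinarith [abs_nonneg L]
      calc _ ≤ 6 * m s * (y s - x s) * ((3 + 2 * Real.log R) * (1 + |L|)) := by gcongr
        _ = _ := by ring
    calc _ ≤ |2 * L / (1 + L^2)| * (6 * m s * (3 + 2 * Real.log R) * (1 + |L|)) := by gcongr
      _ = 6 * m s * (3 + 2 * Real.log R) * (|2 * L / (1 + L^2)| * (1 + |L|)) := by ring
      _ ≤ 6 * m s * (3 + 2 * Real.log R) * 3 := by gcongr; exact aux_ineq1 L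
      _ = _ := by ring

lemma Sol.bdd {T : ℝ} {x : ℝ → ℝ} (hx : Sol T f x) (hT : 0 ≤ T) : ∃ R, 1 ≤ R ∧ ∀ t ∈ Icc 0 T, |x t| ≤ R := by
  obtain ⟨C, hC⟩ := (hx.ac hT).exists_bound
  rw [uIcc_of_le hT] at hC
  exact ⟨max 1 C, le_max_left _ _, fun t ht => (hC t ht).trans (le_max_right _ _)⟩

/-- if the trajectories are strictly ordered on (a,b) with a limit collision at one endpoint: contradiction. -/
lemma no_collide {x y : ℝ → ℝ} {T : ℝ} (hc : Clean f f' β m) (hx : Sol T f x) (hy : Sol T f y) (hT : 0 ≤ T)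
    {t0 t1 : ℝ} (h0 : t0 ∈ Icc 0 T) (h1 : t1 ∈ Icc 0 T) (hlt : x t1 < y t1) : x t0 < y t0 := by
  obtain ⟨R1, hR1, hx1⟩ := hx.bdd hT
  obtain ⟨R2, hR2, hy2⟩ := hy.bdd hT
  set R := max R1 R2
  have hxR : ∀ t ∈ Icc 0 T, |x t| ≤ R := fun t ht => (hx1 t ht).trans (le_max_left _ _)
  have hyR : ∀ t ∈ Icc 0 T, |y t| ≤ R := fun t ht => (hy2 t ht).trans (le_max_right _ _)
  have hR : 1 ≤ R := hR1.trans (le_max_left _ _)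
  set M := 18 * (3 + 2 * Real.log R) * ∫ s, m s
  have hδc : ContinuousOn (fun t => y t - x t) (Icc 0 T) := (hy.contOn hT).sub (hx.contOn hT)
  -- lower bound valid on any ordered interval with endpoint t1
  obtain ⟨ε, hε, hbound⟩ : ∃ ε > 0, ∀ t ∈ Icc 0 T, (∀ s ∈ uIcc t t1, x s < y s) → ε < y t - x t := by
    refine ⟨Real.exp (-(Real.exp (M + Real.log (1 + Real.log (y t1 - x t1)^2)) + 1)), Real.exp_pos _, fun t ht hs => ?_⟩
    have hpos : 0 < y t - x t := by linarith [hs t left_mem_uIcc]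
    have key : Real.log (1 + Real.log (y t - x t)^2) ≤ M + Real.log (1 + Real.log (y t1 - x t1)^2) := by
      rcases le_total t t1 with hle | hle
      · rw [uIcc_of_le hle] at hs
        have := sep hc hx hy hR hxR hyR ht.1 hle h1.2 hs
        rw [abs_le] at this; linarith [this.1]
      · rw [uIcc_of_ge hle] at hs
        have := sep hc hx hy hR hxR hyR h1.1 hle ht.2 hs
        rw [abs_le] at this; linarith [this.2]
    rw [← Real.lt_log_iff_exp_lt hpos]
    have k2 : 1 + Real.log (y t - x t)^2 ≤ Real.exp (M + Real.log (1 + Real.log (y t1 - x t1)^2)) := by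
      rw [← Real.log_le_iff_le_exp (by positivity)]; exact key
    have k3 := sq_nonneg (Real.log (y t - x t) + 1)
    nlinarith [sq_nonneg (Real.log (y t - x t) - 1), sq_nonneg (Real.log (y t - x t))]
  by_contra hcon
  push Not at hcon
  -- connectedness: set where ordered between
  have hsub : uIcc t0 t1 ⊆ Icc 0 T := by
    rw [← uIcc_of_le hT]; exact uIcc_subset_uIcc (by rwa [uIcc_of_le hT]) (by rwa [uIcc_of_le hT])
  -- closest collision time to t1
  set Z := {t ∈ uIcc t0 t1 | y t - x t ≤ 0}
  have hZc : IsCompact Z := by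
    have : IsClosed Z := by
      have := (hδc.mono hsub).preimage_isClosed_of_isClosed isClosed_Icc (isClosed_Iic (a := (0:ℝ)))
      exact this
    exact isCompact_uIcc.of_isClosed_subset this (fun t ht => ht.1)
  have hZne : Z.Nonempty := ⟨t0, left_mem_uIcc, by linarith⟩
  obtain ⟨z, hz, hzmin⟩ := hZc.exists_isMinOn hZne (f := fun t => |t - t1|) (by fun_prop)
  have hzT := hsub hz.1
  have hbetween : ∀ s ∈ uIcc z t1, s ≠ z → x s < y s := by
    intro s hs hne
    by_contra hcc
    push Not at hcc
    have hsZ : s ∈ Z := ⟨uIcc_subset_uIcc hz.1 right_mem_uIcc hs, by linarith⟩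
    have := hzmin hsZ
    simp only [mem_ofPred_eq] at this
    rcases le_total z t1 with hle | hle
    · rw [uIcc_of_le hle] at hs
      rw [abs_of_nonpos (by linarith), abs_of_nonpos (by linarith [hs.2])] at this
      exact hne (le_antisymm (by linarith) hs.1)
    · rw [uIcc_of_ge hle] at hs
      rw [abs_of_nonneg (by linarith), abs_of_nonneg (by linarith [hs.1])] at this
      exact hne (le_antisymm hs.2 (by linarith))
  have hzt : z ≠ t1 := by rintro rfl; have : y z - x z ≤ 0 := hz.2; linarith
  -- approach z from within
  set g : ℝ → ℝ := fun θ => z + θ * (t1 - z) with hg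
  have hgmem : ∀ θ ∈ Icc (0:ℝ) 1, g θ ∈ uIcc z t1 := by
    intro θ hθ
    rw [mem_uIcc]
    rcases le_total z t1 with hle | hle
    · left; constructor <;> simp only [hg] <;> nlinarith [hθ.1, hθ.2]
    · right; constructor <;> simp only [hg] <;> nlinarith [hθ.1, hθ.2]
  have hsub2 : uIcc z t1 ⊆ Icc 0 T := (uIcc_subset_uIcc hz.1 right_mem_uIcc).trans hsub
  have hcomp : ContinuousOn (fun θ => y (g θ) - x (g θ)) (Icc 0 1) :=
    hδc.comp (f := g) (by fun_prop) (fun θ hθ => hsub2 (hgmem θ hθ))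
  have hge : ∀ θ ∈ Ioc (0:ℝ) 1, ε < y (g θ) - x (g θ) := by
    intro θ hθ
    refine hbound _ (hsub2 (hgmem θ ⟨hθ.1.le, hθ.2⟩)) fun s hs => ?_
    have hs' : s ∈ uIcc z t1 := uIcc_subset_uIcc (hgmem θ ⟨hθ.1.le, hθ.2⟩) right_mem_uIcc hs
    refine hbetween s hs' ?_
    rintro rfl
    rw [mem_uIcc] at hs
    simp only [hg] at hs
    have hθ0 := hθ.1
    rcases lt_or_gt_of_ne hzt with hlt' | hlt'
    · have : 0 < θ * (t1 - s) := mul_pos hθ0 (by linarith)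
      rcases hs with hs | hs <;> linarith [hs.1, hs.2]
    · have : 0 < θ * (s - t1) := mul_pos hθ0 (by linarith)
      rcases hs with hs | hs <;> nlinarith [hs.1, hs.2]
  have hlim : Tendsto (fun θ => y (g θ) - x (g θ)) (𝓝[Ioc 0 1] 0) (𝓝 (y (g 0) - x (g 0))) :=
    (hcomp 0 ⟨le_rfl, zero_le_one⟩).mono_left (nhdsWithin_mono _ Ioc_subset_Icc_self)
  have hnb : (𝓝[Ioc (0:ℝ) 1] 0).NeBot := by
    rw [nhdsWithin_Ioc_eq_nhdsGT one_pos]; infer_instance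
  have := ge_of_tendsto hlim (eventually_of_mem self_mem_nhdsWithin fun θ hθ => (hge θ hθ).le)
  have hg0 : g 0 = z := by simp [hg]
  rw [hg0] at this
  have h3 : y z - x z ≤ 0 := hz.2
  linarith

lemma sol_unique {x y : ℝ → ℝ} {T : ℝ} (hc : Clean f f' β m) (hx : Sol T f x) (hy : Sol T f y) (hT : 0 ≤ T)
    (h0 : x 0 = y 0) {t : ℝ} (ht : t ∈ Icc 0 T) : x t = y t := by
  rcases lt_trichotomy (x t) (y t) with h | h | h
  · have := no_collide hc hx hy hT ⟨le_rfl, hT⟩ ht h; linarith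
  · exact h
  · have := no_collide hc hy hx hT ⟨le_rfl, hT⟩ ht h; linarith

end P4
end PartD

section PartE
open MeasureTheory Set Filter Topology

section P5
open BoundedContinuousFunction

noncomputable def tonP (g : ℝ → ℝ → ℝ) (x0 h : ℝ) (y : ℝ → ℝ) : ℝ → ℝ :=
  fun t => x0 + ∫ s in (0:ℝ)..t, g s (y (s - h))

variable {g : ℝ → ℝ → ℝ} {k : ℝ → ℝ}

lemma car_int (hc : ∀ t, Continuous (g t)) (hm : ∀ x, Measurable fun t => g t x) (hk : Integrable k)
    (hb : ∀ t x, |g t x| ≤ k t) {y : ℝ → ℝ} (hy : Measurable y) : Integrable (fun s => g s (y s)) := by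
  have := measurable_uncurry_of_continuous_of_measurable (u := fun x t => g t x) hc hm
  have h2 : Measurable (fun s => g s (y s)) := this.comp (hy.prodMk measurable_id)
  exact hk.mono' h2.aestronglyMeasurable (Eventually.of_forall fun s => hb s _)

lemma tonP_diff (hc : ∀ t, Continuous (g t)) (hm : ∀ x, Measurable fun t => g t x) (hk : Integrable k)
    (hb : ∀ t x, |g t x| ≤ k t) (x0 h : ℝ) {y : ℝ → ℝ} (hy : Measurable y) (s t : ℝ) :
    |tonP g x0 h y t - tonP g x0 h y s| ≤ |(∫ r in (0:ℝ)..t, k r) - ∫ r in (0:ℝ)..s, k r| := by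
  have hi := car_int hc hm hk hb (y := fun s => y (s - h)) (hy.comp (measurable_id.sub_const h))
  unfold tonP
  rw [add_sub_add_left_eq_sub, intervalIntegral.integral_interval_sub_left hi.intervalIntegrable hi.intervalIntegrable,
    intervalIntegral.integral_interval_sub_left hk.intervalIntegrable hk.intervalIntegrable]
  exact intervalIntegral.norm_integral_le_abs_of_norm_le (f := fun s => g s (y (s - h))) (Eventually.of_forall fun r => hb _ _) hk.intervalIntegrable

lemma tonP_cont (hc : ∀ t, Continuous (g t)) (hm : ∀ x, Measurable fun t => g t x) (hk : Integrable k)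
    (hb : ∀ t x, |g t x| ≤ k t) (x0 h : ℝ) {y : ℝ → ℝ} (hy : Measurable y) : Continuous (tonP g x0 h y) := by
  have hi := car_int hc hm hk hb (y := fun s => y (s - h)) (hy.comp (measurable_id.sub_const h))
  exact continuous_const.add (intervalIntegral.continuous_primitive (fun a b => hi.intervalIntegrable) 0)

lemma ton_iter_cont (hc : ∀ t, Continuous (g t)) (hm : ∀ x, Measurable fun t => g t x) (hk : Integrable k)
    (hb : ∀ t x, |g t x| ≤ k t) (x0 h : ℝ) (n : ℕ) : Continuous ((tonP g x0 h)^[n] (fun _ => x0)) := by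
  cases n with
  | zero => exact continuous_const
  | succ n =>
    induction n with
    | zero => exact tonP_cont hc hm hk hb x0 h measurable_const
    | succ n ih =>
      rw [Function.iterate_succ_apply']
      exact tonP_cont hc hm hk hb x0 h ih.measurable

lemma ton_stable (h0 : ∀ t ≤ 0, ∀ x, g t x = 0) (x0 h : ℝ) (hh : 0 ≤ h) (n : ℕ) : ∀ t ≤ n * h,
    (tonP g x0 h)^[n+1] (fun _ => x0) t = (tonP g x0 h)^[n] (fun _ => x0) t := by
  induction n with
  | zero =>
    intro t ht
    simp only [Nat.cast_zero, zero_mul] at ht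
    simp only [zero_add, Function.iterate_one, Function.iterate_zero, id]
    unfold tonP
    rw [intervalIntegral.integral_of_ge ht, setIntegral_congr_fun measurableSet_Ioc (g := fun _ => (0:ℝ))
      (fun s hs => h0 s hs.2 _)]
    simp
  | succ n ih =>
    intro t ht
    rw [Function.iterate_succ_apply']
    conv_rhs => rw [Function.iterate_succ_apply']
    have aux : ∀ u : ℝ → ℝ, tonP g x0 h u t = x0 + ∫ s in (0:ℝ)..t, g s (u (s - h)) := fun u => rfl
    rw [aux, aux]
    congr 1
    refine intervalIntegral.integral_congr fun s hs => ?_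
    have : s - h ≤ n * h := by
      push_cast at ht
      have hn : 0 ≤ n * h := by positivity
      rw [mem_uIcc] at hs
      rcases hs with hs | hs <;> linarith [hs.2]
    have := ih _ this
    exact congrArg (g s) this

lemma ton_delay (hc : ∀ t, Continuous (g t)) (hm : ∀ x, Measurable fun t => g t x) (hk : Integrable k)
    (hb : ∀ t x, |g t x| ≤ k t) (h0 : ∀ t ≤ 0, ∀ x, g t x = 0) {T : ℝ} (hT : 0 < T) (x0 : ℝ) (n : ℕ) :
    ∃ y : ℝ → ℝ, Continuous y ∧ (∀ t ≤ T, y t = tonP g x0 (T / (n+1)) y t) ∧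
      ∀ s t, |y t - y s| ≤ |(∫ r in (0:ℝ)..t, k r) - ∫ r in (0:ℝ)..s, k r| := by
  set h := T / (n+1)
  refine ⟨(tonP g x0 h)^[n+1] (fun _ => x0), ton_iter_cont hc hm hk hb x0 h _, fun t ht => ?_, fun s t => ?_⟩
  · have := ton_stable h0 x0 h (by positivity) (n+1) t (by 
      simp only [h]; push_cast; rw [mul_div_cancel₀ _ (by positivity)]; exact ht)
    rw [Function.iterate_succ_apply' _ (n+1)] at this
    exact this.symm
  · rw [Function.iterate_succ_apply']
    exact tonP_diff hc hm hk hb x0 h (ton_iter_cont hc hm hk hb x0 h n).measurable s t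

lemma caratheodory (hc : ∀ t, Continuous (g t)) (hm : ∀ x, Measurable fun t => g t x) (hk : Integrable k)
    (hb : ∀ t x, |g t x| ≤ k t) (h0 : ∀ t ≤ 0, ∀ x, g t x = 0) {T : ℝ} (hT : 0 < T) (x0 : ℝ) :
    ∃ x : ℝ → ℝ, Continuous x ∧ ∀ t ∈ Icc 0 T, x t = x0 + ∫ s in (0:ℝ)..t, g s (x s) := by
  choose y ycont ysol ydiff using fun n => ton_delay hc hm hk hb h0 hT x0 n
  set κ : ℝ → ℝ := fun t => ∫ r in (0:ℝ)..t, k r with hκ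
  have κc : Continuous κ := intervalIntegral.continuous_primitive (fun a b => hk.intervalIntegrable) 0
  have k0 : ∀ t, 0 ≤ k t := fun t => (abs_nonneg _).trans (hb t 0)
  have κ0 : κ 0 = 0 := by simp [hκ]
  have y0 : ∀ n, y n 0 = x0 := fun n => by rw [ysol n 0 hT.le]; simp [tonP]
  let Y : ℕ → (Icc (0:ℝ) T →ᵇ ℝ) := fun n => BoundedContinuousFunction.mkOfCompact
    ⟨fun t => y n t, (ycont n).comp continuous_subtype_val⟩
  obtain ⟨C, hC⟩ := (isCompact_Icc (a := (0:ℝ)) (b := T)).exists_bound_of_continuousOn κc.continuousOn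
  have hcomp : IsCompact (closure (range Y)) := by
    refine arzela_ascoli (Metric.closedBall x0 C) (isCompact_closedBall _ _) _ ?_ ?_
    · rintro _ t ⟨n, rfl⟩
      rw [Metric.mem_closedBall, Real.dist_eq]
      have := ydiff n 0 t
      rw [y0] at this
      simp only [intervalIntegral.integral_same, sub_zero] at this
      exact this.trans (hC t t.2)
    · intro t
      refine Metric.equicontinuousAt_of_continuity_modulus (fun s : Icc (0:ℝ) T => |κ t - κ s|) ?_ _ ?_
      · have : Continuous (fun s : Icc (0:ℝ) T => |κ t - κ s|) := by fun_prop
        have := this.tendsto t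
        simpa using this
      · refine Eventually.of_forall ?_
        rintro s ⟨_, n, rfl⟩
        rw [Real.dist_eq]
        exact ydiff n s t
  obtain ⟨X, -, σ, hσ, hlim⟩ := hcomp.tendsto_subseq (fun n => subset_closure (mem_range_self n))
  have hlim' : ∀ t : Icc (0:ℝ) T, Tendsto (fun n => y (σ n) t) atTop (𝓝 (X t)) := fun t =>
    ((BoundedContinuousFunction.tendsto_iff_tendstoUniformly.1 hlim).tendsto_at t)
  refine ⟨IccExtend hT.le X, X.continuous.Icc_extend', fun t ht => ?_⟩
  have e1 : Tendsto (fun n => y (σ n) t) atTop (𝓝 (IccExtend hT.le X t)) := by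
    rw [IccExtend_of_mem _ _ ht]; exact hlim' ⟨t, ht⟩
  have hstep : Tendsto (fun n : ℕ => T / ((σ n : ℝ) + 1)) atTop (𝓝 0) :=
    (tendsto_const_div_atTop_nhds_zero_nat T).comp (tendsto_add_atTop_nat 1 |>.comp hσ.tendsto_atTop) |>.congr fun n => by simp
  have e2 : Tendsto (fun n => ∫ s in (0:ℝ)..t, g s (y (σ n) (s - T / ((σ n : ℝ) + 1)))) atTop
      (𝓝 (∫ s in (0:ℝ)..t, g s (IccExtend hT.le X s))) := by
    refine intervalIntegral.tendsto_integral_filter_of_dominated_convergence k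
      (Eventually.of_forall fun n => ?_) (Eventually.of_forall fun n => Eventually.of_forall fun s _ => hb _ _)
      hk.intervalIntegrable (Eventually.of_forall fun s hs => ?_)
    · exact (car_int hc hm hk hb (y := fun s => y (σ n) (s - T / ((σ n : ℝ) + 1)))
        ((ycont _).measurable.comp (measurable_id.sub_const _))).aestronglyMeasurable.restrict
    · refine ((hc s).tendsto _).comp ?_
      rw [uIoc_of_le ht.1] at hs
      have hsT : s ∈ Icc 0 T := ⟨hs.1.le, hs.2.trans ht.2⟩
      rw [IccExtend_of_mem _ _ hsT]
      refine (hlim' ⟨s, hsT⟩).congr_dist ?_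
      refine squeeze_zero (fun _ => dist_nonneg) (g := fun n => |κ s - κ (s - T / ((σ n : ℝ) + 1))|) (fun n => ?_) ?_
      · rw [Real.dist_eq]; exact ydiff (σ n) _ _
      · have : Continuous fun r => |κ s - κ (s - r)| := by fun_prop
        have := (this.tendsto 0).comp hstep
        simpa [Function.comp_def] using this
  refine tendsto_nhds_unique e1 ((e2.const_add x0).congr fun n => ?_)
  exact (ysol (σ n) t ht.2).symm
end P5
end PartE

section PartF
open MeasureTheory Set Filter Topology

section P5b
variable {f f' : ℝ → ℝ → ℝ} {β m : ℝ → ℝ}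

lemma clamp_abs {R x : ℝ} (hR : 0 ≤ R) : |max (-R) (min R x)| ≤ |x| ∧ |max (-R) (min R x)| ≤ R := by
  refine ⟨?_, ?_⟩
  · rcases le_total R x with h1 | h1
    · rw [min_eq_left h1, max_eq_right (by linarith), abs_of_nonneg hR]; exact h1.trans (le_abs_self x)
    · rw [min_eq_right h1]
      rcases le_total (-R) x with h2 | h2
      · rw [max_eq_right h2]
      · rw [max_eq_left h2, abs_neg, abs_of_nonneg hR]; linarith [neg_abs_le x]
  · rw [abs_le]; exact ⟨le_max_left _ _, max_le (by linarith) (min_le_left _ _)⟩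

lemma growth_mono {u v : ℝ} (h : |u| ≤ |v|) : (1 + |u|) * (1 + Real.log (1 + u^2)) ≤ (1 + |v|) * (1 + Real.log (1 + v^2)) := by
  have h2 : u^2 ≤ v^2 := sq_le_sq.2 h
  have h3 : 0 ≤ Real.log (1 + u^2) := Real.log_nonneg (by nlinarith)
  have h4 : Real.log (1 + u^2) ≤ Real.log (1 + v^2) := Real.log_le_log (by positivity) (by linarith)
  have := abs_nonneg u
  exact mul_le_mul (by linarith) (by linarith) (by linarith) (by linarith [abs_nonneg v])

lemma apriori {g : ℝ → ℝ → ℝ} {x : ℝ → ℝ} {T : ℝ} (hT : 0 ≤ T) (hx : Sol T g x) (mI : Integrable m)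
    (m0 : ∀ t, 0 ≤ m t)
    (hg : ∀ t x, |g t x| ≤ 18 * m t * ((1 + |x|) * (1 + Real.log (1 + x^2)))) :
    ∀ t ∈ Icc 0 T, Real.log (1 + Real.log (1 + x t^2)) ≤ Real.log (1 + Real.log (1 + x 0^2)) + 54 * ∫ s, m s := by
  intro t ht
  have l0 : ∀ r : ℝ, 0 ≤ Real.log (1 + r^2) := fun r => Real.log_nonneg (by nlinarith)
  have acx := hx.ac' le_rfl ht.1 ht.2
  have ac2 : AbsolutelyContinuousOnInterval (fun s => 1 + x s^2) 0 t := by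
    simp only [pow_two]
    exact (ac_const 1 0 t).add (acx.mul acx)
  have ac3 := (ac_const 1 0 t).add (ac_log ac2 (fun s hs => by positivity))
  have ac4 := ac_log ac3 (fun s hs => by have := l0 (x s); simp only [Pi.add_apply]; linarith)
  have := ac_bound (k := fun s => 54 * m s) ht.1 ac4 ((mI.const_mul _).intervalIntegrable) ?_
  · rw [abs_le] at this
    have h2 := this.2
    rw [intervalIntegral.integral_const_mul, intervalIntegral.integral_of_le ht.1] at h2
    have h3 := setIntegral_le_integral (s := Ioc 0 t) mI (Eventually.of_forall m0)
    simp only [Pi.add_apply] at h2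
    linarith
  · filter_upwards [hx.deriv hT] with s h1 hs
    have d := h1 ⟨hs.1, by linarith [hs.2, ht.2]⟩
    have hq : 1 + (x ^ 2) s ≠ 0 := by
      have : 0 < 1 + (x s) ^ 2 := by positivity
      exact this.ne'
    have hl := l0 (x s)
    have hq2 : 1 + Real.log (1 + (x ^ 2) s) ≠ 0 := by
      have : 0 < 1 + Real.log (1 + (x s) ^ 2) := by linarith
      exact this.ne'
    have d2 := (((d.pow 2).const_add 1).log hq).const_add 1 |>.log hq2
    refine ⟨_, d2, ?_⟩
    simp only [Pi.pow_apply, Nat.cast_ofNat, Nat.reduceSub, pow_one]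
    rw [abs_div, abs_div, abs_of_pos (show 0 < 1 + Real.log (1 + x s^2) by linarith),
      abs_of_pos (show 0 < 1 + x s^2 by positivity), div_le_iff₀ (by linarith), div_le_iff₀ (by positivity),
      abs_mul, abs_mul, abs_two]
    have hm := m0 s
    have hx0 := abs_nonneg (x s)
    have key : 2 * |x s| * (1 + |x s|) ≤ 3 * (1 + x s^2) := by
      have := sq_abs (x s)
      nlinarith [sq_nonneg (|x s| - 1)]
    calc _ ≤ 2 * |x s| * (18 * m s * ((1 + |x s|) * (1 + Real.log (1 + x s^2)))) := by gcongr; exact hg _ _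
      _ = 18 * m s * (1 + Real.log (1 + x s^2)) * (2 * |x s| * (1 + |x s|)) := by ring
      _ ≤ 18 * m s * (1 + Real.log (1 + x s^2)) * (3 * (1 + x s^2)) :=
          mul_le_mul_of_nonneg_left key (by positivity)
      _ = _ := by ring

lemma exists_sol (h : Clean f f' β m) {T : ℝ} (hT : 0 < T) (x0 : ℝ) : ∃ x : ℝ → ℝ, x 0 = x0 ∧ Sol T f x := by
  set M := Real.log (1 + Real.log (1 + x0^2)) + 54 * ∫ s, m s
  set R := Real.exp (Real.exp M) with hR
  have hR0 : 0 ≤ R := (Real.exp_pos _).le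
  set g : ℝ → ℝ → ℝ := fun t x => if 0 < t then f t (max (-R) (min R x)) else 0 with hg
  have hgc : ∀ t, Continuous (g t) := by
    intro t
    simp only [hg]
    split_ifs
    · exact (h.cont t).comp (by fun_prop)
    · exact continuous_const
  have hgm : ∀ x, Measurable fun t => g t x := fun x =>
    Measurable.ite measurableSet_Ioi (h.meas _) measurable_const
  have hgb : ∀ t x, |g t x| ≤ 18 * m t * ((1 + |x|) * (1 + Real.log (1 + x^2))) ∧
      |g t x| ≤ 18 * m t * ((1 + |R|) * (1 + Real.log (1 + R^2))) := by
    intro t x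
    have hm := h.m0 t
    have l0 : ∀ r : ℝ, 0 ≤ Real.log (1 + r^2) := fun r => Real.log_nonneg (by nlinarith)
    have := l0 x
    have := l0 R
    simp only [hg]
    split_ifs
    · obtain ⟨c1, c2⟩ := clamp_abs (x := x) hR0
      exact ⟨(h.growth t _).trans (mul_le_mul_of_nonneg_left (growth_mono c1) (by positivity)),
        (h.growth t _).trans (mul_le_mul_of_nonneg_left (growth_mono (c2.trans (le_abs_self R))) (by positivity))⟩
    · rw [abs_zero]; constructor <;> positivity
  have hkI : Integrable (fun t => 18 * m t * ((1 + |R|) * (1 + Real.log (1 + R^2)))) :=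
    (h.mI.const_mul 18).mul_const _
  obtain ⟨x, hxc, hx⟩ := caratheodory hgc hgm hkI (fun t x => (hgb t x).2)
    (fun t ht x => by simp only [hg]; rw [if_neg (by linarith)]) hT x0
  have hx0 : x 0 = x0 := by rw [hx 0 ⟨le_rfl, hT.le⟩]; simp
  have hgi := car_int hgc hgm hkI (fun t x => (hgb t x).2) hxc.measurable
  have hsol : Sol T g x := ⟨hgi.integrableOn, fun t ht => by rw [hx0]; exact hx t ht⟩
  have hap := apriori hT.le hsol h.mI h.m0 (fun t x => (hgb t x).1)
  rw [hx0] at hap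
  have hbd : ∀ t ∈ Icc 0 T, |x t| ≤ R := by
    intro t ht
    have l0 : 0 ≤ Real.log (1 + x t^2) := Real.log_nonneg (by nlinarith)
    have h1 := hap t ht
    rw [Real.log_le_iff_le_exp (by linarith)] at h1
    have h2 : Real.log (1 + x t^2) ≤ Real.exp M := by linarith
    rw [Real.log_le_iff_le_exp (by positivity)] at h2
    have := sq_abs (x t)
    nlinarith [sq_nonneg (|x t| - 1), abs_nonneg (x t)]
  have heq : ∀ t ∈ Ioc 0 T, g t (x t) = f t (x t) := by
    intro t ht
    have := abs_le.1 (hbd t ⟨ht.1.le, ht.2⟩)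
    simp only [hg]
    rw [if_pos ht.1, min_eq_right this.2, max_eq_right this.1]
  refine ⟨x, hx0, (hsol.1.congr_fun heq measurableSet_Ioc), fun t ht => ?_⟩
  rw [hsol.2 t ht]
  congr 1
  rw [intervalIntegral.integral_of_le ht.1, intervalIntegral.integral_of_le ht.1]
  exact setIntegral_congr_fun measurableSet_Ioc fun s hs => heq s ⟨hs.1, hs.2.trans ht.2⟩
end P5b
end PartF

section PartG
open MeasureTheory Set Filter Topology

section P6
variable {f f' : ℝ → ℝ → ℝ} {β m : ℝ → ℝ}

structure FlowB (T : ℝ) (f φ : ℝ → ℝ → ℝ) : Prop where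
  start : ∀ x, φ 0 x = x
  sol : ∀ x, Sol T f (fun t => φ t x)

lemma FlowB.mono {T : ℝ} {φ : ℝ → ℝ → ℝ} (h : Clean f f' β m) (hφ : FlowB T f φ) (hT : 0 ≤ T) {t : ℝ}
    (ht : t ∈ Icc 0 T) : StrictMono (φ t) := by
  intro x y hxy
  refine no_collide h (hφ.sol x) (hφ.sol y) hT ht ⟨le_rfl, hT⟩ ?_
  simp only [hφ.start]; exact hxy

lemma Ioc_disj_iff {a b c d : ℝ} (h1 : a < b) (h2 : c < d) : Disjoint (Ioc a b) (Ioc c d) ↔ b ≤ c ∨ d ≤ a := by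
  rw [Ioc_disjoint_Ioc]
  simp only [min_le_iff, le_max_iff]
  constructor
  · rintro ((h | h) | (h | h))
    · linarith
    · exact Or.inr h
    · exact Or.inl h
    · linarith
  · rintro (h | h)
    · exact Or.inr (Or.inl h)
    · exact Or.inl (Or.inr h)

lemma static_len {ι : Type*} {s : Finset ι} {u v : ι → ℝ} {c d : ℝ}
    (huv : ∀ i ∈ s, u i < v i) (hc : ∀ i ∈ s, c ≤ u i) (hd : ∀ i ∈ s, v i ≤ d)
    (hdis : (s : Set ι).PairwiseDisjoint fun i => Ioc (u i) (v i)) (hcd : c ≤ d) :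
    volume.real (⋃ i ∈ s, Ioc (u i) (v i)) = ∑ i ∈ s, (v i - u i) ∧ ∑ i ∈ s, (v i - u i) ≤ d - c := by
  have e : volume.real (⋃ i ∈ s, Ioc (u i) (v i)) = ∑ i ∈ s, (v i - u i) := by
    rw [measureReal_biUnion_finset hdis (fun i _ => measurableSet_Ioc) (fun i _ => measure_Ioc_lt_top.ne)]
    exact Finset.sum_congr rfl fun i hi => Real.volume_real_Ioc_of_le (huv i hi).le
  refine ⟨e, ?_⟩
  rw [← e, ← Real.volume_real_Ioc_of_le hcd]
  exact measureReal_mono (iUnion₂_subset fun i hi => Ioc_subset_Ioc (hc i hi) (hd i hi)) measure_Ioc_lt_top.ne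

lemma static {ι : Type*} (h : Clean f f' β m) (t : ℝ) {s : Finset ι} (hs : s.Nonempty) {u v : ι → ℝ} {c d : ℝ}
    (huv : ∀ i ∈ s, u i < v i) (hc : ∀ i ∈ s, c ≤ u i) (hd : ∀ i ∈ s, v i ≤ d)
    (hdis : (s : Set ι).PairwiseDisjoint fun i => Ioc (u i) (v i)) (hcd : c < d) :
    |(∑ i ∈ s, (f t (v i) - f t (u i))) - (∑ i ∈ s, (v i - u i)) * ((f t d - f t c) / (d - c))| ≤
      6 * β t * (∑ i ∈ s, (v i - u i)) * (1 + Real.log ((d - c) / ∑ i ∈ s, (v i - u i))) := by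
  obtain ⟨e, -⟩ := static_len huv hc hd hdis hcd.le
  have hpos : 0 < ∑ i ∈ s, (v i - u i) := Finset.sum_pos (fun i hi => by linarith [huv i hi]) hs
  have := jn (h.lint t) (h.osc t) hcd (E := ⋃ i ∈ s, Ioc (u i) (v i))
    (s.measurableSet_biUnion fun i _ => measurableSet_Ioc)
    (iUnion₂_subset fun i hi => Ioc_subset_Ioc (hc i hi) (hd i hi)) (by rw [e]; exact hpos)
  rw [e, integral_biUnion_finset s (fun i _ => measurableSet_Ioc) hdis] at this
  · have e2 : ∑ i ∈ s, ∫ x in Ioc (u i) (v i), f' t x = ∑ i ∈ s, (f t (v i) - f t (u i)) :=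
      Finset.sum_congr rfl fun i hi => by rw [h.prim, intervalIntegral.integral_of_le (huv i hi).le]
    have e3 : avgI (f' t) c d = (f t d - f t c) / (d - c) := by
      unfold avgI; rw [h.prim]; ring
    rwa [e2, e3] at this
  · intro i hi
    exact (intervalIntegrable_iff_integrableOn_Ioc_of_le (huv i hi).le).1 (h.lint t _ _)

lemma ac_sum {ι : Type*} {s : Finset ι} {F : ι → ℝ → ℝ} {a b : ℝ}
    (h : ∀ i ∈ s, AbsolutelyContinuousOnInterval (F i) a b) :
    AbsolutelyContinuousOnInterval (fun r => ∑ i ∈ s, F i r) a b := by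
  classical
  induction s using Finset.induction_on with
  | empty => simp only [Finset.sum_empty]; exact ac_const 0 a b
  | insert i s hi ih =>
    simp only [Finset.sum_insert hi]
    exact (h i (Finset.mem_insert_self _ _)).add (ih fun j hj => h j (Finset.mem_insert_of_mem hj))

lemma evol {ι : Type*} {T : ℝ} {φ : ℝ → ℝ → ℝ} (h : Clean f f' β m) (hφ : FlowB T f φ) (hT : 0 ≤ T) {t : ℝ}
    (ht : t ∈ Icc 0 T) {s : Finset ι} (hs : s.Nonempty) {u v : ι → ℝ} {c d : ℝ}
    (huv : ∀ i ∈ s, u i < v i) (hc : ∀ i ∈ s, c ≤ u i) (hd : ∀ i ∈ s, v i ≤ d)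
    (hdis : (s : Set ι).PairwiseDisjoint fun i => Ioc (u i) (v i)) (hcd : c < d) :
    |Real.log (1 + (Real.log (φ t d - φ t c) - Real.log (∑ i ∈ s, (φ t (v i) - φ t (u i))))) -
      Real.log (1 + (Real.log (d - c) - Real.log (∑ i ∈ s, (v i - u i))))| ≤ 6 * ∫ r in (0:ℝ)..t, β r := by
  have hmono : ∀ r ∈ Icc 0 t, StrictMono (φ r) := fun r hr => FlowB.mono h hφ hT ⟨hr.1, hr.2.trans ht.2⟩
  have huv' : ∀ r ∈ Icc 0 t, ∀ i ∈ s, φ r (u i) < φ r (v i) := fun r hr i hi => hmono r hr (huv i hi)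
  have hc' : ∀ r ∈ Icc 0 t, ∀ i ∈ s, φ r c ≤ φ r (u i) := fun r hr i hi => (hmono r hr).monotone (hc i hi)
  have hd' : ∀ r ∈ Icc 0 t, ∀ i ∈ s, φ r (v i) ≤ φ r d := fun r hr i hi => (hmono r hr).monotone (hd i hi)
  have hdis' : ∀ r ∈ Icc 0 t, (s : Set ι).PairwiseDisjoint fun i => Ioc (φ r (u i)) (φ r (v i)) := by
    intro r hr i hi j hj hij
    have := hdis hi hj hij
    simp only [Function.onFun] at this ⊢
    rw [Ioc_disj_iff (huv i hi) (huv j hj)] at this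
    rw [Ioc_disj_iff (huv' r hr i hi) (huv' r hr j hj)]
    exact this.imp (fun q => (hmono r hr).monotone q) (fun q => (hmono r hr).monotone q)
  have hcd' : ∀ r ∈ Icc 0 t, φ r c < φ r d := fun r hr => hmono r hr hcd
  set A : ℝ → ℝ := fun r => ∑ i ∈ s, (φ r (v i) - φ r (u i)) with hA
  set B : ℝ → ℝ := fun r => φ r d - φ r c with hB
  have hApos : ∀ r ∈ Icc 0 t, 0 < A r := fun r hr =>
    Finset.sum_pos (fun i hi => by linarith [huv' r hr i hi]) hs
  have hBpos : ∀ r ∈ Icc 0 t, 0 < B r := fun r hr => by have := hcd' r hr; simp only [hB]; linarith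
  have hAB : ∀ r ∈ Icc 0 t, A r ≤ B r := fun r hr =>
    (static_len (huv' r hr) (hc' r hr) (hd' r hr) (hdis' r hr) (hcd' r hr).le).2
  have hL : ∀ r ∈ Icc 0 t, 0 ≤ Real.log (B r) - Real.log (A r) := fun r hr => by
    linarith [Real.log_le_log (hApos r hr) (hAB r hr)]
  have acφ : ∀ x, AbsolutelyContinuousOnInterval (fun r => φ r x) 0 t := fun x => (hφ.sol x).ac' le_rfl ht.1 ht.2
  have acA : AbsolutelyContinuousOnInterval A 0 t := ac_sum fun i _ => (acφ (v i)).sub (acφ (u i))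
  have acB : AbsolutelyContinuousOnInterval B 0 t := (acφ d).sub (acφ c)
  have uI : uIcc 0 t = Icc 0 t := uIcc_of_le ht.1
  have acl := (ac_const 1 0 t).add ((ac_log acB (by rw [uI]; exact hBpos)).sub (ac_log acA (by rw [uI]; exact hApos)))
  have acv := ac_log acl (by 
    rw [uI]; intro r hr; have := hL r hr; simp only [Pi.add_apply, Pi.sub_apply]; linarith)
  have key := ac_bound (k := fun r => 6 * β r) ht.1 acv ((h.bI.const_mul 6).intervalIntegrable) ?_
  · rw [intervalIntegral.integral_const_mul] at key
    simp only [Pi.add_apply, Pi.sub_apply] at key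
    have eA : A 0 = ∑ i ∈ s, (v i - u i) := by simp only [hA, hφ.start]
    have eB : B 0 = d - c := by simp only [hB, hφ.start]
    rw [eA, eB] at key
    exact key
  · have hder : ∀ᵐ r, r ∈ Ioo 0 T → (∀ i ∈ s, HasDerivAt (fun r => φ r (v i)) (f r (φ r (v i))) r ∧
        HasDerivAt (fun r => φ r (u i)) (f r (φ r (u i))) r) := by
      have := (eventually_all_finset (l := ae volume) s (p := fun i r => r ∈ Ioo 0 T → 
        (HasDerivAt (fun r => φ r (v i)) (f r (φ r (v i))) r ∧
        HasDerivAt (fun r => φ r (u i)) (f r (φ r (u i))) r))).2 (fun i _ => by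
          filter_upwards [(hφ.sol (v i)).deriv hT, (hφ.sol (u i)).deriv hT] with r h1 h2 hr
          exact ⟨h1 hr, h2 hr⟩)
      filter_upwards [this] with r h1 hr i hi using h1 i hi hr
    filter_upwards [hder, (hφ.sol c).deriv hT, (hφ.sol d).deriv hT] with r h1 h2 h3 hr
    have hrT : r ∈ Ioo 0 T := ⟨hr.1, hr.2.trans_le ht.2⟩
    have hr' : r ∈ Icc 0 t := ⟨hr.1.le, hr.2.le⟩
    have dA : HasDerivAt A (∑ i ∈ s, (f r (φ r (v i)) - f r (φ r (u i)))) r :=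
      HasDerivAt.fun_sum fun i hi => (h1 hrT i hi).1.sub (h1 hrT i hi).2
    have dB : HasDerivAt B (f r (φ r d) - f r (φ r c)) r := (h3 hrT).sub (h2 hrT)
    have a0 := hApos r hr'
    have b0 := hBpos r hr'
    have l0 := hL r hr'
    have hne : 1 + (Real.log (B r) - Real.log (A r)) ≠ 0 := by linarith
    have dv := (((dB.log b0.ne').sub (dA.log a0.ne')).const_add 1).log hne
    refine ⟨_, dv, ?_⟩
    have st := static h r hs (huv' r hr') (hc' r hr') (hd' r hr') (hdis' r hr') (hcd' r hr')
    change |_ - A r * (_ / B r)| ≤ 6 * β r * A r * (1 + Real.log (B r / A r)) at st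
    rw [Real.log_div b0.ne' a0.ne'] at st
    set A' := ∑ i ∈ s, (f r (φ r (v i)) - f r (φ r (u i)))
    set B' := f r (φ r d) - f r (φ r c)
    set L := Real.log (B r) - Real.log (A r)
    simp only [Pi.sub_apply]
    rw [abs_div, abs_of_pos (show 0 < 1 + L by linarith), div_le_iff₀ (by linarith)]
    have e : B' / B r - A' / A r = -((A' - A r * (B' / B r)) / A r) := by field_simp; ring
    rw [e, abs_neg, abs_div, abs_of_pos a0, div_le_iff₀ a0]
    calc _ ≤ _ := st
      _ = _ := by ring

/-- quantitative comparison. -/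
lemma evol2 {ι : Type*} {T : ℝ} {φ : ℝ → ℝ → ℝ} (h : Clean f f' β m) (hφ : FlowB T f φ) (hT : 0 ≤ T) {t : ℝ}
    (ht : t ∈ Icc 0 T) {K : ℝ} (hK : Real.exp (6 * ∫ r in (0:ℝ)..t, β r) ≤ K)
    {s : Finset ι} {u v : ι → ℝ} {c d : ℝ}
    (huv : ∀ i ∈ s, u i < v i) (hc : ∀ i ∈ s, c ≤ u i) (hd : ∀ i ∈ s, v i ≤ d)
    (hdis : (s : Set ι).PairwiseDisjoint fun i => Ioc (u i) (v i)) (hcd : c < d) :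
    ((∑ i ∈ s, (v i - u i)) / (d - c) / Real.exp 1) ^ K ≤
        (∑ i ∈ s, (φ t (v i) - φ t (u i))) / (φ t d - φ t c) / Real.exp 1 ∧
    ((∑ i ∈ s, (φ t (v i) - φ t (u i))) / (φ t d - φ t c) / Real.exp 1) ^ K ≤
        (∑ i ∈ s, (v i - u i)) / (d - c) / Real.exp 1 := by
  have hK0 : 0 < K := (Real.exp_pos _).trans_le hK
  rcases s.eq_empty_or_nonempty with rfl | hs
  · simp [Real.zero_rpow hK0.ne']
  have hmono := FlowB.mono h hφ hT ht
  have ev := evol h hφ hT ht hs huv hc hd hdis hcd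
  have a0 : 0 < ∑ i ∈ s, (v i - u i) := Finset.sum_pos (fun i hi => by linarith [huv i hi]) hs
  have at0 : 0 < ∑ i ∈ s, (φ t (v i) - φ t (u i)) := Finset.sum_pos (fun i hi => by linarith [hmono (huv i hi)]) hs
  have b0 : 0 < d - c := by linarith
  have bt0 : 0 < φ t d - φ t c := by linarith [hmono hcd]
  have ab := (static_len huv hc hd hdis hcd.le).2
  have hdis' : (s : Set ι).PairwiseDisjoint fun i => Ioc (φ t (u i)) (φ t (v i)) := by
    intro i hi j hj hij
    have := hdis hi hj hij
    simp only [Function.onFun] at this ⊢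
    rw [Ioc_disj_iff (huv i hi) (huv j hj)] at this
    rw [Ioc_disj_iff (hmono (huv i hi)) (hmono (huv j hj))]
    exact this.imp (fun q => hmono.monotone q) (fun q => hmono.monotone q)
  have abt := (static_len (fun i hi => hmono (huv i hi)) (fun i hi => hmono.monotone (hc i hi))
    (fun i hi => hmono.monotone (hd i hi)) hdis' (hmono hcd).le).2
  set A := ∑ i ∈ s, (v i - u i)
  set At := ∑ i ∈ s, (φ t (v i) - φ t (u i))
  set B := d - c
  set Bt := φ t d - φ t c
  have l1 : 0 ≤ Real.log B - Real.log A := by linarith [Real.log_le_log a0 ab]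
  have l2 : 0 ≤ Real.log Bt - Real.log At := by linarith [Real.log_le_log at0 abt]
  have hN : 6 * ∫ r in (0:ℝ)..t, β r ≤ Real.log K := (Real.le_log_iff_exp_le hK0).2 hK
  have ev := abs_le.1 (ev.trans hN)
  have conv : ∀ x y : ℝ, 0 < x → 0 < y → x / y / Real.exp 1 = Real.exp (-(1 + (Real.log y - Real.log x))) := by
    intro x y hx hy
    rw [show -(1 + (Real.log y - Real.log x)) = Real.log x - Real.log y - 1 by ring, Real.exp_sub, Real.exp_sub,
      Real.exp_log hx, Real.exp_log hy]
  have comp : ∀ p q : ℝ, 0 < p → 0 < q → Real.log p - Real.log q ≤ Real.log K → p ≤ q * K := by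
    intro p q hp hq hh
    rw [← Real.log_le_log_iff hp (by positivity), Real.log_mul hq.ne' hK0.ne']; linarith
  rw [conv _ _ a0 b0, conv _ _ at0 bt0, ← Real.exp_mul, ← Real.exp_mul]
  constructor
  · refine Real.exp_le_exp.2 ?_
    have := comp _ _ (by linarith) (by linarith) ev.2
    linarith
  · refine Real.exp_le_exp.2 ?_
    have := comp (1 + (Real.log B - Real.log A)) (1 + (Real.log Bt - Real.log At)) (by linarith) (by linarith) (by linarith [ev.1])
    linarith
end P6
end PartG

section PartH
open MeasureTheory Set Filter Topology

section P7

def cellU (c d : ℝ) (n : ℕ) (s : Finset ℕ) : Set ℝ :=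
  ⋃ i ∈ s, Ioc (c + i * ((d - c) / n)) (c + (i + 1) * ((d - c) / n))

lemma cellU_meas (c d : ℝ) (n : ℕ) (s : Finset ℕ) : MeasurableSet (cellU c d n s) :=
  s.measurableSet_biUnion fun _ _ => measurableSet_Ioc

lemma cell_bd {c d : ℝ} (hcd : c < d) {n : ℕ} (hn : 0 < n) {i : ℕ} (hi : i < n) :
    c + i * ((d - c) / n) < c + (i + 1) * ((d - c) / n) ∧ c ≤ c + i * ((d - c) / n) ∧
      c + (i + 1) * ((d - c) / n) ≤ d := by
  have hn' : (0:ℝ) < n := by exact_mod_cast hn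
  have h : 0 < (d - c) / n := div_pos (by linarith) hn'
  have h2 : n * ((d - c) / n) = d - c := by field_simp
  have hi' : (i:ℝ) + 1 ≤ n := by exact_mod_cast hi
  refine ⟨by nlinarith, ?_, by nlinarith⟩
  have : 0 ≤ i * ((d - c) / n) := by positivity
  linarith

lemma cell_disj {c d : ℝ} (hcd : c < d) {n : ℕ} (hn : 0 < n) {s : Finset ℕ} (hs : s ⊆ Finset.range n) :
    (s : Set ℕ).PairwiseDisjoint fun i : ℕ => Ioc (c + i * ((d - c) / n)) (c + (i + 1) * ((d - c) / n)) := by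
  have hn' : (0:ℝ) < n := by exact_mod_cast hn
  have h : 0 < (d - c) / n := div_pos (by linarith) hn'
  intro i hi j hj hij
  simp only [Function.onFun]
  rw [Ioc_disj_iff (cell_bd hcd hn (Finset.mem_range.1 (hs hi))).1 (cell_bd hcd hn (Finset.mem_range.1 (hs hj))).1]
  rcases lt_or_gt_of_ne hij with hlt | hlt
  · left
    have : (i:ℝ) + 1 ≤ j := by exact_mod_cast hlt
    nlinarith
  · right
    have : (j:ℝ) + 1 ≤ i := by exact_mod_cast hlt
    nlinarith

lemma cellU_sub {c d : ℝ} (hcd : c < d) {n : ℕ} (hn : 0 < n) {s : Finset ℕ} (hs : s ⊆ Finset.range n) :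
    cellU c d n s ⊆ Ioc c d :=
  iUnion₂_subset fun i hi => Ioc_subset_Ioc (cell_bd hcd hn (Finset.mem_range.1 (hs hi))).2.1
    (cell_bd hcd hn (Finset.mem_range.1 (hs hi))).2.2

lemma cell_cover {c d : ℝ} (hcd : c < d) {n : ℕ} (hn : 0 < n) {x : ℝ} (hx : x ∈ Ioc c d) :
    ∃ i < n, x ∈ Ioc (c + (i:ℕ) * ((d - c) / n)) (c + (i + 1) * ((d - c) / n)) := by
  have hn' : (0:ℝ) < n := by exact_mod_cast hn
  set h := (d - c) / n with hh
  have hpos : 0 < h := div_pos (by linarith) hn'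
  have h2 : n * h = d - c := by rw [hh]; field_simp
  have hy : 0 < (x - c) / h := div_pos (by linarith [hx.1]) hpos
  have hc1 : 0 < ⌈(x - c) / h⌉₊ := Nat.ceil_pos.2 hy
  obtain ⟨i, hi⟩ : ∃ i, ⌈(x - c) / h⌉₊ = i + 1 := ⟨_, (Nat.sub_add_cancel hc1).symm⟩
  have up := Nat.le_ceil ((x - c) / h)
  have lo : (i:ℝ) < (x - c) / h := Nat.lt_ceil.1 (by omega)
  rw [hi] at up
  push_cast at up
  rw [div_le_iff₀ hpos] at up
  rw [lt_div_iff₀ hpos] at lo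
  refine ⟨i, ?_, by linarith, by linarith⟩
  have : (i:ℝ) * h < n * h := by rw [h2]; linarith [hx.2]
  exact_mod_cast lt_of_mul_lt_mul_right this hpos.le

lemma grid_approx (ρ : Measure ℝ) [IsFiniteMeasure ρ] {c d : ℝ} (hcd : c < d) {E : Set ℝ} (hE : MeasurableSet E)
    (hEs : E ⊆ Ioc c d) {ε : ENNReal} (hε : ε ≠ 0) :
    ∃ n : ℕ, 0 < n ∧ ∃ s ⊆ Finset.range n, ρ (symmDiff (cellU c d n s) E) < ε + ε := by
  classical
  obtain ⟨K, hKE, hKc, hK⟩ := hE.exists_isCompact_lt_add (measure_ne_top ρ E) hε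
  have h1 := tendsto_measure_cthickening_of_isCompact (μ := ρ) hKc
  have hstep : Tendsto (fun n : ℕ => (d - c) / (n : ℝ)) atTop (𝓝 0) := tendsto_const_div_atTop_nhds_zero_nat _
  have h2 := (h1.comp hstep).eventually (Iio_mem_nhds (ENNReal.lt_add_right (measure_ne_top ρ K) hε))
  obtain ⟨n, hn, hn0⟩ := (h2.and (eventually_gt_atTop 0)).exists
  simp only [Function.comp, mem_Iio] at hn
  have hn' : (0:ℝ) < n := by exact_mod_cast hn0
  set h := (d - c) / n with hh
  have hpos : 0 < h := div_pos (by linarith) hn'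
  refine ⟨n, hn0, (Finset.range n).filter (fun i : ℕ =>
    (Ioc (c + i * ((d - c) / n)) (c + (i + 1) * ((d - c) / n)) ∩ K).Nonempty), Finset.filter_subset _ _, ?_⟩
  set s := (Finset.range n).filter (fun i : ℕ =>
    (Ioc (c + i * ((d - c) / n)) (c + (i + 1) * ((d - c) / n)) ∩ K).Nonempty) with hs
  have hKF : K ⊆ cellU c d n s := by
    intro x hx
    obtain ⟨i, hi, hxi⟩ := cell_cover hcd hn0 (hEs (hKE hx))
    exact mem_iUnion₂.2 ⟨i, by rw [hs, Finset.mem_filter, Finset.mem_range]; exact ⟨hi, x, hxi, hx⟩, hxi⟩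
  have hFT : cellU c d n s ⊆ Metric.cthickening h K := by
    intro x hx
    obtain ⟨i, hi, hxi⟩ := mem_iUnion₂.1 hx
    rw [hs, Finset.mem_filter] at hi
    obtain ⟨-, z, hz, hzK⟩ := hi
    refine Metric.mem_cthickening_of_dist_le x z h K hzK ?_
    rw [Real.dist_eq, abs_le]
    rw [← hh] at hxi hz
    constructor <;> linarith [hxi.1, hxi.2, hz.1, hz.2]
  have hKm := hKc.measurableSet
  calc ρ (symmDiff (cellU c d n s) E) ≤ ρ ((cellU c d n s \ K) ∪ (E \ K)) := by
        refine measure_mono ?_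
        rintro x (⟨h1, h2⟩ | ⟨h1, h2⟩)
        · exact Or.inl ⟨h1, fun hk => h2 (hKE hk)⟩
        · exact Or.inr ⟨h1, fun hk => h2 (hKF hk)⟩
    _ ≤ ρ (cellU c d n s \ K) + ρ (E \ K) := measure_union_le _ _
    _ < ε + ε := by
        refine ENNReal.add_lt_add ?_ ?_
        · rw [measure_diff hKF hKm.nullMeasurableSet (measure_ne_top _ _)]
          refine ENNReal.sub_lt_of_lt_add (measure_mono hKF) ?_
          rw [add_comm]
          exact (measure_mono hFT).trans_lt hn
        · rw [measure_diff hKE hKm.nullMeasurableSet (measure_ne_top _ _)]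
          refine ENNReal.sub_lt_of_lt_add (measure_mono hKE) ?_
          rw [add_comm]; exact hK

lemma grid_real {w : ℝ → ℝ} {c d : ℝ} (hcd : c < d) (hw : IntegrableOn w (Ioc c d)) (w0 : ∀ x, 0 ≤ w x)
    {E : Set ℝ} (hE : MeasurableSet E) (hEs : E ⊆ Ioc c d) {ε : ℝ} (hε : 0 < ε) :
    ∃ n : ℕ, 0 < n ∧ ∃ s ⊆ Finset.range n, |volume.real (cellU c d n s) - volume.real E| < ε ∧
      |(∫ x in cellU c d n s, w x) - ∫ x in E, w x| < ε := by
  set μ := volume.restrict (Ioc c d) with hμ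
  set ν := μ.withDensity (fun x => ENNReal.ofReal (w x)) with hν
  haveI : IsFiniteMeasure μ := ⟨by simp [hμ]⟩
  haveI : IsFiniteMeasure ν := isFiniteMeasure_withDensity_ofReal hw.2
  obtain ⟨n, hn, s, hs, hlt⟩ := grid_approx (μ + ν) hcd hE hEs (ε := ENNReal.ofReal (ε/2)) (by simpa using hε)
  refine ⟨n, hn, s, hs, ?_⟩
  have hF := cellU_sub hcd hn hs
  have hFm := cellU_meas c d n s
  set F := cellU c d n s
  have hD : (symmDiff F E) ⊆ Ioc c d := by
    rintro x (⟨h1, h2⟩ | ⟨h1, h2⟩)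
    · exact hF h1
    · exact hEs h1
  rw [← ENNReal.ofReal_add (by positivity) (by positivity), add_halves, Measure.add_apply] at hlt
  have v1 : ∀ G ⊆ Ioc c d, MeasurableSet G → μ.real G = volume.real G := by
    intro G hG hm
    rw [measureReal_def, hμ, Measure.restrict_apply hm, inter_eq_left.2 hG, measureReal_def]
  have v2 : ∀ G ⊆ Ioc c d, MeasurableSet G → ν.real G = ∫ x in G, w x := by
    intro G hG hm
    rw [measureReal_def, hν, withDensity_apply _ hm, hμ, Measure.restrict_restrict hm, inter_eq_left.2 hG,
      integral_eq_lintegral_of_nonneg_ae (Eventually.of_forall w0) (hw.mono_set hG).1]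
  have key : ∀ κ : Measure ℝ, IsFiniteMeasure κ → κ (symmDiff F E) < ENNReal.ofReal ε → |κ.real F - κ.real E| < ε := by
    intro κ _ hk
    refine (abs_measureReal_sub_le_measureReal_symmDiff' hFm.nullMeasurableSet hE.nullMeasurableSet
      (measure_ne_top _ _) (measure_ne_top _ _)).trans_lt ?_
    rw [measureReal_def]
    exact (ENNReal.lt_ofReal_iff_toReal_lt (measure_ne_top _ _)).1 hk
  rw [← v1 F hF hFm, ← v1 E hEs hE, ← v2 F hF hFm, ← v2 E hEs hE]
  exact ⟨key μ inferInstance (lt_of_le_of_lt le_self_add hlt), key ν inferInstance (lt_of_le_of_lt le_add_self hlt)⟩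
end P7
end PartH

section PartI
open MeasureTheory Set Filter Topology

section P8

def Reg (K : ℝ) (Φ : ℝ → ℝ) : Prop := ∀ (s : Finset ℕ) (u v : ℕ → ℝ) (c d : ℝ),
    (∀ i ∈ s, u i < v i) → (∀ i ∈ s, c ≤ u i) → (∀ i ∈ s, v i ≤ d) →
    ((s : Set ℕ).PairwiseDisjoint fun i => Ioc (u i) (v i)) → c < d →
    ((∑ i ∈ s, (v i - u i)) / (d - c) / Real.exp 1) ^ K ≤
        (∑ i ∈ s, (Φ (v i) - Φ (u i))) / (Φ d - Φ c) / Real.exp 1 ∧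
    ((∑ i ∈ s, (Φ (v i) - Φ (u i))) / (Φ d - Φ c) / Real.exp 1) ^ K ≤
        (∑ i ∈ s, (v i - u i)) / (d - c) / Real.exp 1

variable {K : ℝ} {Φ : ℝ → ℝ}

lemma reg_ac (hK : 0 < K) (hΦ : StrictMono Φ) (hR : Reg K Φ) {c d : ℝ} (hcd : c < d) :
    AbsolutelyContinuousOnInterval Φ c d := by
  classical
  unfold AbsolutelyContinuousOnInterval
  have hB : 0 < Φ d - Φ c := by linarith [hΦ hcd]
  have hB0 : 0 < d - c := by linarith
  set G : ℝ → ℝ := fun x => (x / (d - c) / Real.exp 1) ^ (1 / K) * Real.exp 1 * (Φ d - Φ c) with hG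
  have hGc : Continuous G := by
    have : Continuous fun x : ℝ => (x / (d - c) / Real.exp 1) ^ (1 / K) :=
      (Real.continuous_rpow_const (by positivity)).comp (by fun_prop)
    exact (this.mul continuous_const).mul continuous_const
  have hG0 : G 0 = 0 := by simp only [hG, zero_div]; rw [Real.zero_rpow (by positivity)]; simp
  have lim : Tendsto (fun E : ℕ × (ℕ → ℝ × ℝ) => G (∑ i ∈ Finset.range E.1, dist (E.2 i).1 (E.2 i).2))
      (AbsolutelyContinuousOnInterval.totalLengthFilter ⊓ principal (AbsolutelyContinuousOnInterval.disjWithin c d)) (𝓝 0) := by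
    have h1 : Tendsto (fun E : ℕ × (ℕ → ℝ × ℝ) => ∑ i ∈ Finset.range E.1, dist (E.2 i).1 (E.2 i).2)
      (AbsolutelyContinuousOnInterval.totalLengthFilter ⊓ principal (AbsolutelyContinuousOnInterval.disjWithin c d)) (𝓝 0) :=
      tendsto_comap.mono_left inf_le_left
    have := (hGc.tendsto 0).comp h1
    rwa [hG0] at this
  refine squeeze_zero' (Eventually.of_forall fun E => Finset.sum_nonneg fun i _ => dist_nonneg) ?_ lim
  rw [eventually_inf_principal]
  refine Eventually.of_forall fun E hE => ?_
  set s := (Finset.range E.1).filter (fun i => (E.2 i).1 ≠ (E.2 i).2) with hs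
  set u : ℕ → ℝ := fun i => min (E.2 i).1 (E.2 i).2
  set v : ℕ → ℝ := fun i => max (E.2 i).1 (E.2 i).2
  have hsub : ∀ i ∈ s, i ∈ Finset.range E.1 := fun i hi => (Finset.mem_filter.1 hi).1
  have huv : ∀ i ∈ s, u i < v i := fun i hi => min_lt_max.2 (Finset.mem_filter.1 hi).2
  have hmem : ∀ i ∈ s, (E.2 i).1 ∈ Icc c d ∧ (E.2 i).2 ∈ Icc c d := fun i hi => by
    have := hE.1 i (hsub i hi); rwa [uIcc_of_le hcd.le] at this
  have h2 := (hR s u v c d huv (fun i hi => le_min (hmem i hi).1.1 (hmem i hi).2.1)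
    (fun i hi => max_le (hmem i hi).1.2 (hmem i hi).2.2)
    (fun i hi j hj hij => hE.2 (hsub i hi) (hsub j hj) hij) hcd).2
  have e1 : ∑ i ∈ s, (v i - u i) = ∑ i ∈ Finset.range E.1, dist (E.2 i).1 (E.2 i).2 := by
    rw [hs, Finset.sum_filter]
    refine Finset.sum_congr rfl fun i _ => ?_
    split_ifs with h
    · simp only [u, v]; rw [max_sub_min_eq_abs, Real.dist_eq, abs_sub_comm]
    · push Not at h; rw [h, dist_self]
  have e2 : ∑ i ∈ s, (Φ (v i) - Φ (u i)) = ∑ i ∈ Finset.range E.1, dist (Φ (E.2 i).1) (Φ (E.2 i).2) := by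
    rw [hs, Finset.sum_filter]
    refine Finset.sum_congr rfl fun i _ => ?_
    split_ifs with h
    · simp only [u, v]; rw [hΦ.monotone.map_max, hΦ.monotone.map_min, max_sub_min_eq_abs, Real.dist_eq, abs_sub_comm]
    · push Not at h; rw [h, dist_self]
  have p0 : 0 ≤ ∑ i ∈ s, (Φ (v i) - Φ (u i)) := by rw [e2]; exact Finset.sum_nonneg fun i _ => dist_nonneg
  rw [e1, e2] at h2
  rw [e2] at p0
  set P := ∑ i ∈ Finset.range E.1, dist (Φ (E.2 i).1) (Φ (E.2 i).2)
  set Q := ∑ i ∈ Finset.range E.1, dist (E.2 i).1 (E.2 i).2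
  have hq : 0 ≤ P / (Φ d - Φ c) / Real.exp 1 := by positivity
  have h3 : P / (Φ d - Φ c) / Real.exp 1 ≤ (Q / (d - c) / Real.exp 1) ^ (1 / K) := by
    have := Real.rpow_le_rpow (by positivity) h2 (show 0 ≤ 1 / K by positivity)
    rwa [← Real.rpow_mul hq, mul_one_div_cancel hK.ne', Real.rpow_one] at this
  rw [div_le_iff₀ (Real.exp_pos _), div_le_iff₀ hB] at h3
  exact h3

lemma reg_ii (hK : 0 < K) (hΦ : StrictMono Φ) (hR : Reg K Φ) : LInt (deriv Φ) := by
  intro c d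
  rcases lt_trichotomy c d with h | h | h
  · exact (reg_ac hK hΦ hR h).intervalIntegrable_deriv
  · rw [h]
  · exact (reg_ac hK hΦ hR h).intervalIntegrable_deriv.symm

lemma reg_int (hK : 0 < K) (hΦ : StrictMono Φ) (hR : Reg K Φ) {c d : ℝ} (h : c < d) :
    ∫ x in c..d, deriv Φ x = Φ d - Φ c := (reg_ac hK hΦ hR h).integral_deriv_eq_sub

lemma reg_diff (hK : 0 < K) (hΦ : StrictMono Φ) (hR : Reg K Φ) : ∀ᵐ x, DifferentiableAt ℝ Φ x := by
  have : ∀ n : ℕ, ∀ᵐ x : ℝ, x ∈ uIcc (-(n:ℝ) - 1) (n + 1) → DifferentiableAt ℝ Φ x := fun n =>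
    (reg_ac hK hΦ hR (by linarith [show (0:ℝ) ≤ n from Nat.cast_nonneg n])).ae_differentiableAt
  rw [← ae_all_iff] at this
  filter_upwards [this] with x hx
  obtain ⟨n, hn⟩ := exists_nat_ge |x|
  have := abs_le.1 hn
  refine hx n ?_
  rw [uIcc_of_le (by linarith)]
  exact ⟨by linarith, by linarith⟩

def MReg (K : ℝ) (w : ℝ → ℝ) : Prop := ∀ (c d : ℝ) (E : Set ℝ), c < d → MeasurableSet E → E ⊆ Ioc c d →
    (volume.real E / (d - c) / Real.exp 1) ^ K ≤ (∫ x in E, w x) / (∫ x in c..d, w x) / Real.exp 1 ∧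
    ((∫ x in E, w x) / (∫ x in c..d, w x) / Real.exp 1) ^ K ≤ volume.real E / (d - c) / Real.exp 1

lemma reg_mreg (hK : 0 < K) (hΦ : StrictMono Φ) (hR : Reg K Φ) : MReg K (deriv Φ) := by
  intro c d E hcd hE hEs
  set w := deriv Φ
  have hw : IntegrableOn w (Ioc c d) := (intervalIntegrable_iff_integrableOn_Ioc_of_le hcd.le).1 (reg_ii hK hΦ hR c d)
  have w0 : ∀ x, 0 ≤ w x := fun x => hΦ.monotone.deriv_nonneg
  have happ := fun k : ℕ => grid_real hcd hw w0 hE hEs (ε := 1 / ((k:ℝ) + 1)) (by positivity)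
  choose n hn s hs h1 h2 using happ
  have l1 : Tendsto (fun k => volume.real (cellU c d (n k) (s k))) atTop (𝓝 (volume.real E)) := by
    rw [tendsto_iff_dist_tendsto_zero]
    exact squeeze_zero (fun _ => dist_nonneg) (fun k => (h1 k).le) tendsto_one_div_add_atTop_nhds_zero_nat
  have l2 : Tendsto (fun k => ∫ x in cellU c d (n k) (s k), w x) atTop (𝓝 (∫ x in E, w x)) := by
    rw [tendsto_iff_dist_tendsto_zero]
    exact squeeze_zero (fun _ => dist_nonneg) (fun k => (h2 k).le) tendsto_one_div_add_atTop_nhds_zero_nat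
  have hcont : ∀ D : ℝ, Continuous fun x : ℝ => (x / D / Real.exp 1) ^ K := fun D =>
    (Real.continuous_rpow_const hK.le).comp (by fun_prop)
  have hcont' : ∀ D : ℝ, Continuous fun x : ℝ => x / D / Real.exp 1 := fun D => by fun_prop
  have key : ∀ k, (volume.real (cellU c d (n k) (s k)) / (d - c) / Real.exp 1) ^ K ≤
      (∫ x in cellU c d (n k) (s k), w x) / (∫ x in c..d, w x) / Real.exp 1 ∧
    ((∫ x in cellU c d (n k) (s k), w x) / (∫ x in c..d, w x) / Real.exp 1) ^ K ≤
      volume.real (cellU c d (n k) (s k)) / (d - c) / Real.exp 1 := by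
    intro k
    have b1 := fun i (hi : i ∈ s k) => (cell_bd hcd (hn k) (Finset.mem_range.1 (hs k hi))).1
    have b2 := fun i (hi : i ∈ s k) => (cell_bd hcd (hn k) (Finset.mem_range.1 (hs k hi))).2.1
    have b3 := fun i (hi : i ∈ s k) => (cell_bd hcd (hn k) (Finset.mem_range.1 (hs k hi))).2.2
    have b4 := cell_disj hcd (hn k) (hs k)
    have := hR (s k) (fun i => c + i * ((d - c) / n k)) (fun i => c + (i + 1) * ((d - c) / n k)) c d
      b1 b2 b3 b4 hcd
    have e1 := (static_len b1 b2 b3 b4 hcd.le).1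
    have e2 : ∫ x in cellU c d (n k) (s k), w x =
        ∑ i ∈ s k, (Φ (c + (i + 1) * ((d - c) / n k)) - Φ (c + i * ((d - c) / n k))) := by
      unfold cellU
      rw [integral_biUnion_finset (s k) (fun i _ => measurableSet_Ioc) b4]
      · refine Finset.sum_congr rfl fun i hi => ?_
        rw [← reg_int hK hΦ hR (b1 i hi), intervalIntegral.integral_of_le (b1 i hi).le]
      · intro i hi
        exact (intervalIntegrable_iff_integrableOn_Ioc_of_le (b1 i hi).le).1 (reg_ii hK hΦ hR _ _)
    rw [e2, show volume.real (cellU c d (n k) (s k)) = _ from e1, reg_int hK hΦ hR hcd]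
    exact this
  exact ⟨le_of_tendsto_of_tendsto' (((hcont _).tendsto _).comp l1) (((hcont' _).tendsto _).comp l2) fun k => (key k).1,
    le_of_tendsto_of_tendsto' (((hcont _).tendsto _).comp l2) (((hcont' _).tendsto _).comp l1) fun k => (key k).2⟩
end P8
end PartI

section PartJ
open MeasureTheory Set Filter Topology

section P9

structure Wt (K : ℝ) (w : ℝ → ℝ) : Prop where
  hm : Measurable w
  h0 : ∀ x, 0 ≤ w x
  hl : LInt w
  hp : ∀ c d, c < d → 0 < ∫ x in c..d, w x
  hR : MReg K w
  hK : 1 < K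

variable {K : ℝ} {w : ℝ → ℝ}

lemma Wt.zero (h : Wt K w) {c d : ℝ} (hcd : c < d) : volume (Ioc c d ∩ {x | w x = 0}) = 0 := by
  have hE : MeasurableSet (Ioc c d ∩ {x | w x = 0}) :=
    measurableSet_Ioc.inter (h.hm (measurableSet_singleton 0))
  have h1 := (h.hR c d _ hcd hE inter_subset_left).1
  have hfin : volume (Ioc c d ∩ {x | w x = 0}) ≠ ⊤ :=
    measure_ne_top_of_subset inter_subset_left (by simp)
  have e : ∫ x in Ioc c d ∩ {x | w x = 0}, w x = 0 := by
    rw [setIntegral_congr_fun hE (g := fun _ => (0:ℝ)) (fun x hx => hx.2)]; simp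
  rw [e] at h1
  simp only [zero_div] at h1
  by_contra hne
  have hpos : 0 < volume.real (Ioc c d ∩ {x | w x = 0}) :=
    ENNReal.toReal_pos hne hfin
  have : 0 < d - c := by linarith
  have : 0 < (volume.real (Ioc c d ∩ {x | w x = 0}) / (d - c) / Real.exp 1) ^ K := by positivity
  linarith

lemma q_bound {q L : ℝ} (hK : 1 < K) (hq : 0 ≤ q) (hh : 0 < q → (K - 1) * Real.log q ≤ - L) :
    q ≤ Real.exp (-(K-1)⁻¹ * L) := by
  rcases hq.eq_or_lt with h | h
  · rw [← h]; positivity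
  · rw [← Real.log_le_iff_le_exp h]
    have h2 := hh h
    have : 0 < K - 1 := by linarith
    have e : Real.log q = (K-1)⁻¹ * ((K-1) * Real.log q) := by field_simp
    rw [e, neg_mul, ← mul_neg]
    gcongr

lemma Wt.up (h : Wt K w) {c d L : ℝ} (hcd : c < d) (hL : 0 ≤ L) :
    volume.real (Ioc c d ∩ {x | (∫ x in c..d, w x) / (d - c) * Real.exp L < w x}) ≤
      Real.exp 1 * (d - c) * Real.exp (-(K-1)⁻¹ * L) := by
  set E := Ioc c d ∩ {x | (∫ x in c..d, w x) / (d - c) * Real.exp L < w x} with hEd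
  have hE : MeasurableSet E := measurableSet_Ioc.inter (measurableSet_lt measurable_const h.hm)
  have h1 := (h.hR c d _ hcd hE inter_subset_left).2
  have hfin : volume E ≠ ⊤ := measure_ne_top_of_subset inter_subset_left (by simp)
  have hI : IntegrableOn w E := ((intervalIntegrable_iff_integrableOn_Ioc_of_le hcd.le).1 (h.hl c d)).mono_set inter_subset_left
  have h2 := setIntegral_ge_of_const_le_real hE hfin (fun x hx => hx.2.le) hI
  have hd : 0 < d - c := by linarith
  have hW := h.hp c d hcd
  have hK := h.hK
  have hb := q_bound (q := volume.real E / (d - c) / Real.exp 1) (L := L) hK (by positivity) (by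
    intro hq
    set W := ∫ x in c..d, w x
    have h3 : Real.exp L * (volume.real E / (d - c) / Real.exp 1) ≤ (∫ x in E, w x) / W / Real.exp 1 := by
      have : Real.exp L * (volume.real E / (d - c) / Real.exp 1) = (W / (d - c) * Real.exp L * volume.real E) / W / Real.exp 1 := by
        field_simp
      rw [this]; gcongr
    set q := volume.real E / (d - c) / Real.exp 1
    have h4 : (Real.exp L * q) ^ K ≤ q := le_trans (Real.rpow_le_rpow (by positivity) h3 (by linarith)) h1
    have h5 := Real.log_le_log (by positivity) h4
    rw [Real.log_rpow (by positivity), Real.log_mul (by positivity) hq.ne', Real.log_exp] at h5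
    nlinarith)
  rw [div_le_iff₀ (by positivity), div_le_iff₀ hd] at hb
  linarith

lemma Wt.lo (h : Wt K w) {c d L : ℝ} (hcd : c < d) :
    volume.real (Ioc c d ∩ {x | w x < (∫ x in c..d, w x) / (d - c) * Real.exp (-L)}) ≤
      Real.exp 1 * (d - c) * Real.exp (-(K-1)⁻¹ * L) := by
  set E := Ioc c d ∩ {x | w x < (∫ x in c..d, w x) / (d - c) * Real.exp (-L)} with hEd
  have hE : MeasurableSet E := measurableSet_Ioc.inter (measurableSet_lt h.hm measurable_const)
  have h1 := (h.hR c d _ hcd hE inter_subset_left).1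
  have hfin : volume E ≠ ⊤ := measure_ne_top_of_subset inter_subset_left (by simp)
  have hI : IntegrableOn w E := ((intervalIntegrable_iff_integrableOn_Ioc_of_le hcd.le).1 (h.hl c d)).mono_set inter_subset_left
  have h2 := setIntegral_mono_on hI (integrableOn_const hfin) hE (fun x hx => hx.2.le)
  rw [setIntegral_const, smul_eq_mul] at h2
  have hd : 0 < d - c := by linarith
  have hW := h.hp c d hcd
  have hK := h.hK
  have hb := q_bound (q := volume.real E / (d - c) / Real.exp 1) (L := L) hK (by positivity) (by
    intro hq
    set W := ∫ x in c..d, w x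
    have h3 : (∫ x in E, w x) / W / Real.exp 1 ≤ Real.exp (-L) * (volume.real E / (d - c) / Real.exp 1) := by
      have : Real.exp (-L) * (volume.real E / (d - c) / Real.exp 1) = (volume.real E * (W / (d - c) * Real.exp (-L))) / W / Real.exp 1 := by
        field_simp
      rw [this]; gcongr
    set q := volume.real E / (d - c) / Real.exp 1
    have h4 := h1.trans h3
    have h5 := Real.log_le_log (by positivity) h4
    rw [Real.log_rpow hq, Real.log_mul (by positivity) hq.ne', Real.log_exp] at h5
    nlinarith)
  rw [div_le_iff₀ (by positivity), div_le_iff₀ hd] at hb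
  linarith

lemma Wt.tail (h : Wt K w) {c d L : ℝ} (hcd : c < d) (hL : 0 ≤ L) :
    volume.restrict (Ioc c d) {x | L < |Real.log (w x) - Real.log ((∫ x in c..d, w x) / (d - c))|} ≤
      ENNReal.ofReal (2 * Real.exp 1 * (d - c) * Real.exp (-(K-1)⁻¹ * L)) := by
  have hd : 0 < d - c := by linarith
  have hW := h.hp c d hcd
  have u := h.up hcd hL
  have l := h.lo hcd (L := L)
  have z := h.zero hcd
  set W := (∫ x in c..d, w x) / (d - c) with hWd
  have hW0 : 0 < W := by positivity
  have hS : MeasurableSet {x | L < |Real.log (w x) - Real.log W|} :=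
    measurableSet_lt measurable_const (by
      have := h.hm
      fun_prop)
  rw [Measure.restrict_apply hS]
  have sub : {x | L < |Real.log (w x) - Real.log W|} ∩ Ioc c d ⊆
      ((Ioc c d ∩ {x | W * Real.exp L < w x}) ∪ (Ioc c d ∩ {x | w x < W * Real.exp (-L)})) ∪ (Ioc c d ∩ {x | w x = 0}) := by
    rintro x ⟨hx, hxI⟩
    rcases (h.h0 x).eq_or_lt with h0 | h0
    · exact Or.inr ⟨hxI, h0.symm⟩
    · left
      rcases lt_abs.1 (show L < |Real.log (w x) - Real.log W| from hx) with h1 | h1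
      · left; refine ⟨hxI, ?_⟩
        change W * Real.exp L < w x
        rw [← Real.log_lt_log_iff (by positivity) h0, Real.log_mul hW0.ne' (by positivity), Real.log_exp]; linarith
      · right; refine ⟨hxI, ?_⟩
        change w x < W * Real.exp (-L)
        rw [← Real.log_lt_log_iff h0 (by positivity), Real.log_mul hW0.ne' (by positivity), Real.log_exp]; linarith
  have f1 : volume (Ioc c d ∩ {x | W * Real.exp L < w x}) ≠ ⊤ := measure_ne_top_of_subset inter_subset_left (by simp)
  have f2 : volume (Ioc c d ∩ {x | w x < W * Real.exp (-L)}) ≠ ⊤ := measure_ne_top_of_subset inter_subset_left (by simp)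
  have u' := (ENNReal.ofReal_toReal f1).symm.le.trans (ENNReal.ofReal_le_ofReal u)
  have l' := (ENNReal.ofReal_toReal f2).symm.le.trans (ENNReal.ofReal_le_ofReal l)
  refine (measure_mono sub).trans ((measure_union_le _ _).trans ?_)
  rw [z, add_zero]
  refine (measure_union_le _ _).trans ((add_le_add u' l').trans ?_)
  rw [← ENNReal.ofReal_add (by positivity) (by positivity)]
  apply ENNReal.ofReal_le_ofReal
  linarith

lemma Wt.main (h : Wt K w) {c d : ℝ} (hcd : c < d) :
    IntegrableOn (fun x => |Real.log (w x) - Real.log ((∫ x in c..d, w x) / (d - c))|) (Ioc c d) ∧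
    ∫ x in c..d, |Real.log (w x) - Real.log ((∫ x in c..d, w x) / (d - c))| ≤ 2 * Real.exp 1 * (K - 1) * (d - c) := by
  have hd : 0 < d - c := by linarith
  have hK : 0 < K - 1 := by linarith [h.hK]
  set A := Real.log ((∫ x in c..d, w x) / (d - c)) with hA
  have hmeas : Measurable fun x => |Real.log (w x) - A| := by
    have := h.hm
    fun_prop
  have lc := lintegral_eq_lintegral_meas_lt (f := fun x => |Real.log (w x) - A|) (volume.restrict (Ioc c d))
    (Eventually.of_forall fun x => abs_nonneg _) hmeas.aemeasurable
  have neg : -(K-1)⁻¹ < 0 := by simp only [neg_lt_zero]; positivity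
  have hint := (integrableOn_exp_mul_Ioi neg 0).const_mul (2 * Real.exp 1 * (d - c))
  have hval : ∫ L in Ioi (0:ℝ), 2 * Real.exp 1 * (d - c) * Real.exp (-(K-1)⁻¹ * L) = 2 * Real.exp 1 * (K - 1) * (d - c) := by
    rw [integral_const_mul, integral_exp_mul_Ioi neg]
    simp
    field_simp
  have bd : ∫⁻ x in Ioc c d, ENNReal.ofReal |Real.log (w x) - A| ≤ ENNReal.ofReal (2 * Real.exp 1 * (K - 1) * (d - c)) := by
    rw [lc, ← hval, ofReal_integral_eq_lintegral_ofReal hint (Eventually.of_forall fun x => by positivity)]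
    exact setLIntegral_mono' measurableSet_Ioi fun L hL => h.tail hcd (le_of_lt hL)
  refine ⟨⟨hmeas.aestronglyMeasurable, ?_⟩, ?_⟩
  · rw [hasFiniteIntegral_iff_ofReal (Eventually.of_forall fun x => abs_nonneg _)]
    exact bd.trans_lt ENNReal.ofReal_lt_top
  · rw [intervalIntegral.integral_of_le hcd.le, integral_eq_lintegral_of_nonneg_ae (Eventually.of_forall fun x => abs_nonneg _) hmeas.aestronglyMeasurable]
    exact ENNReal.toReal_le_of_le_ofReal (by positivity) bd

lemma Wt.logl (h : Wt K w) : LInt (fun x => Real.log (w x)) := by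
  have key : ∀ c d, c < d → IntervalIntegrable (fun x => Real.log (w x)) volume c d := by
    intro c d hcd
    rw [intervalIntegrable_iff_integrableOn_Ioc_of_le hcd.le]
    have h1 := (h.main hcd).1
    set A := Real.log ((∫ x in c..d, w x) / (d - c))
    have hmeas : Measurable fun x => Real.log (w x) - A := by
      have := h.hm
      fun_prop
    have h2 : IntegrableOn (fun x => Real.log (w x) - A) (Ioc c d) :=
      (integrable_norm_iff hmeas.aestronglyMeasurable).1 h1
    have h3 := h2.add (integrableOn_const (C := A) (by simp))
    refine h3.congr (Eventually.of_forall fun x => ?_)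
    simp
  intro c d
  rcases lt_trichotomy c d with h | h | h
  · exact key _ _ h
  · rw [h]
  · exact (key _ _ h).symm

lemma LInt.loc {g : ℝ → ℝ} (h : LInt g) : LocallyIntegrable g := by
  intro x
  refine ⟨Ioo (x-1) (x+1), Ioo_mem_nhds (by linarith) (by linarith), ?_⟩
  exact ((intervalIntegrable_iff_integrableOn_Ioc_of_le (by linarith)).1 (h (x-1) (x+1))).mono_set Ioo_subset_Ioc_self

lemma avg_diff9 {g : ℝ → ℝ} (h : LInt g) {c d : ℝ} (hcd : c < d) (A : ℝ) :
    |A - avgI g c d| * (d - c) ≤ ∫ x in c..d, |g x - A| := by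
  have hd : 0 < d - c := by linarith
  have e : (A - avgI g c d) * (d - c) = -∫ x in c..d, (g x - A) := by
    rw [intervalIntegral.integral_sub (h c d) intervalIntegrable_const, ← mul_avgI g hcd]
    simp; ring
  calc |A - avgI g c d| * (d - c) = |(A - avgI g c d) * (d - c)| := by rw [abs_mul, abs_of_pos hd]
    _ = |∫ x in c..d, (g x - A)| := by rw [e, abs_neg]
    _ ≤ _ := intervalIntegral.abs_integral_le_integral_abs hcd.le

lemma Wt.osc (h : Wt K w) {c d : ℝ} (hcd : c < d) :
    ∫ x in c..d, |Real.log (w x) - avgI (fun x => Real.log (w x)) c d| ≤ 4 * Real.exp 1 * (K - 1) * (d - c) := by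
  have h1 := (h.main hcd).2
  set A := Real.log ((∫ x in c..d, w x) / (d - c))
  have h2 := avg_diff9 h.logl hcd A
  set B := avgI (fun x => Real.log (w x)) c d
  have h3 := int_mono (h.logl.osc B) (h := fun x => |Real.log (w x) - A| + |A - B|)
    (fun a b => (h.logl.osc A a b).add intervalIntegrable_const) hcd.le (fun x _ => abs_sub_le _ _ _)
  rw [intervalIntegral.integral_add (h.logl.osc A c d) intervalIntegrable_const] at h3
  simp only [intervalIntegral.integral_const, smul_eq_mul] at h3
  nlinarith

lemma Wt.memBMO (h : Wt K w) : MemBMO (fun x => Real.log (w x)) := by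
  refine ⟨h.logl.loc, 4 * Real.exp 1 * (K - 1), ?_⟩
  rintro r ⟨a, b, hab, rfl⟩
  rw [avgI_le_iff _ hab]
  exact h.osc hab

lemma Wt.bmo (h : Wt K w) : bmoNorm (fun x => Real.log (w x)) ≤ 4 * Real.exp 1 * (K - 1) :=
  (bmoNorm_le_iff h.memBMO _).2 fun _ _ hcd => h.osc hcd

lemma Wt.ainf (h : Wt K w) : IsAinftyWeight w := by
  refine ⟨h.h0, h.hl.loc, Real.exp (2 * Real.exp 1 * (K - 1)), ?_⟩
  rintro r ⟨c, d, hcd, rfl⟩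
  have hd : 0 < d - c := by linarith
  have hW := h.hp c d hcd
  have h1 := (h.main hcd).2
  set A := Real.log ((∫ x in c..d, w x) / (d - c)) with hA
  have h2 := avg_diff9 h.logl hcd A
  have h3 : |A - avgI (fun x => Real.log (w x)) c d| ≤ 2 * Real.exp 1 * (K - 1) :=
    le_of_mul_le_mul_right (h2.trans h1) hd
  have e : avgI w c d = Real.exp A := by
    rw [hA, Real.exp_log (by positivity)]; unfold avgI; field_simp
  unfold ainftyQuot
  rw [e, ← Real.exp_add]
  exact Real.exp_le_exp.2 (by linarith [le_abs_self (A - avgI (fun x => Real.log (w x)) c d)])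

lemma flow_wt {f f' : ℝ → ℝ → ℝ} {β m : ℝ → ℝ} {T : ℝ} {φ : ℝ → ℝ → ℝ} (h : Clean f f' β m)
    (hφ : FlowB T f φ) (hT : 0 ≤ T) {t : ℝ} (ht : t ∈ Icc 0 T) {K : ℝ}
    (hK : Real.exp (6 * ∫ r in (0:ℝ)..t, β r) ≤ K) (hK1 : 1 < K) :
    Wt K (deriv (φ t)) ∧ ∀ᵐ x, DifferentiableAt ℝ (φ t) x := by
  have hR : Reg K (φ t) := fun s u v c d h1 h2 h3 h4 h5 => evol2 h hφ hT ht hK h1 h2 h3 h4 h5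
  have hm := hφ.mono h hT ht
  have hK0 : 0 < K := by linarith
  refine ⟨⟨measurable_deriv _, fun x => hm.monotone.deriv_nonneg, reg_ii hK0 hm hR, ?_, reg_mreg hK0 hm hR, hK1⟩, reg_diff hK0 hm hR⟩
  intro c d hcd
  rw [reg_int hK0 hm hR hcd]
  linarith [hm hcd]

lemma flow_final {f f' : ℝ → ℝ → ℝ} {β m : ℝ → ℝ} {T : ℝ} {φ : ℝ → ℝ → ℝ} (h : Clean f f' β m)
    (hφ : FlowB T f φ) (hT : 0 ≤ T) {t : ℝ} (ht : t ∈ Icc 0 T) :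
    (∀ᵐ x, HasDerivAt (φ t) (deriv (φ t) x) x) ∧ IsAinftyWeight (fun x => |deriv (φ t) x|) ∧
    bmoNorm (fun x => Real.log |deriv (φ t) x|) ≤ (∫ s in (0:ℝ)..t, 24 * Real.exp 1 * β s) * Real.exp (6 * ∫ s in (0:ℝ)..t, β s) := by
  have hN : 0 ≤ ∫ s in (0:ℝ)..t, β s := int_nonneg ht.1 h.b0
  have ew : (fun x => |deriv (φ t) x|) = deriv (φ t) :=
    funext fun x => abs_of_nonneg (hφ.mono h hT ht).monotone.deriv_nonneg
  have ew2 : (fun x => Real.log |deriv (φ t) x|) = fun x => Real.log (deriv (φ t) x) := by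
    funext x; rw [Real.log_abs]
  rw [ew, ew2, intervalIntegral.integral_const_mul]
  set N := ∫ s in (0:ℝ)..t, β s
  have h1 : 1 ≤ Real.exp (6 * N) := Real.one_le_exp (by positivity)
  obtain ⟨w1, w2⟩ := flow_wt h hφ hT ht (K := Real.exp (6 * N) + 1) (by linarith) (by linarith)
  refine ⟨w2.mono fun x hx => hx.hasDerivAt, w1.ainf, ?_⟩
  have h2 : bmoNorm (fun x => Real.log (deriv (φ t) x)) ≤ 4 * Real.exp 1 * (Real.exp (6 * N) - 1) := by
    have hle : ∀ ε : ℝ, 0 < ε → bmoNorm (fun x => Real.log (deriv (φ t) x)) ≤ 4 * Real.exp 1 * (Real.exp (6 * N) - 1) + ε := by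
      intro ε he
      have := (flow_wt h hφ hT ht (K := Real.exp (6 * N) + ε / (4 * Real.exp 1)) (by
        have : 0 < ε / (4 * Real.exp 1) := by positivity
        linarith) (by
        have : 0 < ε / (4 * Real.exp 1) := by positivity
        linarith)).1.bmo
      refine this.trans (le_of_eq ?_)
      field_simp
      ring
    exact le_of_forall_pos_le_add hle
  refine h2.trans ?_
  have h3 : Real.exp (6 * N) - 1 ≤ 6 * N * Real.exp (6 * N) := by
    have := Real.add_one_le_exp (-(6 * N))
    have e : Real.exp (-(6*N)) * Real.exp (6 * N) = 1 := by rw [← Real.exp_add]; simp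
    nlinarith
  calc _ ≤ 4 * Real.exp 1 * (6 * N * Real.exp (6 * N)) := by gcongr
    _ = _ := by ring
end P9
end PartJ

section PartK
open MeasureTheory Set Filter Topology

section P10

lemma clean_exists (T : ℝ) (b b' : ℝ → ℝ → ℝ)
    (hbint : ∀ a c : ℝ, a < c → IntegrableOn (fun p : ℝ × ℝ => b p.1 p.2) (Ioc 0 T ×ˢ Ioo a c) volume)
    (hderiv : ∀ᵐ t ∂volume.restrict (Ioc 0 T), (∀ x y : ℝ, b t y - b t x = ∫ z in x..y, b' t z) ∧ MemBMO (b' t))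
    (hstar : IntegrableOn (fun t => starNorm (b' t)) (Ioc 0 T) volume) :
    ∃ f f' β m, Clean f f' β m ∧ ∀ᵐ t ∂volume.restrict (Ioc 0 T), f t = b t ∧ β t = bmoNorm (b' t) := by
  classical
  have hA : ∀ a c : ℝ, a < c → ∃ x ∈ Ioo a c, Integrable (fun t => b t x) (volume.restrict (Ioc 0 T)) := by
    intro a c hac
    have h1 := hbint a c hac
    unfold IntegrableOn at h1
    rw [Measure.volume_eq_prod, ← Measure.prod_restrict] at h1
    have h2 := h1.prod_left_ae
    have h3 := h2.and (ae_restrict_mem measurableSet_Ioo)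
    have : (ae (volume.restrict (Ioo a c))).NeBot := by
      rw [ae_neBot]; simp [Measure.restrict_eq_zero, hac]
    obtain ⟨x, hx1, hx2⟩ := h3.exists
    exact ⟨x, hx2, hx1⟩
  have hB : ∀ x, AEMeasurable (fun t => b t x) (volume.restrict (Ioc 0 T)) := by
    intro x
    have hch : ∀ n : ℕ, ∃ y ∈ Ioo x (x + 1 / ((n:ℝ) + 1)), Integrable (fun t => b t y) (volume.restrict (Ioc 0 T)) :=
      fun n => hA _ _ (by have : 0 < 1 / ((n:ℝ) + 1) := by positivity
                          linarith)
    choose y hy hyI using hch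
    have lim : Tendsto y atTop (𝓝 x) := by
      refine tendsto_of_tendsto_of_tendsto_of_le_of_le tendsto_const_nhds
        (h := fun n : ℕ => x + 1 / ((n:ℝ) + 1)) ?_ (fun n => (hy n).1.le) (fun n => (hy n).2.le)
      simpa using (tendsto_const_nhds (x := x)).add (tendsto_one_div_add_atTop_nhds_zero_nat (𝕜 := ℝ))
    refine aemeasurable_of_tendsto_metrizable_ae atTop (f := fun n t => b t (y n)) (fun n => (hyI n).1.aemeasurable) ?_
    filter_upwards [hderiv] with t ht
    exact ((prim_cont ht.2.lint ht.1).tendsto x).comp lim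
  have hC : ∀ᵐ t ∂volume.restrict (Ioc 0 T), ∀ q : ℚ, b t q = (hB q).mk _ t :=
    ae_all_iff.2 fun q => (hB q).ae_eq_mk
  obtain ⟨S, hS, hSm, hSp⟩ := ((hderiv.and hC).and (ae_restrict_mem measurableSet_Ioc)).exists_measurable_mem
  set f : ℝ → ℝ → ℝ := fun t x => if t ∈ S then b t x else 0 with hf
  set f' : ℝ → ℝ → ℝ := fun t x => if t ∈ S then b' t x else 0 with hf'
  have fS : ∀ t ∈ S, f t = b t := fun t ht => by funext x; simp [hf, ht]
  have fS' : ∀ t ∈ S, f' t = b' t := fun t ht => by funext x; simp [hf', ht]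
  have fN : ∀ t ∉ S, f t = fun _ => 0 := fun t ht => by funext x; simp [hf, ht]
  have fN' : ∀ t ∉ S, f' t = fun _ => 0 := fun t ht => by funext x; simp [hf', ht]
  have prim : ∀ t x y, f t y - f t x = ∫ z in x..y, f' t z := by
    intro t x y
    by_cases ht : t ∈ S
    · rw [fS t ht, fS' t ht]; exact (hSp t ht).1.1.1 x y
    · rw [fN t ht, fN' t ht]; simp
  have memb : ∀ t, MemBMO (f' t) := by
    intro t
    by_cases ht : t ∈ S
    · rw [fS' t ht]; exact (hSp t ht).1.1.2
    · rw [fN' t ht]; exact memBMO_zero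
  have cont : ∀ t, Continuous (f t) := fun t => prim_cont (memb t).lint (prim t)
  have mq : ∀ q : ℚ, Measurable fun t => f t q := by
    intro q
    have : (fun t => f t q) = S.indicator ((hB q).mk _) := by
      funext t
      by_cases ht : t ∈ S
      · rw [fS t ht, indicator_of_mem ht]; exact (hSp t ht).1.2 q
      · rw [fN t ht, indicator_of_notMem ht]
    rw [this]
    exact (hB q).measurable_mk.indicator hSm
  have meas : ∀ x, Measurable fun t => f t x := by
    intro x
    have hch : ∀ n : ℕ, ∃ q : ℚ, x < q ∧ (q:ℝ) < x + 1 / ((n:ℝ) + 1) :=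
      fun n => exists_rat_btwn (by have : 0 < 1 / ((n:ℝ) + 1) := by positivity
                                   linarith)
    choose y hy1 hy2 using hch
    have lim : Tendsto (fun n => (y n : ℝ)) atTop (𝓝 x) := by
      refine tendsto_of_tendsto_of_tendsto_of_le_of_le tendsto_const_nhds
        (h := fun n : ℕ => x + 1 / ((n:ℝ) + 1)) ?_ (fun n => (hy1 n).le) (fun n => (hy2 n).le)
      simpa using (tendsto_const_nhds (x := x)).add (tendsto_one_div_add_atTop_nhds_zero_nat (𝕜 := ℝ))
    refine measurable_of_tendsto_metrizable (f := fun n t => f t (y n)) (fun n => mq (y n)) ?_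
    rw [tendsto_pi_nhds]
    intro t
    exact ((cont t).tendsto x).comp lim
  have hSsub : S ⊆ Ioc 0 T := fun t ht => (hSp t ht).2
  have i0 : ∀ g : ℝ → ℝ, 0 ≤ ∫ x in (-1:ℝ)..1, |g x| := fun g => int_nonneg (by norm_num) fun x => abs_nonneg _
  have b0I : IntegrableOn (fun t => |b t 0|) (Ioc 0 T) := by
    obtain ⟨x0, hx0, hxI⟩ := hA 0 1 one_pos
    have hdom : Integrable (fun t => |b t x0| + starNorm (b' t)) (volume.restrict (Ioc 0 T)) := hxI.abs.add hstar
    refine hdom.mono' (hB 0).abs.aestronglyMeasurable ?_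
    filter_upwards [hderiv] with t ht
    rw [Real.norm_eq_abs, abs_abs]
    have e := ht.1 0 x0
    have l := ht.2.lint
    have h1 : |∫ z in (0:ℝ)..x0, b' t z| ≤ ∫ z in (0:ℝ)..x0, |b' t z| :=
      intervalIntegral.abs_integral_le_integral_abs hx0.1.le
    have h2 : ∫ z in (0:ℝ)..x0, |b' t z| ≤ ∫ z in (-1:ℝ)..1, |b' t z| :=
      intervalIntegral.integral_mono_interval (by norm_num) hx0.1.le hx0.2.le
        (Eventually.of_forall fun x => abs_nonneg _) (l.abs _ _)
    have h3 : |b t 0| ≤ |b t x0| + |b t x0 - b t 0| := by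
      have := abs_sub_abs_le_abs_sub (b t 0) (b t x0)
      rw [abs_sub_comm] at this; linarith
    have h4 := bmoNorm_nonneg (b' t)
    rw [e] at h3
    unfold starNorm
    linarith
  have mI : Integrable (S.indicator fun t => starNorm (b' t) + |b t 0|) :=
    (integrable_indicator_iff hSm).2 ((hstar.add b0I).mono_set hSsub)
  have mbd : ∀ t, (∫ x in (-1:ℝ)..1, |f' t x|) + |f t 0| + bmoNorm (f' t) ≤ S.indicator (fun t => starNorm (b' t) + |b t 0|) t := by
    intro t
    by_cases ht : t ∈ S
    · rw [fS t ht, fS' t ht, indicator_of_mem ht]; unfold starNorm; linarith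
    · rw [fN t ht, fN' t ht, indicator_of_notMem ht, bmoNorm_zero]; simp
  have bI : Integrable fun t => bmoNorm (f' t) := by
    refine mI.mono' (bmo_meas prim memb meas).aestronglyMeasurable (Eventually.of_forall fun t => ?_)
    rw [Real.norm_eq_abs, abs_of_nonneg (bmoNorm_nonneg _)]
    linarith [mbd t, i0 (f' t), abs_nonneg (f t 0)]
  refine ⟨f, f', fun t => bmoNorm (f' t), _, ⟨prim, fun t => (memb t).lint, fun t c d h => (bmoNorm_le_iff (memb t) _).1 le_rfl c d h,
    meas, mbd, bI, mI⟩, ?_⟩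
  filter_upwards [hS] with t ht
  exact ⟨fS t ht, by simp only [fS' t ht]⟩

lemma ii_congr9 {T t : ℝ} {g h : ℝ → ℝ} (ht : t ∈ Icc 0 T) (hgh : ∀ᵐ s ∂volume.restrict (Ioc 0 T), g s = h s) :
    ∫ s in (0:ℝ)..t, g s = ∫ s in (0:ℝ)..t, h s := by
  rw [intervalIntegral.integral_of_le ht.1, intervalIntegral.integral_of_le ht.1]
  exact integral_congr_ae (ae_restrict_of_ae_restrict_of_subset (Ioc_subset_Ioc_right ht.2) hgh)

lemma flow_iff9 {T : ℝ} {b f φ : ℝ → ℝ → ℝ} (hfb : ∀ᵐ t ∂volume.restrict (Ioc 0 T), f t = b t) :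
    IsFlowOf T b φ ↔ FlowB T f φ := by
  have key : ∀ x, ∀ᵐ s ∂volume.restrict (Ioc 0 T), b s (φ s x) = f s (φ s x) := fun x => by
    filter_upwards [hfb] with s hs
    rw [hs]
  constructor
  · rintro ⟨h1, h2, h3⟩
    refine ⟨h1, fun x => ⟨(h2 x).congr (key x), fun t ht => ?_⟩⟩
    beta_reduce
    rw [h1 x, h3 x t ht, ii_congr9 ht (key x)]
  · rintro ⟨h1, h2⟩
    refine ⟨h1, fun x => (h2 x).1.congr ((key x).mono fun s hs => hs.symm), fun x t ht => ?_⟩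
    have := (h2 x).2 t ht
    rw [ii_congr9 ht (key x)]
    beta_reduce at this
    rw [h1 x] at this
    exact this
end P10
end PartK

/-- Main theorem: if `b ∈ L¹(0,T; L¹_loc(ℝ))` has spatial derivative `∂ₓb(t,·) ∈ BMO(ℝ)` for
a.e. `t` with `∫₀ᵀ ‖∂ₓb(t,·)‖_* dt < ∞`, then `b` generates a unique flow `φ`, for each
`t ∈ [0,T]` the function `x ↦ |∂ₓφ(t,x)|` is an `A_∞(ℝ)` weight, and
`‖log|∂ₓφ(t,·)|‖_BMO ≤ (∫₀ᵗ C₁ ‖∂ₓb(s,·)‖_BMO ds) exp(c ∫₀ᵗ ‖∂ₓb(s,·)‖_BMO ds)`. -/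
theorem flow_with_ainfty_density (T : ℝ) (hT : 0 < T) (b b' : ℝ → ℝ → ℝ)
    (hbint : ∀ a c : ℝ, a < c →
      MeasureTheory.IntegrableOn (fun p : ℝ × ℝ => b p.1 p.2)
        (Set.Ioc 0 T ×ˢ Set.Ioo a c) MeasureTheory.volume)
    (hderiv : ∀ᵐ t ∂MeasureTheory.volume.restrict (Set.Ioc 0 T),
      (∀ x y : ℝ, b t y - b t x = ∫ z in x..y, b' t z) ∧ MemBMO (b' t))
    (hstar : MeasureTheory.IntegrableOn (fun t => starNorm (b' t)) (Set.Ioc 0 T)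
      MeasureTheory.volume) :
    ∃ φ : ℝ → ℝ → ℝ,
      IsFlowOf T b φ ∧
      (∀ ψ : ℝ → ℝ → ℝ, IsFlowOf T b ψ → ∀ t ∈ Set.Icc (0 : ℝ) T, ∀ x : ℝ, ψ t x = φ t x) ∧
      ∃ φ' : ℝ → ℝ → ℝ, ∃ C₁ c : ℝ, 0 < C₁ ∧ 0 < c ∧
        ∀ t ∈ Set.Icc (0 : ℝ) T,
          (∀ᵐ x ∂MeasureTheory.volume, HasDerivAt (φ t) (φ' t x) x) ∧
          IsAinftyWeight (fun x => |φ' t x|) ∧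
          bmoNorm (fun x => Real.log |φ' t x|) ≤
            (∫ s in (0 : ℝ)..t, C₁ * bmoNorm (b' s)) *
              Real.exp (c * ∫ s in (0 : ℝ)..t, bmoNorm (b' s)) := by
  obtain ⟨f, f', β, m, hc, hae⟩ := clean_exists T b b' hbint hderiv hstar
  choose X hX0 hX using fun x0 => exists_sol hc hT x0
  have hfb : ∀ᵐ t ∂volume.restrict (Ioc 0 T), f t = b t := hae.mono fun t h => h.1
  have hφ : FlowB T f (fun t x => X x t) := ⟨hX0, hX⟩
  refine ⟨fun t x => X x t, (flow_iff9 hfb).2 hφ, ?_, fun t => deriv (fun x => X x t), 24 * Real.exp 1, 6, by positivity, by norm_num, ?_⟩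
  · intro ψ hψ t ht x
    have hψ' := (flow_iff9 hfb).1 hψ
    exact sol_unique hc (hψ'.sol x) (hX x) hT.le (by rw [hψ'.start x, hX0 x]) ht
  · intro t ht
    have := flow_final hc hφ hT.le ht
    rw [ii_congr9 ht (h := fun s => 24 * Real.exp 1 * bmoNorm (b' s)) (hae.mono fun s h => by simp only [h.2]),
      ii_congr9 ht (h := fun s => bmoNorm (b' s)) (hae.mono fun s h => h.2)] at this
    exact this
end

section
/- There exist constants ε₀ ∈ (0,1] and C₄ > 0 such that: for every v ∈ BMO(ℝ) with v ≥ 0 a.e. on ℝ and ‖v‖_BMO < ε₀, the function e^v belongs to A_∞(ℝ) and [e^v]_{A_∞} ≤ 1 + C₄ ‖v‖_BMO. -/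
open MeasureTheory Set

/-- Dyadic averages of `f` of depth `n` in `(a,b]`. -/
noncomputable def dyE (f : ℝ → ℝ) : ℕ → ℝ → ℝ → ℝ → ℝ
  | 0, a, b, _ => avgI f a b
  | n + 1, a, b, x => if x ≤ (a + b) / 2 then dyE f n a ((a + b) / 2) x
      else dyE f n ((a + b) / 2) b x

lemma dyE_meas (f : ℝ → ℝ) (n : ℕ) : ∀ a b, Measurable (dyE f n a b) := by
  induction n with
  | zero => intro a b; exact measurable_const
  | succ n ih =>
    intro a b
    exact Measurable.ite measurableSet_Iic (ih _ _) (ih _ _)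

lemma dyE_mem (f : ℝ → ℝ) (n : ℕ) : ∀ a b x, a < b → x ∈ Ioc a b →
    ∃ w, x ∈ Metric.closedBall w ((b - a) / 2 ^ n / 2) ∧
      dyE f n a b x = avgI f (w - (b - a) / 2 ^ n / 2) (w + (b - a) / 2 ^ n / 2) := by
  induction n with
  | zero =>
    intro a b x hab hx
    refine ⟨(a + b) / 2, ?_, ?_⟩
    · rw [Real.closedBall_eq_Icc]
      constructor <;> linarith [hx.1, hx.2]
    · simp only [dyE]; congr 1 <;> ring
  | succ n ih =>
    intro a b x hab hx
    have e : (b - a) / 2 ^ (n + 1) / 2 = ((b - a) / 2) / 2 ^ n / 2 := by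
      rw [pow_succ]; field_simp
    rw [e]
    by_cases h : x ≤ (a + b) / 2
    · obtain ⟨w, h1, h2⟩ := ih a ((a + b) / 2) x (by linarith) ⟨hx.1, h⟩
      have e2 : (a + b) / 2 - a = (b - a) / 2 := by ring
      rw [e2] at h1 h2
      exact ⟨w, h1, by simp only [dyE, if_pos h]; exact h2⟩
    · obtain ⟨w, h1, h2⟩ := ih ((a + b) / 2) b x (by linarith) ⟨not_le.mp h, hx.2⟩
      have e2 : b - (a + b) / 2 = (b - a) / 2 := by ring
      rw [e2] at h1 h2
      exact ⟨w, h1, by simp only [dyE, if_neg h]; exact h2⟩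

lemma avg_sub_le {f : ℝ → ℝ} (hf : LocallyIntegrable f volume) {a b : ℝ} (hab : a < b) (c : ℝ) :
    |avgI f a b - c| ≤ (b - a)⁻¹ * ∫ x in a..b, |f x - c| := by
  have hi : IntervalIntegrable f volume a b :=
    (hf.integrableOn_isCompact isCompact_uIcc).intervalIntegrable
  have hp : 0 < b - a := by linarith
  have e : avgI f a b - c = (b - a)⁻¹ * ∫ x in a..b, (f x - c) := by
    rw [intervalIntegral.integral_sub hi intervalIntegrable_const, intervalIntegral.integral_const,
      avgI, smul_eq_mul]
    field_simp
  rw [e, abs_mul, abs_of_pos (inv_pos.mpr hp)]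
  gcongr
  exact intervalIntegral.abs_integral_le_integral_abs hab.le

lemma exp_lin {y : ℝ} (h0 : 0 ≤ y) (h : y ≤ 1 / 4) : Real.exp y ≤ 1 + 2 * y := by
  have := Real.abs_exp_sub_one_le (x := y) (by rw [abs_of_nonneg h0]; linarith)
  rw [abs_of_nonneg h0] at this
  linarith [le_abs_self (Real.exp y - 1)]

lemma half_step {f : ℝ → ℝ} (hf : LocallyIntegrable f volume)
    (hosc : ∀ a b, a < b → ∫ x in a..b, |f x - avgI f a b| ≤ 1 / 32 * (b - a))
    {p q : ℝ} (hpq : p < q) (g : ℝ → ℝ)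
    (ih : ∀ c, ∫ x in p..q, |f x - c| ≤ 1 / 8 * (q - p) →
      ∫⁻ x in Ioc p q, ENNReal.ofReal (Real.exp |g x - c|) ≤
        ENNReal.ofReal ((q - p) + 8 * ∫ x in p..q, |f x - c|)) (c : ℝ)
    (hc : ∫ x in p..q, |f x - c| ≤ 1 / 4 * (q - p)) :
    ∫⁻ x in Ioc p q, ENNReal.ofReal (Real.exp |g x - c|) ≤
        ENNReal.ofReal ((q - p) + 8 * ∫ x in p..q, |f x - c|) := by
  by_cases h : ∫ x in p..q, |f x - c| ≤ 1 / 8 * (q - p)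
  · exact ih c h
  push Not at h
  have hp : 0 < q - p := by linarith
  have h1 := hosc p q hpq
  have h2 := ih (avgI f p q) (by linarith)
  have h3 : |avgI f p q - c| ≤ 1 / 4 := by
    refine (avg_sub_le hf hpq c).trans ?_
    rw [inv_mul_le_iff₀ hp]; linarith
  have h4 : Real.exp |avgI f p q - c| ≤ 3 / 2 := by
    have := exp_lin (abs_nonneg _) h3
    linarith
  calc ∫⁻ x in Ioc p q, ENNReal.ofReal (Real.exp |g x - c|)
      ≤ ∫⁻ x in Ioc p q, ENNReal.ofReal (3 / 2) *
          ENNReal.ofReal (Real.exp |g x - avgI f p q|) := by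
        apply lintegral_mono
        intro x
        dsimp only
        rw [← ENNReal.ofReal_mul (by norm_num)]
        apply ENNReal.ofReal_le_ofReal
        calc Real.exp |g x - c| ≤ Real.exp (|avgI f p q - c| + |g x - avgI f p q|) := by
              apply Real.exp_le_exp.mpr
              have := abs_add_le (avgI f p q - c) (g x - avgI f p q)
              rw [show g x - c = avgI f p q - c + (g x - avgI f p q) by ring]
              exact this
          _ ≤ _ := by rw [Real.exp_add]; gcongr
    _ = ENNReal.ofReal (3 / 2) * ∫⁻ x in Ioc p q, ENNReal.ofReal (Real.exp |g x - avgI f p q|) :=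
        lintegral_const_mul' _ _ ENNReal.ofReal_ne_top
    _ ≤ ENNReal.ofReal (3 / 2) *
          ENNReal.ofReal ((q - p) + 8 * ∫ x in p..q, |f x - avgI f p q|) := by gcongr
    _ ≤ _ := by
        rw [← ENNReal.ofReal_mul (by norm_num)]
        apply ENNReal.ofReal_le_ofReal
        linarith

lemma dyE_bound {f : ℝ → ℝ} (hf : LocallyIntegrable f volume)
    (hosc : ∀ a b, a < b → ∫ x in a..b, |f x - avgI f a b| ≤ 1 / 32 * (b - a)) (n : ℕ) :
    ∀ p q, p < q → ∀ c, ∫ x in p..q, |f x - c| ≤ 1 / 8 * (q - p) →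
      ∫⁻ x in Ioc p q, ENNReal.ofReal (Real.exp |dyE f n p q x - c|) ≤
        ENNReal.ofReal ((q - p) + 8 * ∫ x in p..q, |f x - c|) := by
  induction n with
  | zero =>
    intro p q hpq c hc
    have hp : 0 < q - p := by linarith
    have h1 := avg_sub_le hf hpq c
    have h3 : |avgI f p q - c| ≤ 1 / 4 := by
      refine h1.trans ?_
      rw [inv_mul_le_iff₀ hp]; linarith
    simp only [dyE, lintegral_const, Measure.restrict_apply_univ, Real.volume_Ioc]
    rw [← ENNReal.ofReal_mul (Real.exp_pos _).le]
    apply ENNReal.ofReal_le_ofReal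
    have h4 := exp_lin (abs_nonneg _) h3
    rw [← div_eq_inv_mul, le_div_iff₀ hp] at h1
    have h5 := mul_nonneg (abs_nonneg (avgI f p q - c)) hp.le
    nlinarith
  | succ n ih =>
    intro p q hpq c hc
    have hpm : p < (p + q) / 2 := by linarith
    have hmq : (p + q) / 2 < q := by linarith
    set m := (p + q) / 2 with hm
    have hi : ∀ s t, IntervalIntegrable (fun x => |f x - c|) volume s t := fun s t =>
      (((hf.integrableOn_isCompact isCompact_uIcc).intervalIntegrable).sub
        intervalIntegrable_const).abs
    have hadd := intervalIntegral.integral_add_adjacent_intervals (hi p m) (hi m q)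
    have n1 : 0 ≤ ∫ x in p..m, |f x - c| :=
      intervalIntegral.integral_nonneg hpm.le (fun _ _ => abs_nonneg _)
    have n2 : 0 ≤ ∫ x in m..q, |f x - c| :=
      intervalIntegral.integral_nonneg hmq.le (fun _ _ => abs_nonneg _)
    have b1 := half_step hf hosc hpm _ (ih p m hpm) c (by linarith)
    have b2 := half_step hf hosc hmq _ (ih m q hmq) c (by linarith)
    rw [← Ioc_union_Ioc_eq_Ioc hpm.le hmq.le, lintegral_union measurableSet_Ioc
      (Ioc_disjoint_Ioc_of_le le_rfl)]
    have e1 : ∫⁻ x in Ioc p m, ENNReal.ofReal (Real.exp |dyE f (n + 1) p q x - c|) =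
        ∫⁻ x in Ioc p m, ENNReal.ofReal (Real.exp |dyE f n p m x - c|) := by
      apply setLIntegral_congr_fun measurableSet_Ioc
      intro x hx
      have : x ≤ (p + q) / 2 := hx.2
      simp only [dyE, if_pos this]; rfl
    have e2 : ∫⁻ x in Ioc m q, ENNReal.ofReal (Real.exp |dyE f (n + 1) p q x - c|) =
        ∫⁻ x in Ioc m q, ENNReal.ofReal (Real.exp |dyE f n m q x - c|) := by
      apply setLIntegral_congr_fun measurableSet_Ioc
      intro x hx
      have : ¬ x ≤ (p + q) / 2 := not_le.mpr hx.1
      simp only [dyE, if_neg this]; rfl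
    rw [e1, e2]
    refine (add_le_add b1 b2).trans ?_
    rw [← ENNReal.ofReal_add (by linarith) (by linarith)]
    apply ENNReal.ofReal_le_ofReal
    linarith

lemma dyE_tendsto {f : ℝ → ℝ} (hf : LocallyIntegrable f volume) {a b : ℝ} (hab : a < b) :
    ∀ᵐ x ∂(volume.restrict (Ioc a b)),
      Filter.Tendsto (fun n => dyE f n a b x) Filter.atTop (nhds (f x)) := by
  rw [ae_restrict_iff' measurableSet_Ioc]
  filter_upwards [IsUnifLocDoublingMeasure.ae_tendsto_average volume hf 1] with x hx hxI
  have hp : 0 < b - a := by linarith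
  choose w hw1 hw2 using fun n => dyE_mem f n a b x hab hxI
  have hd : ∀ n : ℕ, 0 < (b - a) / 2 ^ n / 2 := fun n => by positivity
  have ht : Filter.Tendsto (fun n : ℕ => (b - a) / 2 ^ n / 2) Filter.atTop
      (nhdsWithin 0 (Ioi 0)) := by
    apply tendsto_nhdsWithin_of_tendsto_nhds_of_eventually_within
    · have := (tendsto_pow_atTop_nhds_zero_of_lt_one (r := (1/2 : ℝ)) (by norm_num)
        (by norm_num)).const_mul ((b - a) / 2)
      rw [mul_zero] at this
      refine this.congr fun n => ?_
      rw [div_pow, one_pow]; ring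
    · exact Filter.Eventually.of_forall hd
  have := hx w _ ht (Filter.Eventually.of_forall fun n => by simpa using hw1 n)
  refine this.congr fun n => ?_
  rw [hw2 n, Real.closedBall_eq_Icc, setAverage_eq, integral_Icc_eq_integral_Ioc,
    ← intervalIntegral.integral_of_le (by linarith [hd n]), avgI, smul_eq_mul, Measure.real,
    Real.volume_Icc, ENNReal.toReal_ofReal (by linarith [hd n])]

lemma exp_bound {f : ℝ → ℝ} (hf : LocallyIntegrable f volume)
    (hosc : ∀ a b, a < b → ∫ x in a..b, |f x - avgI f a b| ≤ 1 / 32 * (b - a))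
    {a b : ℝ} (hab : a < b) :
    ∫⁻ x in Ioc a b, ENNReal.ofReal (Real.exp (f x - avgI f a b)) ≤
        ENNReal.ofReal ((b - a) + 8 * ∫ x in a..b, |f x - avgI f a b|) := by
  set c := avgI f a b with hc
  have hle := fun n => dyE_bound hf hosc n a b hab c (by linarith [hosc a b hab])
  calc ∫⁻ x in Ioc a b, ENNReal.ofReal (Real.exp (f x - c))
      ≤ ∫⁻ x in Ioc a b, Filter.liminf
          (fun n => ENNReal.ofReal (Real.exp |dyE f n a b x - c|)) Filter.atTop := by
        apply lintegral_mono_ae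
        filter_upwards [dyE_tendsto hf hab] with x hx
        have h2 : Filter.Tendsto (fun n => ENNReal.ofReal (Real.exp |dyE f n a b x - c|))
            Filter.atTop (nhds (ENNReal.ofReal (Real.exp |f x - c|))) :=
          (ENNReal.continuous_ofReal.tendsto _).comp
            ((Real.continuous_exp.tendsto _).comp (hx.sub_const c).abs)
        rw [h2.liminf_eq]
        exact ENNReal.ofReal_le_ofReal (Real.exp_le_exp.mpr (le_abs_self _))
    _ ≤ Filter.liminf (fun n => ∫⁻ x in Ioc a b,
          ENNReal.ofReal (Real.exp |dyE f n a b x - c|)) Filter.atTop := by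
        apply lintegral_liminf_le
        intro n
        have := dyE_meas f n a b
        fun_prop
    _ ≤ _ := by
        refine (Filter.liminf_le_liminf (Filter.Eventually.of_forall hle)).trans ?_
        simp

theorem exp_of_small_bmo_is_ainfty :
    ∃ ε₀ C₄ : ℝ, 0 < ε₀ ∧ ε₀ ≤ 1 ∧ 0 < C₄ ∧
      ∀ v : ℝ → ℝ, MemBMO v → (∀ᵐ x ∂MeasureTheory.volume, 0 ≤ v x) →
        bmoNorm v < ε₀ →
          IsAinftyWeight (fun x => Real.exp (v x)) ∧
            ainftyConst (fun x => Real.exp (v x)) ≤ 1 + C₄ * bmoNorm v := by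
  refine ⟨1 / 32, 8, by norm_num, by norm_num, by norm_num, ?_⟩
  rintro v ⟨hf, hbdd⟩ - hv
  have hosc' : ∀ a b, a < b → ∫ x in a..b, |v x - avgI v a b| ≤ bmoNorm v * (b - a) := by
    intro a b hab
    have hp : 0 < b - a := by linarith
    have h := le_csSup hbdd ⟨a, b, hab, rfl⟩
    change avgI _ a b ≤ bmoNorm v at h
    rw [avgI, inv_mul_le_iff₀ hp] at h
    linarith
  have hosc : ∀ a b, a < b → ∫ x in a..b, |v x - avgI v a b| ≤ 1 / 32 * (b - a) := by
    intro a b hab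
    have hp : 0 < b - a := by linarith
    exact (hosc' a b hab).trans (by gcongr)
  have hint : ∀ a b, a < b →
      IntegrableOn (fun x => Real.exp (v x - avgI v a b)) (Ioc a b) volume := by
    intro a b hab
    have hm : AEStronglyMeasurable v (volume.restrict (Ioc a b)) :=
      hf.aestronglyMeasurable.restrict
    refine ⟨Real.continuous_exp.comp_aestronglyMeasurable (hm.sub aestronglyMeasurable_const), ?_⟩
    rw [hasFiniteIntegral_iff_ofReal (Filter.Eventually.of_forall fun x => (Real.exp_pos _).le)]
    exact (exp_bound hf hosc hab).trans_lt ENNReal.ofReal_lt_top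
  have hquot : ∀ r ∈ ainftySet (fun x => Real.exp (v x)), r ≤ 1 + 8 * bmoNorm v := by
    rintro r ⟨a, b, hab, rfl⟩
    have hp : 0 < b - a := by linarith
    have e : ainftyQuot (fun x => Real.exp (v x)) a b =
        (b - a)⁻¹ * ∫ x in a..b, Real.exp (v x - avgI v a b) := by
      simp only [ainftyQuot, Real.log_exp, sub_eq_add_neg, Real.exp_add]
      rw [intervalIntegral.integral_mul_const, avgI]
      ring_nf
    have n1 : 0 ≤ ∫ x in a..b, |v x - avgI v a b| :=
      intervalIntegral.integral_nonneg hab.le (fun _ _ => abs_nonneg _)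
    rw [e, inv_mul_le_iff₀ hp, intervalIntegral.integral_of_le hab.le,
      integral_eq_lintegral_of_nonneg_ae
        (Filter.Eventually.of_forall fun x => (Real.exp_pos _).le) (hint a b hab).1]
    have := ENNReal.toReal_le_of_le_ofReal (by linarith) (exp_bound hf hosc hab)
    linarith [hosc' a b hab]
  refine ⟨⟨fun x => (Real.exp_pos _).le, ?_, ⟨_, hquot⟩⟩, ?_⟩
  · intro x
    refine ⟨Ioc (x - 1) (x + 1), Ioc_mem_nhds (by linarith) (by linarith), ?_⟩
    have := (hint (x - 1) (x + 1) (by linarith)).mul_const (Real.exp (avgI v (x - 1) (x + 1)))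
    simp only [← Real.exp_add, sub_add_cancel] at this
    exact this
  · exact csSup_le ⟨_, 0, 1, by norm_num, rfl⟩ hquot
end

section
/- Suppose b ∈ L¹_loc(ℝ) is locally absolutely continuous with derivative b' ∈ BMO(ℝ). Then b satisfies the Zygmund condition: |b(x+y) + b(x−y) − 2b(x)| ≤ 2|y| ‖b'‖_BMO for all (x,y) ∈ ℝ × ℝ. -/
open MeasureTheory Set

theorem zyg_aux (b b' : ℝ → ℝ) (hb' : MemBMO b')
    (hftc : ∀ x y : ℝ, b y - b x = ∫ z in x..y, b' z) (x y : ℝ) (hy : 0 < y) :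
    |b (x + y) + b (x - y) - 2 * b x| ≤ 2 * y * bmoNorm b' := by
  obtain ⟨hl, hbd⟩ := hb'
  have hle : avgI (fun t => |b' t - avgI b' (x - y) (x + y)|) (x - y) (x + y) ≤ bmoNorm b' :=
    le_csSup hbd ⟨x - y, x + y, by linarith, rfl⟩
  generalize avgI b' (x - y) (x + y) = c at hle
  have hi : ∀ u v : ℝ, IntervalIntegrable b' volume u v := fun u v =>
    (hl.integrableOn_isCompact isCompact_uIcc).intervalIntegrable
  have hg : ∀ u v : ℝ, IntervalIntegrable (fun t => b' t - c) volume u v := fun u v =>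
    (hi u v).sub intervalIntegrable_const
  have h1 : ∀ u v : ℝ, ∫ t in u..v, (b' t - c) = b v - b u - (v - u) * c := fun u v => by
    rw [intervalIntegral.integral_sub (hi u v) intervalIntegrable_const, hftc,
      intervalIntegral.integral_const, smul_eq_mul]
  have ha := intervalIntegral.abs_integral_le_integral_abs (μ := volume)
    (f := fun t => b' t - c) (show x - y ≤ x by linarith)
  have hb := intervalIntegral.abs_integral_le_integral_abs (μ := volume)
    (f := fun t => b' t - c) (show x ≤ x + y by linarith)
  have hs := intervalIntegral.integral_add_adjacent_intervals
    (hg (x - y) x).abs (hg x (x + y)).abs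
  rw [h1] at ha hb
  unfold avgI at hle
  rw [inv_mul_le_iff₀ (by linarith)] at hle
  rw [abs_le] at ha hb ⊢
  constructor <;> linarith [ha.1, ha.2, hb.1, hb.2]

/-- A locally absolutely continuous `b` with derivative `b' ∈ BMO(ℝ)` satisfies the Zygmund
condition `|b(x+y) + b(x-y) - 2 b(x)| ≤ 2 |y| ‖b'‖_BMO`. -/
theorem zygmund_of_bmo_deriv (b b' : ℝ → ℝ)
    (hb : MeasureTheory.LocallyIntegrable b MeasureTheory.volume)
    (hb' : MemBMO b')
    (hftc : ∀ x y : ℝ, b y - b x = ∫ z in x..y, b' z) :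
    ∀ x y : ℝ, |b (x + y) + b (x - y) - 2 * b x| ≤ 2 * |y| * bmoNorm b' := by
  intro x y
  rcases lt_trichotomy y 0 with hy | hy | hy
  · have h := zyg_aux b b' hb' hftc x (-y) (by linarith)
    rw [abs_of_neg hy]
    rw [sub_neg_eq_add, ← sub_eq_add_neg, add_comm (b (x - y))] at h
    exact h
  · subst hy
    simp [two_mul]
  · rw [abs_of_pos hy]
    exact zyg_aux b b' hb' hftc x y hy
end

section
/- Suppose b ∈ L¹_loc(ℝ) is locally absolutely continuous with derivative b' ∈ BMO(ℝ). Then there is a constant C₅ > 0 (independent of b) such that |b(x) − b(0)| ≤ C₅ ‖b'‖_* |x| (1 + |log|x||) for all x ∈ ℝ with x ≠ 0. -/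
open MeasureTheory Set

lemma gb_abstract (g : ℝ → ℝ) (N S : ℝ) (hN : 0 ≤ N)
    (h : ∀ t s, 0 < t → t ≤ s → s ≤ 3 * t → |g t - g s| ≤ 3 * N) (h1 : |g 1| ≤ S)
    (x : ℝ) (hx : 0 < x) : |g x| ≤ S + 3 * N * (1 + |Real.log x|) := by
  have key : ∀ n : ℕ, ∀ t s, 0 < t → t ≤ s → s ≤ 3 ^ n * t → |g t - g s| ≤ 3 * N * n := by
    intro n
    induction n with
    | zero =>
      intro t s ht hts hs
      have : t = s := by
        simp at hs
        linarith
      simp [this]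
    | succ n ih =>
      intro t s ht hts hs
      rw [pow_succ] at hs
      push_cast
      by_cases hc : s ≤ 3 * t
      · have := h t s ht hts hc
        have h2 : 0 ≤ N * n := by positivity
        linarith
      · push Not at hc
        have a1 := ih t (s/3) ht (by linarith) (by linarith)
        have a2 := h (s/3) s (by linarith) (by linarith) (by linarith)
        have := abs_sub_le (g t) (g (s/3)) (g s)
        linarith
  set n := ⌈|Real.log x|⌉₊ with hn
  have hn1 : |Real.log x| ≤ n := Nat.le_ceil _
  have hn2 : (n:ℝ) < |Real.log x| + 1 := Nat.ceil_lt_add_one (abs_nonneg _)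
  have e3 : Real.exp n ≤ 3 ^ n := by
    rw [← Real.exp_one_pow]
    exact pow_le_pow_left₀ (Real.exp_pos _).le (by linarith [Real.exp_one_lt_d9]) n
  have hb : 3 * N * n ≤ 3 * N * (1 + |Real.log x|) := by
    apply mul_le_mul_of_nonneg_left <;> linarith
  have hd : |g x - g 1| ≤ 3 * N * n := by
    rcases le_total x 1 with hx1 | hx1
    · apply key n x 1 hx hx1
      have : Real.exp (-Real.log x) ≤ Real.exp n := Real.exp_le_exp.2 ((neg_le_abs _).trans hn1)
      rw [Real.exp_neg, Real.exp_log hx] at this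
      calc (1:ℝ) = x⁻¹ * x := by field_simp
        _ ≤ 3 ^ n * x := by gcongr; linarith
    · rw [abs_sub_comm]
      apply key n 1 x one_pos hx1
      have : Real.exp (Real.log x) ≤ Real.exp n := Real.exp_le_exp.2 ((le_abs_self _).trans hn1)
      rw [Real.exp_log hx] at this
      linarith
  have := abs_sub_abs_le_abs_sub (g x) (g 1)
  linarith

lemma osc_le (f : ℝ → ℝ) (hf : MemBMO f) (a b : ℝ) (hab : a < b) :
    (b - a)⁻¹ * ∫ x in a..b, |f x - avgI f a b| ≤ bmoNorm f :=
  le_csSup hf.2 ⟨a, b, hab, rfl⟩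

lemma ii_of (f : ℝ → ℝ) (hf : MemBMO f) (a b : ℝ) : IntervalIntegrable f volume a b :=
  (hf.1.integrableOn_isCompact isCompact_uIcc).intervalIntegrable

lemma bmo_nonneg (f : ℝ → ℝ) (hf : MemBMO f) : 0 ≤ bmoNorm f := by
  refine le_trans ?_ (osc_le f hf 0 1 one_pos)
  have := intervalIntegral.integral_nonneg (f := fun x => |f x - avgI f 0 1|) (μ := volume)
    (zero_le_one (α := ℝ)) (fun x _ => abs_nonneg _)
  simpa using this

lemma nested (f : ℝ → ℝ) (hf : MemBMO f) (a b u v : ℝ) (huv : u < v) (hau : a ≤ u) (hvb : v ≤ b)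
    (h3 : b - a ≤ 3 * (v - u)) : |avgI f u v - avgI f a b| ≤ 3 * bmoNorm f := by
  have hab : a < b := by linarith
  have ho := osc_le f hf a b hab
  have hN := bmo_nonneg f hf
  set A := avgI f a b with hA
  have hvu : 0 < v - u := by linarith
  have hba : 0 < b - a := by linarith
  rw [inv_mul_le_iff₀ hba] at ho
  have e : avgI f u v - A = (v-u)⁻¹ * ∫ x in u..v, (f x - A) := by
    rw [intervalIntegral.integral_sub (ii_of f hf u v) (by simp)]
    simp only [avgI, intervalIntegral.integral_const, smul_eq_mul]
    field_simp
  have hi : IntervalIntegrable (fun x => |f x - A|) volume a b :=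
    ((ii_of f hf a b).sub (by simp)).abs
  have m : ∫ x in u..v, |f x - A| ≤ ∫ x in a..b, |f x - A| :=
    intervalIntegral.integral_mono_interval hau huv.le hvb
      (Filter.Eventually.of_forall fun x => abs_nonneg _) hi
  have n := intervalIntegral.abs_integral_le_integral_abs (f := fun x => f x - A) (μ := volume) huv.le
  rw [e, abs_mul, abs_of_pos (inv_pos.2 hvu), inv_mul_le_iff₀ hvu]
  have := mul_le_mul_of_nonneg_right h3 hN
  linarith

lemma avg_one (f : ℝ → ℝ) (hf : MemBMO f) (u v : ℝ) (hu : -1 ≤ u) (hv : v ≤ 1) (huv : v - u = 1) :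
    |avgI f u v| ≤ ∫ x in (-1:ℝ)..1, |f x| := by
  have n := intervalIntegral.abs_integral_le_integral_abs (f := f) (μ := volume)
    (show u ≤ v by linarith)
  have m : ∫ x in u..v, |f x| ≤ ∫ x in (-1:ℝ)..1, |f x| :=
    intervalIntegral.integral_mono_interval hu (by linarith) hv
      (Filter.Eventually.of_forall fun x => abs_nonneg _) (ii_of f hf _ _).abs
  simp only [avgI, huv, inv_one, one_mul]
  linarith

/-- Growth estimate: `|b(x) - b(0)| ≤ C₅ ‖b'‖_* |x| (1 + |log|x||)` for `b` locally absolutely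
continuous with derivative `b' ∈ BMO(ℝ)`. -/
theorem growth_est_of_bmo_deriv :
    ∃ C₅ : ℝ, 0 < C₅ ∧
      ∀ b b' : ℝ → ℝ,
        MeasureTheory.LocallyIntegrable b MeasureTheory.volume →
        MemBMO b' →
        (∀ x y : ℝ, b y - b x = ∫ z in x..y, b' z) →
        ∀ x : ℝ, x ≠ 0 →
          |b x - b 0| ≤ C₅ * starNorm b' * (|x| * (1 + |Real.log (|x|)|)) := by
  refine ⟨3, by norm_num, ?_⟩
  intro b f _ hf hb x hx
  have hN := bmo_nonneg f hf
  have hS : 0 ≤ ∫ x in (-1:ℝ)..1, |f x| :=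
    intervalIntegral.integral_nonneg (by norm_num) (fun x _ => abs_nonneg _)
  have hL := abs_nonneg (Real.log |x|)
  have hx0 : 0 < |x| := abs_pos.2 hx
  suffices H : ∃ g : ℝ, |b x - b 0| = |x| * |g| ∧
      |g| ≤ (∫ x in (-1:ℝ)..1, |f x|) + 3 * bmoNorm f * (1 + |Real.log (|x|)|) by
    obtain ⟨g, h1, h2⟩ := H
    rw [h1, starNorm]
    have : |g| ≤ 3 * (bmoNorm f + ∫ x in (-1:ℝ)..1, |f x|) * (1 + |Real.log (|x|)|) := by
      nlinarith [mul_nonneg hS hL]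
    calc |x| * |g| ≤ |x| * _ := mul_le_mul_of_nonneg_left this hx0.le
      _ = _ := by ring
  rcases lt_or_gt_of_ne hx with hneg | hpos
  · refine ⟨avgI f (-|x|) 0, ?_, gb_abstract (fun t => avgI f (-t) 0) _ _ hN ?_ ?_ _ hx0⟩
    · rw [← abs_sub_comm, hb, avgI, abs_mul, abs_of_neg hneg]
      have : 0 < -x := by linarith
      simp only [neg_neg, zero_sub]
      rw [abs_of_pos (inv_pos.2 this)]
      field_simp
    · intro t s ht hts hs
      exact nested f hf _ _ _ _ (by linarith) (by linarith) le_rfl (by linarith)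
    · exact avg_one f hf _ _ (by norm_num) (by norm_num) (by norm_num)
  · refine ⟨avgI f 0 |x|, ?_, gb_abstract (fun t => avgI f 0 t) _ _ hN ?_ ?_ _ hx0⟩
    · rw [hb, avgI, abs_mul, abs_of_pos hpos]
      simp only [sub_zero]
      rw [abs_of_pos (inv_pos.2 hpos)]
      field_simp
    · intro t s ht hts hs
      exact nested f hf _ _ _ _ (by linarith) le_rfl (by linarith) (by linarith)
    · exact avg_one f hf _ _ (by norm_num) (by norm_num) (by norm_num)
end

section
/- Suppose b ∈ L¹_loc(ℝ) is locally absolutely continuous with derivative b' ∈ BMO(ℝ). Then there is a constant C₅ > 0 (independent of b) such that |b(x+h) − b(x)| ≤ C₅ ‖b'‖_* (log⁺|x|) · |h| (1 + |log|h||) for all x ∈ ℝ and all h ≠ 0. -/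
open MeasureTheory Set

lemma aux_ii {f : ℝ → ℝ} (hf : LocallyIntegrable f volume) (a b : ℝ) :
    IntervalIntegrable f volume a b := by
  rw [intervalIntegrable_iff]
  exact (hf.integrableOn_isCompact isCompact_uIcc).mono_set uIoc_subset_uIcc

lemma aux_osc {f : ℝ → ℝ} (hf : MemBMO f) {a b : ℝ} (hab : a < b) :
    ∫ x in a..b, |f x - avgI f a b| ≤ (b - a) * bmoNorm f := by
  have h : avgI (fun x => |f x - avgI f a b|) a b ≤ bmoNorm f :=
    le_csSup hf.2 ⟨a, b, hab, rfl⟩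
  have hp : 0 < b - a := sub_pos.2 hab
  have h2 := mul_le_mul_of_nonneg_left h hp.le
  have h3 : (b - a) * avgI (fun x => |f x - avgI f a b|) a b
      = ∫ x in a..b, |f x - avgI f a b| := by
    conv_lhs => unfold avgI
    rw [← mul_assoc, mul_inv_cancel₀ hp.ne', one_mul]
    rfl
  rw [h3] at h2
  exact h2

lemma aux_nonneg {f : ℝ → ℝ} (hf : MemBMO f) : 0 ≤ bmoNorm f := by
  have h := aux_osc hf (show (0:ℝ) < 1 by norm_num)
  have h2 : 0 ≤ ∫ x in (0:ℝ)..1, |f x - avgI f 0 1| :=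
    intervalIntegral.integral_nonneg (by norm_num) (fun x _ => abs_nonneg _)
  linarith

lemma aux_A {f : ℝ → ℝ} (hf : MemBMO f) {a b c d : ℝ} (hab : a < b) (hca : c ≤ a) (hbd : b ≤ d)
    (h2 : d - c ≤ 2 * (b - a)) : |avgI f a b - avgI f c d| ≤ 2 * bmoNorm f := by
  have hp : 0 < b - a := sub_pos.2 hab
  set m := avgI f c d with hm
  have hi : ∀ u v : ℝ, IntervalIntegrable (fun x => f x - m) volume u v := fun u v =>
    (aux_ii hf.1 u v).sub intervalIntegrable_const
  have e : (b - a) * (avgI f a b - m) = ∫ x in a..b, (f x - m) := by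
    rw [intervalIntegral.integral_sub (aux_ii hf.1 a b) intervalIntegrable_const]
    simp only [avgI, intervalIntegral.integral_const, smul_eq_mul]
    rw [mul_sub, ← mul_assoc, mul_inv_cancel₀ hp.ne', one_mul]
  have h3 : |∫ x in a..b, (f x - m)| ≤ ∫ x in a..b, |f x - m| :=
    intervalIntegral.abs_integral_le_integral_abs hab.le
  have h4 : ∫ x in a..b, |f x - m| ≤ ∫ x in c..d, |f x - m| :=
    intervalIntegral.integral_mono_interval hca hab.le hbd
      (Filter.Eventually.of_forall fun x => abs_nonneg _) (hi c d).abs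
  have h5 := aux_osc hf (show c < d by linarith)
  rw [← hm] at h5
  rw [← e, abs_mul, abs_of_pos hp] at h3
  have h6 := mul_le_mul_of_nonneg_right h2 (aux_nonneg hf)
  have : (b - a) * |avgI f a b - m| ≤ (b - a) * (2 * bmoNorm f) := by linarith
  exact le_of_mul_le_mul_left this hp

lemma aux_B {f : ℝ → ℝ} (hf : MemBMO f) {a b : ℝ} (hab : a < b) (n : ℕ) :
    ∀ c d : ℝ, c ≤ a → b ≤ d → d - c ≤ (2 ^ n + 1) * (b - a) →
      |avgI f a b - avgI f c d| ≤ (2 * n + 2) * bmoNorm f := by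
  induction n with
  | zero =>
    intro c d hca hbd h
    have := aux_A hf hab hca hbd (by norm_num at h; linarith)
    simpa using this
  | succ n ih =>
    intro c d hca hbd h
    have h1 := ih ((a + c) / 2) ((b + d) / 2) (by linarith) (by linarith)
      (by rw [pow_succ] at h; linarith)
    have h2 := aux_A hf (a := (a + c) / 2) (b := (b + d) / 2) (c := c) (d := d)
      (by linarith) (by linarith) (by linarith) (by linarith)
    have h3 := abs_sub_le (avgI f a b) (avgI f ((a + c) / 2) ((b + d) / 2)) (avgI f c d)
    push_cast
    linarith

lemma aux_C {f : ℝ → ℝ} (hf : MemBMO f) {a b c d : ℝ} (hab : a < b) (hca : c ≤ a) (hbd : b ≤ d) :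
    |avgI f a b - avgI f c d| ≤ (4 + 4 * Real.log ((d - c) / (b - a))) * bmoNorm f := by
  have hp : 0 < b - a := sub_pos.2 hab
  set R := (d - c) / (b - a) with hR
  have hR1 : 1 ≤ R := by rw [hR, le_div_iff₀ hp]; linarith
  have hl : 0 ≤ Real.log R := Real.log_nonneg hR1
  have hl2 : (1:ℝ) / 2 < Real.log 2 := by linarith [Real.log_two_gt_d9]
  set n := ⌈Real.logb 2 R⌉₊ with hn
  have hRn : R ≤ 2 ^ n := by
    have : Real.logb 2 R ≤ (n : ℝ) := Nat.le_ceil _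
    rw [Real.logb_le_iff_le_rpow (by norm_num) (by linarith)] at this
    simpa using this
  have hn2 : (n : ℝ) ≤ 1 + 2 * Real.log R := by
    have h1 : (n : ℝ) < Real.logb 2 R + 1 :=
      Nat.ceil_lt_add_one (Real.logb_nonneg (by norm_num) hR1)
    have h2 : Real.logb 2 R ≤ 2 * Real.log R := by
      unfold Real.logb
      rw [div_le_iff₀ (by linarith)]
      nlinarith
    linarith
  have hdc : d - c ≤ (2 ^ n + 1) * (b - a) := by
    rw [← div_le_iff₀ hp]; linarith
  refine (aux_B hf hab n c d hca hbd hdc).trans ?_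
  exact mul_le_mul_of_nonneg_right (by linarith) (aux_nonneg hf)

lemma aux_log {t : ℝ} (ht : 0 ≤ t) : Real.log (1 + t) ≤ 1 + max 0 (Real.log t) := by
  have hl2 : Real.log 2 < 1 := by linarith [Real.log_two_lt_d9]
  rcases le_total t 1 with h | h
  · have : Real.log (1 + t) ≤ Real.log 2 := Real.log_le_log (by linarith) (by linarith)
    linarith [le_max_left 0 (Real.log t)]
  · have : Real.log (1 + t) ≤ Real.log (2 * t) := Real.log_le_log (by linarith) (by linarith)
    rw [Real.log_mul (by norm_num) (by linarith)] at this
    linarith [le_max_right 0 (Real.log t)]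

theorem modulus_of_continuity_of_bmo_deriv :
    ∃ C₅ : ℝ, 0 < C₅ ∧
      ∀ b b' : ℝ → ℝ,
        MeasureTheory.LocallyIntegrable b MeasureTheory.volume →
        MemBMO b' →
        (∀ x y : ℝ, b y - b x = ∫ z in x..y, b' z) →
        ∀ x h : ℝ, h ≠ 0 →
          |b (x + h) - b x| ≤
            C₅ * starNorm b' * logPlus |x| * (|h| * (1 + |Real.log (|h|)|)) := by
  refine ⟨60, by norm_num, ?_⟩
  intro b f _ hf hb x h hh
  have hhp : 0 < |h| := abs_pos.2 hh
  have hM := aux_nonneg hf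
  have hA : 0 ≤ ∫ x in (-1:ℝ)..1, |f x| :=
    intervalIntegral.integral_nonneg (by norm_num) (fun x _ => abs_nonneg _)
  have h0 : |avgI f (-1) 1| ≤ ∫ x in (-1:ℝ)..1, |f x| := by
    have h3 : |∫ x in (-1:ℝ)..1, f x| ≤ ∫ x in (-1:ℝ)..1, |f x| :=
      intervalIntegral.abs_integral_le_integral_abs (by norm_num)
    unfold avgI
    rw [abs_mul, show |((1:ℝ) - -1)⁻¹| = 1 / 2 by norm_num]
    linarith
  -- reduce to an ordered interval
  obtain ⟨p, q, hpq, hlen, hx1, hx2, hint⟩ : ∃ p q : ℝ, p < q ∧ q - p = |h| ∧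
      -(|x| + |h|) ≤ p ∧ q ≤ |x| + |h| ∧ |b (x + h) - b x| = |∫ z in p..q, f z| := by
    have := neg_abs_le x
    have := le_abs_self x
    rcases lt_or_gt_of_ne hh with hneg | hpos
    · refine ⟨x + h, x, by linarith, ?_, ?_, ?_, ?_⟩
      · rw [abs_of_neg hneg]; ring
      · rw [abs_of_neg hneg]; linarith
      · linarith
      · rw [hb x (x + h), intervalIntegral.integral_symm, abs_neg]
    · refine ⟨x, x + h, by linarith, ?_, ?_, ?_, ?_⟩
      · rw [abs_of_pos hpos]; ring
      · linarith
      · rw [abs_of_pos hpos]; linarith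
      · rw [hb x (x + h)]
  have hI : |b (x + h) - b x| = |h| * |avgI f p q| := by
    rw [hint]
    unfold avgI
    rw [hlen, abs_mul, abs_inv, abs_abs, ← mul_assoc, mul_inv_cancel₀ hhp.ne', one_mul]
  set T := 1 + |x| + |h| with hT
  have hxn := abs_nonneg x
  have hTp : 0 < T := by positivity
  have c1 := aux_C hf hpq (c := -T) (d := T) (by linarith) (by linarith)
  have c2 := aux_C hf (show (-1:ℝ) < 1 by norm_num) (c := -T) (d := T) (by linarith) (by linarith)
  have e1 : Real.log ((T - -T) / (q - p)) = Real.log 2 + Real.log T - Real.log |h| := by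
    rw [hlen, show T - -T = 2 * T by ring, Real.log_div (by positivity) hhp.ne',
      Real.log_mul (by norm_num) hTp.ne']
  have e2 : Real.log ((T - -T) / (1 - -1)) = Real.log T := by
    congr 1; ring
  rw [e1] at c1
  rw [e2] at c2
  have hl2 : Real.log 2 < 1 := by linarith [Real.log_two_lt_d9]
  have hLT : Real.log T ≤ 2 + logPlus |x| + |Real.log (|h|)| := by
    have k1 : Real.log T ≤ Real.log ((1 + |x|) * (1 + |h|)) :=
      Real.log_le_log hTp (by nlinarith)
    rw [Real.log_mul (by positivity) (by positivity)] at k1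
    have k2 := aux_log hxn
    have k3 := aux_log hhp.le
    have k4 : max 0 (Real.log |x|) ≤ logPlus |x| := max_le_max (by norm_num) le_rfl
    have k5 : max 0 (Real.log |h|) ≤ |Real.log (|h|)| := max_le (abs_nonneg _) (le_abs_self _)
    linarith
  have hL : 1 ≤ logPlus |x| := le_max_left _ _
  have hH : 0 ≤ |Real.log (|h|)| := abs_nonneg _
  have hH2 : -Real.log |h| ≤ |Real.log (|h|)| := neg_le_abs _
  rw [hI]
  generalize logPlus |x| = L at *
  generalize |Real.log (|h|)| = H at *
  have key : |avgI f p q| ≤ 60 * starNorm f * (L * (1 + H)) := by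
    have t1 : |avgI f p q| ≤ |avgI f p q - avgI f (-T) T| + |avgI f (-1) 1 - avgI f (-T) T|
        + |avgI f (-1) 1| := by
      have u1 := abs_add_le (avgI f p q - avgI f (-T) T) (avgI f (-T) T)
      have u2 := abs_sub_abs_le_abs_sub (avgI f (-T) T) (avgI f (-1) 1)
      rw [abs_sub_comm] at u2
      rw [sub_add_cancel] at u1
      linarith
    have g1 : 1 ≤ L * (1 + H) := by nlinarith
    have g2 : (4 + 4 * (Real.log 2 + Real.log T - Real.log |h|)) + (4 + 4 * Real.log T)
        ≤ 60 * (L * (1 + H)) := by nlinarith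
    have g3 := mul_le_mul_of_nonneg_right g2 hM
    unfold starNorm
    nlinarith
  calc |h| * |avgI f p q| ≤ |h| * (60 * starNorm f * (L * (1 + H))) :=
        mul_le_mul_of_nonneg_left key hhp.le
    _ = _ := by ring
end

section
/- Suppose b ∈ L¹_loc(ℝ) is locally absolutely continuous with derivative b' ∈ BMO(ℝ). Then for all x ∈ ℝ, y ≠ 0 and z ≠ 0 one has |(b(x+y) − b(x))/y − (b(x+z) − b(x))/z| ≤ 5 ‖b'‖_BMO + (‖b'‖_BMO / log 2) |log(|y|/|z|)|. -/
open MeasureTheory Set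

open MeasureTheory Set

lemma osc_aux (f : ℝ → ℝ) (hf : MemBMO f) (a c b : ℝ) (hac : a < c) (hcb : c < b) :
    2 * (c - a) * |avgI f a c - avgI f a b| ≤ (b - a) * bmoNorm f ∧
    2 * (b - c) * |avgI f c b - avgI f a b| ≤ (b - a) * bmoNorm f := by
  have hi : ∀ u v : ℝ, IntervalIntegrable f volume u v := fun u v =>
    (hf.1.integrableOn_isCompact isCompact_uIcc).intervalIntegrable
  have hm : ∀ u v : ℝ, u ≠ v → ∫ x in u..v, f x = (v - u) * avgI f u v := by
    intro u v h
    have : v - u ≠ 0 := sub_ne_zero.2 h.symm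
    unfold avgI
    field_simp
  have hN : avgI (fun x => |f x - avgI f a b|) a b ≤ bmoNorm f :=
    le_csSup hf.2 ⟨a, b, hac.trans hcb, rfl⟩
  have hba : 0 < b - a := by linarith
  generalize hmm : avgI f a b = m at *
  have hg : ∀ u v : ℝ, IntervalIntegrable (fun x => f x - m) volume u v :=
    fun u v => (hi u v).sub intervalIntegrable_const
  have hI : ∫ x in a..b, |f x - m| ≤ (b - a) * bmoNorm f := by
    unfold avgI at hN
    rwa [inv_mul_le_iff₀ hba] at hN
  have hP : ∀ u v : ℝ, u < v → (v - u) * |avgI f u v - m| ≤ ∫ x in u..v, |f x - m| := by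
    intro u v h
    have h1 := intervalIntegral.abs_integral_le_integral_abs (f := fun x => f x - m) (μ := volume) h.le
    rw [intervalIntegral.integral_sub (hi u v) intervalIntegrable_const, hm u v h.ne,
      intervalIntegral.integral_const, smul_eq_mul, ← mul_sub, abs_mul,
      abs_of_pos (sub_pos.2 h)] at h1
    exact h1
  have hadd := intervalIntegral.integral_add_adjacent_intervals (hg a c).abs (hg c b).abs
  have hadd2 := intervalIntegral.integral_add_adjacent_intervals (hi a c) (hi c b)
  rw [hm a c hac.ne, hm c b hcb.ne, hm a b (hac.trans hcb).ne, hmm] at hadd2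
  have h1 := hP a c hac
  have h2 := hP c b hcb
  have heq : (c - a) * |avgI f a c - m| = (b - c) * |avgI f c b - m| := by
    have : (c - a) * (avgI f a c - m) = -((b - c) * (avgI f c b - m)) := by linarith
    have h3 := congrArg abs this
    rwa [abs_neg, abs_mul, abs_mul, abs_of_pos (sub_pos.2 hac), abs_of_pos (sub_pos.2 hcb)] at h3
  constructor <;> linarith

lemma chain_aux (A : ℝ → ℝ) (N : ℝ) (hN : 0 ≤ N)
    (h : ∀ z y, 0 < z → z < y → 2 * z * |A z - A y| ≤ y * N) (z y : ℝ) (hz : 0 < z) (hzy : z ≤ y) :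
    |A z - A y| ≤ N + N / Real.log 2 * Real.log (y / z) := by
  have hl : 0 < Real.log 2 := Real.log_pos (by norm_num)
  have key : ∀ n : ℕ, ∀ y, z ≤ y → y ≤ 2 ^ n * (2 * z) →
      |A z - A y| ≤ N + N / Real.log 2 * Real.log (y / z) := by
    have base : ∀ y, z ≤ y → y ≤ 2 * z → |A z - A y| ≤ N + N / Real.log 2 * Real.log (y / z) := by
      intro y h1 h2
      have : 0 ≤ N / Real.log 2 * Real.log (y / z) :=
        mul_nonneg (by positivity) (Real.log_nonneg (by rwa [one_le_div hz]))
      suffices |A z - A y| ≤ N by linarith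
      rcases h1.eq_or_lt with rfl | h1
      · simpa
      · have := h z y hz h1
        have h3 : 2 * z * |A z - A y| ≤ 2 * z * N := this.trans (by gcongr)
        exact le_of_mul_le_mul_left h3 (by positivity)
    intro n
    induction n with
    | zero => intro y h1 h2; exact base y h1 (by simpa using h2)
    | succ n ih =>
      intro y h1 h2
      rcases le_total y (2 * z) with h3 | h3
      · exact base y h1 h3
      · have i1 := ih (y / 2) (by linarith) (by rw [pow_succ] at h2; linarith)
        have hy : 0 < y := by linarith
        have i2 := h (y / 2) y (by positivity) (by linarith)
        have i3 : |A (y / 2) - A y| ≤ N := le_of_mul_le_mul_left (by linarith) hy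
        have i4 : Real.log (y / 2 / z) = Real.log (y / z) - Real.log 2 := by
          rw [← Real.log_div (by positivity) (by norm_num)]; congr 1; field_simp
        have i5 : N / Real.log 2 * Real.log (y / 2 / z)
            = N / Real.log 2 * Real.log (y / z) - N := by
          rw [i4]; field_simp
        have := abs_sub_le (A z) (A (y / 2)) (A y)
        linarith
  obtain ⟨n, hn⟩ := pow_unbounded_of_one_lt (y / (2 * z)) (one_lt_two)
  exact key n y hzy ((div_le_iff₀ (by positivity)).1 hn.le)

lemma chain_aux2 (A : ℝ → ℝ) (N : ℝ) (hN : 0 ≤ N)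
    (h : ∀ z y, 0 < z → z < y → 2 * z * |A z - A y| ≤ y * N) (y z : ℝ) (hy : 0 < y) (hz : 0 < z) :
    |A y - A z| ≤ N + N / Real.log 2 * |Real.log (y / z)| := by
  have hl : 0 < Real.log 2 := Real.log_pos (by norm_num)
  rcases le_total z y with h1 | h1
  · rw [abs_sub_comm]
    refine (chain_aux A N hN h z y hz h1).trans ?_
    gcongr
    exact le_abs_self _
  · refine (chain_aux A N hN h y z hy h1).trans ?_
    rw [← inv_div y z, Real.log_inv]
    gcongr
    exact neg_le_abs _

/-- Reimann's difference-quotient estimate for `b` locally absolutely continuous with derivative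
`b' ∈ BMO(ℝ)`. -/
theorem diff_quot_est_of_bmo_deriv (b b' : ℝ → ℝ)
    (hb : MeasureTheory.LocallyIntegrable b MeasureTheory.volume)
    (hb' : MemBMO b')
    (hftc : ∀ x y : ℝ, b y - b x = ∫ z in x..y, b' z) :
    ∀ x y z : ℝ, y ≠ 0 → z ≠ 0 →
      |(b (x + y) - b x) / y - (b (x + z) - b x) / z| ≤
        5 * bmoNorm b' + (bmoNorm b' / Real.log 2) * |Real.log (|y| / |z|)| := by
  intro x y z hy hz
  have hA : ∀ s, (b (x + s) - b x) / s = avgI b' x (x + s) := by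
    intro s
    rw [hftc, avgI, add_sub_cancel_left, div_eq_inv_mul]
  have hsymm : ∀ u v, avgI b' u v = avgI b' v u := by
    intro u v
    rw [avgI, avgI, intervalIntegral.integral_symm, ← neg_sub, inv_neg]
    ring
  rw [hA, hA]
  set A : ℝ → ℝ := fun s => avgI b' x (x + s) with hAdef
  change |A y - A z| ≤ _
  set N := bmoNorm b'
  have hN : 0 ≤ N := by
    have := (osc_aux b' hb' 0 1 2 (by norm_num) (by norm_num)).1
    have h2 : 0 ≤ 2 * (1 - (0:ℝ)) * |avgI b' 0 1 - avgI b' 0 2| := by norm_num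
    change _ ≤ (2 - 0) * N at this
    linarith
  have hp : ∀ z y, 0 < z → z < y → 2 * z * |A z - A y| ≤ y * N := by
    intro z y h1 h2
    have := (osc_aux b' hb' x (x + z) (x + y) (by linarith) (by linarith)).1
    simpa only [add_sub_cancel_left] using this
  have hn : ∀ z y, 0 < z → z < y → 2 * z * |A (-z) - A (-y)| ≤ y * N := by
    intro z y h1 h2
    have := (osc_aux b' hb' (x + -y) (x + -z) x (by linarith) (by linarith)).2
    rw [hsymm _ x, hsymm _ x] at this
    have e1 : x - (x + -z) = z := by ring
    have e2 : x - (x + -y) = y := by ring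
    rwa [e1, e2] at this
  have hs : ∀ y, 0 < y → |A y - A (-y)| ≤ 2 * N := by
    intro y h1
    obtain ⟨i1, i2⟩ := osc_aux b' hb' (x + -y) x (x + y) (by linarith) (by linarith)
    rw [hsymm _ x] at i1
    have e1 : x - (x + -y) = y := by ring
    have e2 : x + y - (x + -y) = y * 2 := by ring
    have e3 : x + y - x = y := by ring
    rw [e1, e2] at i1
    rw [e3, e2] at i2
    have j1 : |A (-y) - avgI b' (x + -y) (x + y)| ≤ N :=
      le_of_mul_le_mul_left (a := y * 2) (by linarith) (by positivity)
    have j2 : |A y - avgI b' (x + -y) (x + y)| ≤ N :=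
      le_of_mul_le_mul_left (a := y * 2) (by linarith) (by positivity)
    rw [abs_sub_comm] at j1
    linarith [abs_sub_le (A y) (avgI b' (x + -y) (x + y)) (A (-y))]
  have cp := chain_aux2 A N hN hp
  have cn := chain_aux2 (fun s => A (-s)) N hN hn
  have hred : ∀ t, t ≠ 0 → |A t - A (|t|)| ≤ 2 * N := by
    intro t ht
    rcases lt_or_gt_of_ne ht with h | h
    · rw [abs_of_neg h, abs_sub_comm]
      simpa using hs (-t) (by linarith)
    · rw [abs_of_pos h]; simpa using hN
  have h0 := cp |y| |z| (abs_pos.2 hy) (abs_pos.2 hz)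
  have h1 := hred y hy
  have h2 := hred z hz
  rw [abs_sub_comm] at h2
  have h3 := abs_sub_le (A y) (A (|y|)) (A z)
  have h4 := abs_sub_le (A (|y|)) (A (|z|)) (A z)
  linarith
end

section
/- Let v be a locally integrable function on ℝ, let I ⊂ ℝ be a bounded interval, and let c₁, c₂, M > 0 be constants such that |{x ∈ I : |v(x) − v_I| > λ}| ≤ c₁ |I| exp(−c₂ λ / M) for all λ > 0. If M < c₂, then |I|⁻¹ ∫_I e^{v(x) − v_I} dx ≤ 1 + c₁ M / (c₂ − M). -/
open MeasureTheory Set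

/-- If `v` satisfies a John–Nirenberg type distribution estimate on the interval `(a,b)` with
constants `c₁, c₂` and `M < c₂`, then the average of `e^{v - v_I}` over the interval is at most
`1 + c₁ M / (c₂ - M)`. -/
theorem exp_avg_est_of_jn (v : ℝ → ℝ) (a b : ℝ) (hab : a < b)
    (hv : MeasureTheory.IntegrableOn v (Set.Ioo a b) MeasureTheory.volume)
    (c₁ c₂ M : ℝ) (hc₁ : 0 < c₁) (hc₂ : 0 < c₂) (hM : 0 < M)
    (hjn : ∀ lam : ℝ, 0 < lam →
      (MeasureTheory.volume {x ∈ Set.Ioo a b | |v x - avgI v a b| > lam}).toReal ≤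
        c₁ * (b - a) * Real.exp (-(c₂ * lam) / M))
    (hMc : M < c₂) :
    (b - a)⁻¹ * ∫ x in a..b, Real.exp (v x - avgI v a b) ≤ 1 + c₁ * M / (c₂ - M) := by
  set A := avgI v a b with hA
  have hba : 0 < b - a := sub_pos.2 hab
  have hd : 0 < c₂ - M := sub_pos.2 hMc
  set μ : Measure ℝ := volume.restrict (Ioo a b) with hμ
  set f : ℝ → ℝ := fun x => |v x - A| with hf
  have hvm : AEMeasurable v μ := hv.aestronglyMeasurable.aemeasurable
  have hfm : AEMeasurable f μ := by
    have h1 : AEMeasurable (fun x => v x - A) μ := hvm.sub_const A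
    exact continuous_abs.measurable.comp_aemeasurable h1
  have hem : AEStronglyMeasurable (fun x => Real.exp (v x - A)) μ :=
    (Real.measurable_exp.comp_aemeasurable (hvm.sub_const A)).aestronglyMeasurable
  have key := lintegral_comp_eq_lintegral_meas_lt_mul (f := f) (g := Real.exp) μ
    (Filter.Eventually.of_forall fun x => abs_nonneg _) hfm
    (fun t _ => Real.continuous_exp.intervalIntegrable _ _)
    (Filter.Eventually.of_forall fun t => (Real.exp_pos t).le)
  simp only [integral_exp, Real.exp_zero] at key
  set β : ℝ := (c₂ - M) / M with hβ
  have hβ0 : 0 < β := div_pos hd hM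
  have hμt : ∀ t ∈ Ioi (0:ℝ), μ {x | t < f x} * ENNReal.ofReal (Real.exp t) ≤
      ENNReal.ofReal (c₁ * (b - a) * Real.exp (-β * t)) := by
    intro t ht
    have h1 : μ {x | t < f x} = volume {x ∈ Ioo a b | |v x - A| > t} := by
      rw [hμ, Measure.restrict_apply' measurableSet_Ioo]
      congr 1
      ext x
      simp only [hf, mem_inter_iff, mem_setOf_eq, gt_iff_lt]
      tauto
    have hfin : volume {x ∈ Ioo a b | |v x - A| > t} ≠ ⊤ :=
      measure_ne_top_of_subset (fun x hx => hx.1) (by simp : volume (Ioo a b) ≠ ⊤)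
    have h2 := hjn t ht
    rw [h1, ← ENNReal.ofReal_toReal hfin, ← ENNReal.ofReal_mul ENNReal.toReal_nonneg]
    apply ENNReal.ofReal_le_ofReal
    refine (mul_le_mul_of_nonneg_right h2 (Real.exp_pos t).le).trans (le_of_eq ?_)
    rw [mul_assoc, ← Real.exp_add]
    congr 2
    rw [hβ]
    field_simp
    ring
  have hint : IntegrableOn (fun t => c₁ * (b - a) * Real.exp (-β * t)) (Ioi 0) :=
    (exp_neg_integrableOn_Ioi 0 hβ0).const_mul _
  have hval : ∫ t in Ioi (0:ℝ), c₁ * (b - a) * Real.exp (-β * t) =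
      c₁ * (b - a) * (M / (c₂ - M)) := by
    rw [integral_const_mul, integral_exp_mul_Ioi (by linarith : -β < 0) 0]
    congr 1
    rw [hβ]
    simp
  have hB : ∫⁻ x, ENNReal.ofReal (Real.exp (f x) - 1) ∂μ ≤
      ENNReal.ofReal (c₁ * (b - a) * (M / (c₂ - M))) := by
    rw [key, ← hval, ofReal_integral_eq_lintegral_ofReal hint
      (Filter.Eventually.of_forall fun t => by positivity)]
    exact setLIntegral_mono' measurableSet_Ioi hμt
  have hC : ∫⁻ x, ENNReal.ofReal (Real.exp (v x - A)) ∂μ ≤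
      ENNReal.ofReal ((b - a) + c₁ * (b - a) * (M / (c₂ - M))) := by
    calc _ ≤ ∫⁻ x, (1 + ENNReal.ofReal (Real.exp (f x) - 1)) ∂μ := by
          apply lintegral_mono
          intro x
          have h0 : 0 ≤ Real.exp (f x) - 1 := by
            have := Real.one_le_exp (abs_nonneg (v x - A))
            simp only [hf]; linarith
          have : Real.exp (v x - A) ≤ Real.exp (f x) := Real.exp_le_exp.2 (le_abs_self _)
          dsimp only
          rw [← ENNReal.ofReal_one, ← ENNReal.ofReal_add zero_le_one h0]
          apply ENNReal.ofReal_le_ofReal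
          linarith
      _ = ENNReal.ofReal (b - a) + ∫⁻ x, ENNReal.ofReal (Real.exp (f x) - 1) ∂μ := by
          rw [lintegral_add_left measurable_const]
          simp [hμ]
      _ ≤ _ := by
          rw [ENNReal.ofReal_add hba.le (by positivity)]
          gcongr
  have hD : ∫ x in a..b, Real.exp (v x - A) ≤ (b - a) + c₁ * (b - a) * (M / (c₂ - M)) := by
    rw [intervalIntegral.integral_of_le hab.le, integral_Ioc_eq_integral_Ioo,
      integral_eq_lintegral_of_nonneg_ae
        (Filter.Eventually.of_forall fun x => (Real.exp_pos _).le) hem]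
    exact ENNReal.toReal_le_of_le_ofReal (by positivity) hC
  calc _ ≤ (b - a)⁻¹ * ((b - a) + c₁ * (b - a) * (M / (c₂ - M))) := by gcongr
    _ = _ := by field_simp
end
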